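/- Let n ≥ 3. For x ∈ B^n and a unit vector ℓ ∈ S^{n-1}, let C(x,ℓ) be the smallest constant such that |⟨∇u(x), ℓ⟩| ≤ C(x,ℓ) sup_{B^n}|u| for all bounded harmonic u on B^n, and let C(x) be the smallest constant such that |∇u(x)| ≤ C(x) sup_{B^n}|u| for all such u. Then for every x ∈ B^n \ {0}: C(x) = C(x, x/|x|), i.e., the supremum of C(x,ℓ) over unit vectors ℓ is attained at the outward radial direction. -/

import Mathlib

open scoped Real BigOperators

/-- Pochhammer symbol `(lam)_m`. -/
noncomputable def poch (lam : ℝ) (m : ℕ) : ℝ := (ascPochhammer ℝ m).eval lam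

/-- Gegenbauer polynomial `C_k^lam(x)`, via its explicit representation. -/
noncomputable def gegen (lam : ℝ) (k : ℕ) (x : ℝ) : ℝ :=
  ∑ j ∈ Finset.range (k / 2 + 1),
    (-1 : ℝ) ^ j * poch lam (k - j) / ((Nat.factorial j : ℝ) * (Nat.factorial (k - 2 * j) : ℝ))
      * (2 * x) ^ (k - 2 * j)

/-- `u` is harmonic on the open unit ball of `ℝⁿ`: twice continuously differentiable
with vanishing Laplacian. -/
def IsHarmonicOnBall (n : ℕ) (u : EuclideanSpace ℝ (Fin n) → ℝ) : Prop :=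
  ContDiffOn ℝ 2 u (Metric.ball 0 1) ∧
  ∀ x ∈ Metric.ball (0 : EuclideanSpace ℝ (Fin n)) 1,
    ∑ i : Fin n, iteratedFDeriv ℝ 2 u x
      ![EuclideanSpace.single i 1, EuclideanSpace.single i 1] = 0

/-- The sup of `|u|` over the open unit ball. -/
noncomputable def supAbs (n : ℕ) (u : EuclideanSpace ℝ (Fin n) → ℝ) : ℝ :=
  ⨆ y : Metric.ball (0 : EuclideanSpace ℝ (Fin n)) 1, |u y.1|


open scoped RealInnerProductSpace

/-- The sharp constant for the directional derivative estimate at `x` in direction `ℓ`. -/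
noncomputable def dirConst (n : ℕ) (x ℓ : EuclideanSpace ℝ (Fin n)) : ℝ :=
  sInf {c : ℝ | ∀ u : EuclideanSpace ℝ (Fin n) → ℝ, IsHarmonicOnBall n u →
    (∃ M : ℝ, ∀ y ∈ Metric.ball (0 : EuclideanSpace ℝ (Fin n)) 1, |u y| ≤ M) →
    |⟪gradient u x, ℓ⟫| ≤ c * supAbs n u}

/-- The sharp constant for the gradient estimate at `x`. -/
noncomputable def gradConst (n : ℕ) (x : EuclideanSpace ℝ (Fin n)) : ℝ :=
  sInf {c : ℝ | ∀ u : EuclideanSpace ℝ (Fin n) → ℝ, IsHarmonicOnBall n u →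
    (∃ M : ℝ, ∀ y ∈ Metric.ball (0 : EuclideanSpace ℝ (Fin n)) 1, |u y| ≤ M) →
    ‖gradient u x‖ ≤ c * supAbs n u}

open MeasureTheory Set Metric Module Filter Topology
open scoped ENNReal

set_option linter.unusedSectionVars false

section SphereMeasure

variable {E : Type*} [NormedAddCommGroup E] [InnerProductSpace ℝ E] [FiniteDimensional ℝ E]
  [MeasurableSpace E] [BorelSpace E]

/-- The rotation invariant probability measure on the unit sphere, seen as a measure on the
ambient space. -/
noncomputable def sphereMeasure (E : Type*) [NormedAddCommGroup E] [InnerProductSpace ℝ E]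
    [FiniteDimensional ℝ E] [MeasurableSpace E] [BorelSpace E] : Measure E :=
  ((volume (ball (0 : E) 1))⁻¹ • volume.restrict (ball (0 : E) 1)).map fun w => ‖w‖⁻¹ • w

theorem measurable_normalize {E : Type*} [NormedAddCommGroup E] [NormedSpace ℝ E]
    [MeasurableSpace E] [BorelSpace E] [SecondCountableTopology E] :
    Measurable fun w : E => ‖w‖⁻¹ • w := by
  fun_prop

instance : IsProbabilityMeasure (sphereMeasure E) := by
  constructor
  rw [sphereMeasure, Measure.map_apply measurable_normalize MeasurableSet.univ]
  simp only [preimage_univ, Measure.smul_apply, Measure.restrict_apply_univ, smul_eq_mul]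
  exact ENNReal.inv_mul_cancel (measure_ball_pos _ _ one_pos).ne' measure_ball_lt_top.ne

theorem lintegral_sphereMeasure {g : E → ℝ≥0∞} (hg : Measurable g) :
    ∫⁻ ζ, g ζ ∂sphereMeasure E =
      (volume (ball (0 : E) 1))⁻¹ * ∫⁻ w in ball (0 : E) 1, g (‖w‖⁻¹ • w) := by
  rw [sphereMeasure, lintegral_map hg measurable_normalize, lintegral_smul_measure, smul_eq_mul]

theorem ae_norm_eq_one [Nontrivial E] : ∀ᵐ ζ ∂sphereMeasure E, ‖ζ‖ = 1 := by
  rw [sphereMeasure, ae_map_iff measurable_normalize.aemeasurable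
    (measurableSet_eq_fun measurable_norm measurable_const)]
  refine Measure.ae_smul_measure (ae_restrict_of_ae ?_) _
  filter_upwards [compl_mem_ae_iff.2 (measure_singleton (0 : E))] with w hw
  rw [norm_smul, norm_inv, norm_norm, inv_mul_cancel₀ (norm_ne_zero_iff.2 hw)]

theorem measurePreserving_sphereMeasure (L : E ≃ₗᵢ[ℝ] E) :
    MeasurePreserving L (sphereMeasure E) (sphereMeasure E) := by
  refine ⟨L.continuous.measurable, ?_⟩
  have h1 : Measure.map L (volume.restrict (ball (0 : E) 1)) = volume.restrict (ball 0 1) := by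
    have := (L.measurePreserving.restrict_preimage (s := ball (0 : E) 1) measurableSet_ball).map_eq
    rwa [show L ⁻¹' ball (0 : E) 1 = ball 0 1 by ext; simp] at this
  rw [sphereMeasure, Measure.map_map L.continuous.measurable measurable_normalize]
  conv_rhs => rw [← h1, ← Measure.map_smul,
    Measure.map_map measurable_normalize L.continuous.measurable]
  congr 1
  ext w
  simp

theorem integral_comp_sphereMeasure (L : E ≃ₗᵢ[ℝ] E) (f : E → ℝ) :
    ∫ ζ, f (L ζ) ∂sphereMeasure E = ∫ ζ, f ζ ∂sphereMeasure E :=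
  (measurePreserving_sphereMeasure L).integral_comp' (f := L.toHomeomorph.toMeasurableEquiv) f

theorem ae_inner_ne_zero {v : E} (hv : v ≠ 0) : ∀ᵐ ζ ∂sphereMeasure E, ⟪v, ζ⟫ ≠ 0 := by
  have hm : MeasurableSet {ζ : E | ⟪v, ζ⟫ ≠ 0} :=
    (measurableSet_eq_fun (by fun_prop) measurable_const).compl
  rw [sphereMeasure, ae_map_iff measurable_normalize.aemeasurable hm]
  refine Measure.ae_smul_measure (ae_restrict_of_ae ?_) _
  have h0 : volume (((ℝ ∙ v)ᗮ : Submodule ℝ E) : Set E) = 0 := by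
    apply Measure.addHaar_submodule
    intro h
    have : v ∈ (ℝ ∙ v)ᗮ := h ▸ Submodule.mem_top
    exact hv (inner_self_eq_zero.1 (Submodule.mem_orthogonal_singleton_iff_inner_right.1 this))
  filter_upwards [measure_eq_zero_iff_ae_notMem.1 h0] with w hw h
  apply hw
  rw [SetLike.mem_coe, Submodule.mem_orthogonal_singleton_iff_inner_right]
  rw [inner_smul_right] at h
  rcases mul_eq_zero.1 h with h | h
  · rw [inv_eq_zero, norm_eq_zero] at h
    simp [h]
  · exact h

theorem setLIntegral_normalize_eq_toSphere [Nontrivial E] {g : E → ℝ≥0∞} (hg : Measurable g)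
    {R : E → ℝ} (hR : Measurable R) (hpos : ∀ ζ : E, ‖ζ‖ = 1 → 0 < R ζ) :
    ∫⁻ w in {w : E | ‖w‖ < R (‖w‖⁻¹ • w)}, g (‖w‖⁻¹ • w) =
      ∫⁻ ω, g ω * ENNReal.ofReal (R ω ^ finrank ℝ E / finrank ℝ E)
        ∂(volume : Measure E).toSphere := by
  have hms : MeasurableSet {w : E | ‖w‖ < R (‖w‖⁻¹ • w)} :=
    measurableSet_lt measurable_norm (hR.comp measurable_normalize)
  have hpr := (volume : Measure E).measurePreserving_homeomorphUnitSphereProd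
  rw [← lintegral_indicator hms]
  set F : E → ℝ≥0∞ := indicator {w : E | ‖w‖ < R (‖w‖⁻¹ • w)} fun w => g (‖w‖⁻¹ • w) with hF
  have hFm : Measurable F := (hg.comp measurable_normalize).indicator hms
  have e1 : ∫⁻ w, F w = ∫⁻ w : ({0}ᶜ : Set E), F w ∂((volume : Measure E).comap Subtype.val) := by
    rw [lintegral_subtype_comap (measurableSet_singleton (0 : E)).compl,
      restrict_compl_singleton]
  have e2 : ∫⁻ w : ({0}ᶜ : Set E), F w ∂((volume : Measure E).comap Subtype.val) =
      ∫⁻ p, F ((homeomorphUnitSphereProd E).symm p)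
        ∂((volume : Measure E).toSphere.prod (Measure.volumeIoiPow (finrank ℝ E - 1))) := by
    have h := hpr.lintegral_comp
      (hFm.comp (measurable_subtype_coe.comp (homeomorphUnitSphereProd E).symm.measurable))
    simpa using h
  rw [e1, e2, lintegral_prod]
  · refine lintegral_congr fun ω => ?_
    have hω : ‖(ω : E)‖ = 1 := by simp
    have h3 : ∀ t : Ioi (0 : ℝ), F ((homeomorphUnitSphereProd E).symm (ω, t)) =
        indicator (Iio (⟨R ω, hpos ω hω⟩ : Ioi (0 : ℝ))) (fun _ => g ω) t := by
      intro t
      have ht : (0 : ℝ) < t := t.2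
      have h4 : (((homeomorphUnitSphereProd E).symm (ω, t) : ({0}ᶜ : Set E)) : E)
        = (t : ℝ) • (ω : E) := by simp
      have h5 : ‖(t : ℝ) • (ω : E)‖ = t := by rw [norm_smul, hω]; simp [abs_of_pos ht]
      have h6 : (t : ℝ)⁻¹ • (t : ℝ) • (ω : E) = ω := by
        rw [smul_smul, inv_mul_cancel₀ ht.ne', one_smul]
      rw [h4, hF]
      simp only [indicator, mem_ofPred_eq, h5, h6, mem_Iio, ← Subtype.coe_lt_coe]
    simp_rw [h3]
    rw [lintegral_indicator_const measurableSet_Iio, Measure.volumeIoiPow_apply_Iio,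
      Nat.sub_add_cancel finrank_pos, Nat.cast_pred finrank_pos, sub_add_cancel]
  · exact (hFm.comp (measurable_subtype_coe.comp
      (homeomorphUnitSphereProd E).symm.measurable)).aemeasurable

theorem setLIntegral_normalize_radial [Nontrivial E] {g : E → ℝ≥0∞} (hg : Measurable g)
    {R : E → ℝ} (hR : Measurable R) (hpos : ∀ ζ : E, ‖ζ‖ = 1 → 0 < R ζ) :
    ∫⁻ w in {w : E | ‖w‖ < R (‖w‖⁻¹ • w)}, g (‖w‖⁻¹ • w) =
      ∫⁻ w in ball (0 : E) 1, g (‖w‖⁻¹ • w) *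
        ENNReal.ofReal (R (‖w‖⁻¹ • w) ^ finrank ℝ E) := by
  have hb : ball (0 : E) 1 = {w : E | ‖w‖ < (fun _ : E => (1 : ℝ)) (‖w‖⁻¹ • w)} := by
    ext; simp
  rw [hb, setLIntegral_normalize_eq_toSphere hg hR hpos,
    setLIntegral_normalize_eq_toSphere (g := fun ζ => g ζ * ENNReal.ofReal (R ζ ^ finrank ℝ E))
      (hg.mul (ENNReal.measurable_ofReal.comp (hR.pow_const _))) measurable_const
      (fun _ _ => one_pos)]
  refine lintegral_congr fun ω => ?_
  have hω : ‖(ω : E)‖ = 1 := by simp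
  rw [mul_assoc, ← ENNReal.ofReal_mul (pow_nonneg (hpos ω hω).le _)]
  simp [div_eq_mul_inv]

end SphereMeasure

section RayJacobian

variable {E : Type*} [NormedAddCommGroup E] [InnerProductSpace ℝ E]

/-- The discriminant `√(⟪x, θ⟫² + 1 - ‖x‖²)` of the chord through `x` in the direction `θ`. -/
noncomputable def rayDisc (x θ : E) : ℝ := √(⟪x, θ⟫ ^ 2 + (1 - ‖x‖ ^ 2))

/-- The distance from `x` to the unit sphere in the direction `θ`. -/
noncomputable def rayLen (x θ : E) : ℝ := rayDisc x θ - ⟪x, θ⟫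

/-- The unit vector pointing from `x` to `ζ`. -/
noncomputable def dirFrom (x ζ : E) : E := ‖ζ - x‖⁻¹ • (ζ - x)

theorem one_sub_norm_sq_pos {x : E} (hx : ‖x‖ < 1) : 0 < 1 - ‖x‖ ^ 2 := by
  nlinarith [norm_nonneg x]

theorem rayDisc_sq {x : E} (hx : ‖x‖ < 1) (θ : E) :
    rayDisc x θ ^ 2 = ⟪x, θ⟫ ^ 2 + (1 - ‖x‖ ^ 2) :=
  Real.sq_sqrt (add_nonneg (sq_nonneg _) (one_sub_norm_sq_pos hx).le)

theorem rayDisc_pos {x : E} (hx : ‖x‖ < 1) (θ : E) : 0 < rayDisc x θ :=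
  Real.sqrt_pos.2 (add_pos_of_nonneg_of_pos (sq_nonneg _) (one_sub_norm_sq_pos hx))

theorem abs_inner_lt_rayDisc {x : E} (hx : ‖x‖ < 1) (θ : E) : |⟪x, θ⟫| < rayDisc x θ := by
  apply abs_lt_of_sq_lt_sq _ (rayDisc_pos hx θ).le
  rw [rayDisc_sq hx]
  linarith [one_sub_norm_sq_pos hx]

theorem rayLen_pos {x : E} (hx : ‖x‖ < 1) (θ : E) : 0 < rayLen x θ :=
  sub_pos.2 ((le_abs_self _).trans_lt (abs_inner_lt_rayDisc hx θ))

theorem rayLen_sq_add {x : E} (hx : ‖x‖ < 1) (θ : E) :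
    rayLen x θ ^ 2 + 2 * ⟪x, θ⟫ * rayLen x θ = 1 - ‖x‖ ^ 2 := by
  have := rayDisc_sq hx θ
  rw [rayLen]
  linear_combination this

theorem rayLen_eq_of_sq_add {x θ : E} (hx : ‖x‖ < 1) {ρ : ℝ} (hρ : 0 ≤ ρ)
    (h : ρ ^ 2 + 2 * ⟪x, θ⟫ * ρ = 1 - ‖x‖ ^ 2) : rayLen x θ = ρ := by
  have h0 := one_sub_norm_sq_pos hx
  have h1 : (rayLen x θ - ρ) * (rayLen x θ + ρ + 2 * ⟪x, θ⟫) = 0 := by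
    linear_combination rayLen_sq_add hx θ - h
  rcases mul_eq_zero.1 h1 with h2 | h2
  · linarith
  · have h3 := rayLen_pos hx θ
    have h4 := rayLen_sq_add hx θ
    nlinarith [mul_nonneg hρ h3.le]

theorem sub_ne_zero_of_norm {x ζ : E} (hx : ‖x‖ < 1) (hζ : ‖ζ‖ = 1) : ζ - x ≠ 0 := by
  rintro h
  rw [sub_eq_zero.1 h] at hζ
  exact hx.ne hζ

theorem rayLen_dirFrom {x ζ : E} (hx : ‖x‖ < 1) (hζ : ‖ζ‖ = 1) :
    rayLen x (dirFrom x ζ) = ‖ζ - x‖ := by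
  apply rayLen_eq_of_sq_add hx (norm_nonneg _)
  have h := norm_ne_zero_iff.2 (sub_ne_zero_of_norm hx hζ)
  rw [dirFrom, inner_smul_right]
  field_simp
  rw [norm_sub_sq_real, inner_sub_right, real_inner_self_eq_norm_sq, hζ, real_inner_comm]
  ring

theorem add_rayLen_smul_dirFrom {x ζ : E} (hx : ‖x‖ < 1) (hζ : ‖ζ‖ = 1) :
    x + rayLen x (dirFrom x ζ) • dirFrom x ζ = ζ := by
  rw [rayLen_dirFrom hx hζ, dirFrom, smul_smul,
    mul_inv_cancel₀ (norm_ne_zero_iff.2 (sub_ne_zero_of_norm hx hζ)), one_smul, add_sub_cancel]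

theorem rayLen_mul_rayDisc_dirFrom {x ζ : E} (hx : ‖x‖ < 1) (hζ : ‖ζ‖ = 1) :
    rayLen x (dirFrom x ζ) * rayDisc x (dirFrom x ζ) = 1 - ⟪x, ζ⟫ := by
  have h2 : rayDisc x (dirFrom x ζ) = rayLen x (dirFrom x ζ) + ⟪x, dirFrom x ζ⟫ := by
    rw [rayLen]; ring
  have h := norm_ne_zero_iff.2 (sub_ne_zero_of_norm hx hζ)
  rw [h2, rayLen_dirFrom hx hζ, dirFrom, inner_smul_right]
  field_simp
  rw [norm_sub_sq_real, inner_sub_right, real_inner_self_eq_norm_sq, hζ, real_inner_comm]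
  ring

theorem continuous_rayDisc (x : E) : Continuous (rayDisc x) := by
  unfold rayDisc
  fun_prop

theorem continuous_rayLen (x : E) : Continuous (rayLen x) := by
  unfold rayLen
  have := continuous_rayDisc x
  fun_prop

theorem injective_sub_norm_smul {x : E} (hx : ‖x‖ < 1) :
    Function.Injective fun w : E => w - ‖w‖ • x := by
  intro w₁ w₂ h
  have h1 : w₁ - w₂ = (‖w₁‖ - ‖w₂‖) • x := by
    simp only at h
    rw [sub_smul, sub_eq_sub_iff_sub_eq_sub]
    exact h
  have h2 : ‖w₁ - w₂‖ ≤ ‖w₁ - w₂‖ * ‖x‖ := by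
    conv_lhs => rw [h1, norm_smul]
    exact mul_le_mul_of_nonneg_right (abs_norm_sub_norm_le _ _) (norm_nonneg _)
  by_contra hne
  have h3 : 0 < ‖w₁ - w₂‖ := norm_pos_iff.2 (sub_ne_zero.2 hne)
  nlinarith

theorem norm_sub_norm_smul {x : E} (hx : ‖x‖ < 1) {w : E} (hw : w ≠ 0) :
    ‖w - ‖w‖ • x‖ = ‖w‖ * rayLen x (‖w - ‖w‖ • x‖⁻¹ • (w - ‖w‖ • x)) := by
  have hw' : 0 < ‖w‖ := norm_pos_iff.2 hw
  have hne : ‖w - ‖w‖ • x‖ ≠ 0 := by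
    rw [norm_ne_zero_iff]
    intro h
    exact hw (injective_sub_norm_smul hx (by simpa using h))
  rw [rayLen_eq_of_sq_add hx (ρ := ‖w‖⁻¹ * ‖w - ‖w‖ • x‖) (by positivity), mul_inv_cancel_left₀
    hw'.ne']
  rw [inner_smul_right]
  field_simp
  rw [norm_sub_sq_real, inner_sub_right, inner_smul_right, inner_smul_right,
    real_inner_self_eq_norm_sq, norm_smul, norm_norm, real_inner_comm x w]
  ring

theorem image_sub_norm_smul {x : E} (hx : ‖x‖ < 1) :
    (fun w : E => w - ‖w‖ • x) '' (ball 0 1 \ {0}) =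
      {u : E | ‖u‖ < rayLen x (‖u‖⁻¹ • u)} \ {0} := by
  ext u
  constructor
  · rintro ⟨w, ⟨hw1, hw0⟩, rfl⟩
    have hw0' : w ≠ 0 := hw0
    have hw1' : ‖w‖ < 1 := by simpa using hw1
    refine ⟨?_, fun h => hw0 (injective_sub_norm_smul hx (by simpa using h))⟩
    simp only [mem_ofPred_eq]
    conv_lhs => rw [norm_sub_norm_smul hx hw0']
    nlinarith [rayLen_pos hx (‖w - ‖w‖ • x‖⁻¹ • (w - ‖w‖ • x))]
  · rintro ⟨hu1, hu0⟩
    have hu0' : 0 < ‖u‖ := norm_pos_iff.2 hu0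
    simp only [mem_ofPred_eq] at hu1
    set r := rayLen x (‖u‖⁻¹ • u) with hr
    have hrpos : 0 < r := rayLen_pos hx _
    have hq := rayLen_sq_add hx (‖u‖⁻¹ • u)
    rw [← hr, inner_smul_right] at hq
    have hn : ‖u + (‖u‖ / r) • x‖ = ‖u‖ / r := by
      rw [← sq_eq_sq₀ (norm_nonneg _) (by positivity), norm_add_sq_real, inner_smul_right,
        norm_smul, Real.norm_eq_abs, abs_of_pos (by positivity), real_inner_comm]
      field_simp at hq ⊢
      linear_combination hq
    refine ⟨u + (‖u‖ / r) • x, ⟨?_, ?_⟩, ?_⟩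
    · rw [mem_ball_zero_iff, hn]
      exact (div_lt_one hrpos).2 hu1
    · intro h
      rw [mem_singleton_iff.1 h, norm_zero] at hn
      exact (div_pos hu0' hrpos).ne hn
    · simp only [hn, add_sub_cancel_right]

theorem hasFDerivAt_norm' {w : E} (hw : w ≠ 0) :
    HasFDerivAt (fun w : E => ‖w‖) (innerSL ℝ (‖w‖⁻¹ • w)) w := by
  have hw' : ‖w‖ ≠ 0 := norm_ne_zero_iff.2 hw
  have h := (hasStrictFDerivAt_norm_sq w).hasFDerivAt.sqrt (pow_ne_zero 2 hw')
  simp only [Real.sqrt_sq (norm_nonneg _)] at h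
  refine h.congr_fderiv ?_
  ext v
  simp
  field_simp

variable [FiniteDimensional ℝ E]

theorem det_id_sub_inner_smul (v x : E) :
    (ContinuousLinearMap.id ℝ E - (innerSL ℝ v).smulRight x).det = 1 - ⟪x, v⟫ := by
  have h := LinearMap.transvection.det (-(innerSL ℝ v : E →ₗ[ℝ] ℝ)) x
  simp only [LinearMap.neg_apply, ContinuousLinearMap.coe_coe, innerSL_apply_apply] at h
  rw [real_inner_comm, sub_eq_add_neg (1 : ℝ), ← h, ContinuousLinearMap.det]
  congr 1
  ext w
  simp [LinearMap.transvection.apply, sub_eq_add_neg]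

variable [MeasurableSpace E] [BorelSpace E]

theorem measurable_dirFrom (x : E) : Measurable (dirFrom x) := by
  unfold dirFrom
  fun_prop

theorem lintegral_dirFrom [Nontrivial E] {x : E} (hx : ‖x‖ < 1) {g : E → ℝ≥0∞}
    (hg : Measurable g) :
    ∫⁻ ζ, g (dirFrom x ζ) * ENNReal.ofReal (1 - ⟪x, ζ⟫) ∂sphereMeasure E =
      ∫⁻ θ, g θ * ENNReal.ofReal (rayLen x θ ^ finrank ℝ E) ∂sphereMeasure E := by
  have hm : Measurable (rayLen x) := (continuous_rayLen x).measurable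
  rw [lintegral_sphereMeasure, lintegral_sphereMeasure]
  rotate_left
  · exact hg.mul (ENNReal.measurable_ofReal.comp (hm.pow_const _))
  · exact (hg.comp (measurable_dirFrom x)).mul (ENNReal.measurable_ofReal.comp (by fun_prop))
  congr 1
  rw [← setLIntegral_normalize_radial hg hm fun ζ _ => rayLen_pos hx ζ]
  have hae : ∀ s : Set E, (s \ {0} : Set E) =ᵐ[volume] s := fun s =>
    sdiff_null_ae_eq_self (measure_singleton 0)
  rw [← setLIntegral_congr (hae {w : E | ‖w‖ < rayLen x (‖w‖⁻¹ • w)}),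
    ← setLIntegral_congr (hae (ball 0 1)), ← image_sub_norm_smul hx,
    lintegral_image_eq_lintegral_abs_det_fderiv_mul volume
      (f' := fun w => ContinuousLinearMap.id ℝ E - (innerSL ℝ (‖w‖⁻¹ • w)).smulRight x)
      (measurableSet_ball.diff (measurableSet_singleton 0)) _ (injective_sub_norm_smul hx).injOn]
  · refine setLIntegral_congr_fun (measurableSet_ball.diff (measurableSet_singleton 0)) ?_
    rintro w ⟨-, hw⟩
    have hw' : 0 < ‖w‖ := norm_pos_iff.2 hw
    have h1 : ‖‖w‖⁻¹ • w‖ = 1 := by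
      rw [norm_smul, norm_inv, norm_norm, inv_mul_cancel₀ hw'.ne']
    have h2 : 0 ≤ 1 - ⟪x, ‖w‖⁻¹ • w⟫ := by
      have := real_inner_le_norm x (‖w‖⁻¹ • w)
      rw [h1, mul_one] at this
      linarith
    have h3 : w - ‖w‖ • x = ‖w‖ • (‖w‖⁻¹ • w - x) := by
      rw [smul_sub, smul_smul, mul_inv_cancel₀ hw'.ne', one_smul]
    simp only
    rw [det_id_sub_inner_smul, abs_of_nonneg h2, mul_comm, dirFrom, h3, norm_smul, norm_norm,
      mul_inv_rev, smul_smul, mul_assoc, inv_mul_cancel₀ hw'.ne', mul_one]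
  · rintro w ⟨-, hw⟩
    exact ((hasFDerivAt_id w).sub ((hasFDerivAt_norm' hw).smul_const x)).hasFDerivWithinAt

theorem integral_dirFrom [Nontrivial E] {x : E} (hx : ‖x‖ < 1) {g : E → ℝ} (hg : Measurable g) :
    ∫ ζ, g (dirFrom x ζ) * (1 - ⟪x, ζ⟫) ∂sphereMeasure E =
      ∫ θ, g θ * rayLen x θ ^ finrank ℝ E ∂sphereMeasure E := by
  have hm : Measurable (rayLen x) := (continuous_rayLen x).measurable
  have hm1 : Measurable fun θ => (rayLen x θ ^ finrank ℝ E).toNNReal :=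
    measurable_real_toNNReal.comp (hm.pow_const _)
  have hm2 : Measurable fun ζ : E => (1 - ⟪x, ζ⟫).toNNReal :=
    measurable_real_toNNReal.comp (by fun_prop)
  have key : ((sphereMeasure E).withDensity fun ζ => ((1 - ⟪x, ζ⟫).toNNReal : ℝ≥0∞)).map
      (dirFrom x) =
      (sphereMeasure E).withDensity fun θ => ((rayLen x θ ^ finrank ℝ E).toNNReal : ℝ≥0∞) := by
    refine Measure.ext_of_lintegral _ fun f hf => ?_
    rw [lintegral_map hf (measurable_dirFrom x),
      lintegral_withDensity_eq_lintegral_mul _ hm2.coe_nnreal_ennreal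
        (g := fun ζ => f (dirFrom x ζ)) (hf.comp (measurable_dirFrom x)),
      lintegral_withDensity_eq_lintegral_mul _ hm1.coe_nnreal_ennreal hf]
    simp only [Pi.mul_apply, mul_comm _ (f _)]
    exact lintegral_dirFrom hx hf
  have h1 : ∫ θ, g θ ∂_ = ∫ θ, g θ ∂_ := congrArg (fun μ => ∫ θ, g θ ∂μ) key
  rw [integral_map (measurable_dirFrom x).aemeasurable hg.aestronglyMeasurable,
    integral_withDensity_eq_integral_smul hm2, integral_withDensity_eq_integral_smul hm1] at h1
  convert h1 using 1
  · refine integral_congr_ae ?_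
    filter_upwards [ae_norm_eq_one (E := E)] with ζ hζ
    have h2 : 0 ≤ 1 - ⟪x, ζ⟫ := by
      have := real_inner_le_norm x ζ
      rw [hζ, mul_one] at this
      linarith
    rw [NNReal.smul_def, Real.coe_toNNReal _ h2, smul_eq_mul, mul_comm]
  · refine integral_congr_ae (Eventually.of_forall fun θ => ?_)
    simp only [NNReal.smul_def, Real.coe_toNNReal _ (pow_nonneg (rayLen_pos hx θ).le _),
      smul_eq_mul, mul_comm]

end RayJacobian

section CompactIntegral

variable {E : Type*} [NormedAddCommGroup E] [MeasurableSpace E] [BorelSpace E]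
variable {F : Type*} [NormedAddCommGroup F] [NormedSpace ℝ F] [FiniteDimensional ℝ F]
variable {H : Type*} [NormedAddCommGroup H] [NormedSpace ℝ H] [FiniteDimensional ℝ H]
variable {μ : Measure E} [IsFiniteMeasure μ] {K : Set E}

theorem aestronglyMeasurable_of_continuousOn_compact (hK : IsCompact K) (hμ : ∀ᵐ ζ ∂μ, ζ ∈ K)
    {k : E → H} (hk : ContinuousOn k K) : AEStronglyMeasurable k μ := by
  rw [← Measure.restrict_eq_self_of_ae_mem hμ]
  exact hk.aestronglyMeasurable_of_isCompact hK hK.isClosed.measurableSet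

theorem integrable_mul_of_continuousOn_compact (hK : IsCompact K) (hμ : ∀ᵐ ζ ∂μ, ζ ∈ K)
    {s : E → ℝ} (hs : Measurable s) {M : ℝ}
    (hM : ∀ ζ, |s ζ| ≤ M) {k : E → H} (hk : ContinuousOn k K) :
    Integrable (fun ζ => s ζ • k ζ) μ := by
  obtain ⟨B, hB⟩ := hK.exists_bound_of_continuousOn hk
  refine Integrable.of_bound
    (hs.aestronglyMeasurable.smul (aestronglyMeasurable_of_continuousOn_compact hK hμ hk))
    (M * B) ?_
  filter_upwards [hμ] with ζ hζ
  rw [norm_smul]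
  exact mul_le_mul (hM ζ) (hB ζ hζ) (norm_nonneg _)
    ((abs_nonneg _).trans (hM ζ))

theorem integrable_of_continuousOn_compact (hK : IsCompact K) (hμ : ∀ᵐ ζ ∂μ, ζ ∈ K)
    {k : E → H} (hk : ContinuousOn k K) :
    Integrable k μ := by
  simpa using integrable_mul_of_continuousOn_compact hK hμ (s := fun _ => 1) measurable_const
    (M := 1) (by simp) hk

theorem exists_ball_bound (hK : IsCompact K) {U : Set F} (hU : IsOpen U) {k : F → E → H}
    (hk : ContinuousOn (Function.uncurry k) (U ×ˢ K)) {y : F} (hy : y ∈ U) :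
    ∃ ε > 0, ball y ε ⊆ U ∧ ∃ B, ∀ z ∈ ball y ε, ∀ ζ : E, ζ ∈ K → ‖k z ζ‖ ≤ B := by
  have : ProperSpace F := FiniteDimensional.proper_real F
  obtain ⟨ε, hε, hεU⟩ := nhds_basis_closedBall.mem_iff.1 (hU.mem_nhds hy)
  obtain ⟨B, hB⟩ := ((isCompact_closedBall y ε).prod hK
    ).exists_bound_of_continuousOn (hk.mono (prod_mono_left hεU))
  exact ⟨ε, hε, ball_subset_closedBall.trans hεU, B, fun z hz ζ hζ =>
    hB (z, ζ) ⟨ball_subset_closedBall hz, hζ⟩⟩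

theorem continuousOn_compact_of_prod {U : Set F} {k : F → E → H}
    (hk : ContinuousOn (Function.uncurry k) (U ×ˢ K)) {y : F} (hy : y ∈ U) :
    ContinuousOn (k y) K :=
  hk.comp (f := fun ζ => (y, ζ)) (by fun_prop) fun _ hζ => ⟨hy, hζ⟩

theorem continuousOn_integral_compact (hK : IsCompact K) (hμ : ∀ᵐ ζ ∂μ, ζ ∈ K)
    {U : Set F} (hU : IsOpen U) {k : F → E → H}
    (hk : ContinuousOn (Function.uncurry k) (U ×ˢ K))
    {s : E → ℝ} (hs : Measurable s) {M : ℝ} (hM : ∀ ζ, |s ζ| ≤ M) :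
    ContinuousOn (fun y => ∫ ζ, s ζ • k y ζ ∂μ) U := by
  intro y hy
  refine ContinuousAt.continuousWithinAt ?_
  obtain ⟨ε, hε, hεU, B, hB⟩ := exists_ball_bound hK hU hk hy
  refine continuousAt_of_dominated (bound := fun _ => M * B) ?_ ?_ (integrable_const _) ?_
  · filter_upwards [hU.mem_nhds hy] with z hz
    exact (integrable_mul_of_continuousOn_compact hK hμ hs hM
      (continuousOn_compact_of_prod hk hz)).aestronglyMeasurable
  · filter_upwards [ball_mem_nhds y hε] with z hz
    filter_upwards [hμ] with ζ hζ
    rw [norm_smul]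
    exact mul_le_mul (hM ζ) (hB z hz ζ hζ) (norm_nonneg _) ((abs_nonneg _).trans (hM ζ))
  · filter_upwards [hμ] with ζ hζ
    have h1 : ContinuousOn (fun z => k z ζ) U :=
      hk.comp (f := fun z => (z, ζ)) (by fun_prop) fun z hz => ⟨hz, hζ⟩
    exact continuousAt_const.smul (h1.continuousAt (hU.mem_nhds hy))

theorem hasFDerivAt_integral_compact (hK : IsCompact K) (hμ : ∀ᵐ ζ ∂μ, ζ ∈ K)
    {U : Set F} (hU : IsOpen U) {k : F → E → H}
    {k' : F → E → F →L[ℝ] H}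
    (hk : ∀ y ∈ U, ContinuousOn (k y) K)
    (hk' : ContinuousOn (Function.uncurry k') (U ×ˢ K))
    (hd : ∀ y ∈ U, ∀ ζ : E, ζ ∈ K → HasFDerivAt (fun y => k y ζ) (k' y ζ) y)
    {s : E → ℝ} (hs : Measurable s) {M : ℝ} (hM : ∀ ζ, |s ζ| ≤ M) {y : F} (hy : y ∈ U) :
    HasFDerivAt (fun y => ∫ ζ, s ζ • k y ζ ∂μ)
      (∫ ζ, s ζ • k' y ζ ∂μ) y := by
  obtain ⟨ε, hε, hεU, B, hB⟩ := exists_ball_bound hK hU hk' hy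
  refine hasFDerivAt_integral_of_dominated_of_fderiv_le (bound := fun _ => M * B)
    (F' := fun y ζ => s ζ • k' y ζ) (ball_mem_nhds y hε) ?_ ?_ ?_ ?_ (integrable_const _) ?_
  · filter_upwards [hU.mem_nhds hy] with z hz
    exact (integrable_mul_of_continuousOn_compact hK hμ hs hM (hk z hz)).aestronglyMeasurable
  · exact integrable_mul_of_continuousOn_compact hK hμ hs hM (hk y hy)
  · exact (integrable_mul_of_continuousOn_compact hK hμ hs hM
      (continuousOn_compact_of_prod hk' hy)).aestronglyMeasurable
  · filter_upwards [hμ] with ζ hζ z hz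
    rw [norm_smul]
    exact mul_le_mul (hM ζ) (hB z hz ζ hζ) (norm_nonneg _) ((abs_nonneg _).trans (hM ζ))
  · filter_upwards [hμ] with ζ hζ z hz
    exact (hd z (hεU hz) ζ hζ).const_smul (s ζ)

/-- If a weighted integral depending on a real parameter is constant, then the weighted
integral of the derivative of the integrand vanishes. -/
theorem integral_deriv_eq_zero (hK : IsCompact K) (hμ : ∀ᵐ ζ ∂μ, ζ ∈ K)
    {U : Set ℝ} (hU : IsOpen U) (h0 : (0 : ℝ) ∈ U) {k k' : ℝ → E → ℝ}
    (hk : ∀ t ∈ U, ContinuousOn (k t) K)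
    (hk' : ContinuousOn (Function.uncurry k') (U ×ˢ K))
    (hd : ∀ t ∈ U, ∀ ζ : E, ζ ∈ K → HasDerivAt (fun t => k t ζ) (k' t ζ) t)
    {s : E → ℝ} (hs : Measurable s) {M : ℝ} (hM : ∀ ζ, |s ζ| ≤ M) {c : ℝ}
    (hc : ∀ t ∈ U, ∫ ζ, s ζ * k t ζ ∂μ = c) :
    ∫ ζ, s ζ * k' 0 ζ ∂μ = 0 := by
  have hk'' : ContinuousOn (Function.uncurry fun t ζ =>
      ContinuousLinearMap.toSpanSingleton ℝ (k' t ζ)) (U ×ˢ K) :=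
    (ContinuousLinearMap.toSpanSingletonLIE ℝ ℝ).continuous.comp_continuousOn hk'
  have h1 := hasFDerivAt_integral_compact hK hμ hU hk hk''
    (fun t ht ζ hζ => (hd t ht ζ hζ).hasFDerivAt)
    hs hM h0
  have h2 : HasFDerivAt (fun t => ∫ ζ, s ζ • k t ζ ∂μ) (0 : ℝ →L[ℝ] ℝ) 0 :=
    (hasFDerivAt_const c (0 : ℝ)).congr_of_eventuallyEq
      (by filter_upwards [hU.mem_nhds h0] with t ht using hc t ht)
  have h3 := DFunLike.congr_fun (h1.unique h2) (1 : ℝ)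
  rw [ContinuousLinearMap.integral_apply (integrable_mul_of_continuousOn_compact hK hμ hs hM
      (continuousOn_compact_of_prod hk'' h0))] at h3
  simpa using h3

theorem integral_deriv_eq_zero_of_contDiffAt [NormedSpace ℝ E] (hK : IsCompact K)
    (hμ : ∀ᵐ ζ ∂μ, ζ ∈ K) {U : Set ℝ} (hU : IsOpen U) (h0 : (0 : ℝ) ∈ U) {k : ℝ → E → ℝ}
    {d : E → ℝ} (hk : ∀ t ∈ U, ∀ ζ ∈ K, ContDiffAt ℝ 1 (Function.uncurry k) (t, ζ))
    (hd : ∀ ζ ∈ K, HasDerivAt (fun t => k t ζ) (d ζ) 0)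
    {s : E → ℝ} (hs : Measurable s) {M : ℝ} (hM : ∀ ζ, |s ζ| ≤ M) {c : ℝ}
    (hc : ∀ t ∈ U, ∫ ζ, s ζ * k t ζ ∂μ = c) :
    ∫ ζ, s ζ * d ζ ∂μ = 0 := by
  have hd' : ∀ t ∈ U, ∀ ζ ∈ K, HasDerivAt (fun t => k t ζ)
      (fderiv ℝ (Function.uncurry k) (t, ζ) (1, 0)) t := fun t ht ζ hζ =>
    ((hk t ht ζ hζ).differentiableAt one_ne_zero).hasFDerivAt.comp_hasDerivAt
      (f := fun t => (t, ζ)) t ((hasDerivAt_id t).prodMk (hasDerivAt_const t ζ))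
  rw [← integral_deriv_eq_zero hK hμ hU h0
    (k' := fun t ζ => fderiv ℝ (Function.uncurry k) (t, ζ) (1, 0)) ?_ ?_ hd' hs hM hc]
  · refine integral_congr_ae ?_
    filter_upwards [hμ] with ζ hζ
    rw [(hd ζ hζ).unique (hd' 0 h0 ζ hζ)]
  · intro t ht ζ hζ
    exact ((hk t ht ζ hζ).continuousAt.comp (f := fun ζ => (t, ζ))
      (by fun_prop)).continuousWithinAt
  · rintro ⟨t, ζ⟩ ⟨ht, hζ⟩
    exact (((hk t ht ζ hζ).fderiv_right (m := 0) (by norm_num)).continuousAt.clm_apply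
      continuousAt_const).continuousWithinAt

end CompactIntegral

section ByParts

variable {E : Type*} [NormedAddCommGroup E] [InnerProductSpace ℝ E] [FiniteDimensional ℝ E]

theorem contDiffAt_rayDisc {x : E} (hx : ‖x‖ < 1) (θ : E) :
    ContDiffAt ℝ 1 (fun p : E × E => rayDisc p.1 p.2) (x, θ) := by
  unfold rayDisc
  refine ContDiffAt.sqrt ?_ ?_
  · exact ((contDiff_fst.inner ℝ contDiff_snd).pow 2).contDiffAt.add
      (contDiffAt_const.sub (contDiff_fst.norm_sq ℝ).contDiffAt)
  · have := rayDisc_pos hx θ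
    exact (Real.sqrt_pos.1 this).ne'

theorem hasDerivAt_rayLen_smul_zero (v ζ : E) :
    HasDerivAt (fun t : ℝ => rayLen (-t • v) ζ) ⟪v, ζ⟫ 0 := by
  have h1 : HasDerivAt (fun t : ℝ => (t * ⟪v, ζ⟫) ^ 2 + (1 - t ^ 2 * ‖v‖ ^ 2)) 0 0 := by
    refine HasDerivAt.congr_deriv ((((hasDerivAt_id (0 : ℝ)).mul_const ⟪v, ζ⟫).pow 2).add
      ((((hasDerivAt_id (0 : ℝ)).pow 2).mul_const (‖v‖ ^ 2)).const_sub 1)) ?_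
    simp
  have h2 := (h1.sqrt (by norm_num)).add ((hasDerivAt_id (0 : ℝ)).mul_const ⟪v, ζ⟫)
  have h3 : (fun t : ℝ => rayLen (-t • v) ζ) =
      fun t : ℝ => √((t * ⟪v, ζ⟫) ^ 2 + (1 - t ^ 2 * ‖v‖ ^ 2)) + t * ⟪v, ζ⟫ := by
    ext t
    simp [rayLen, rayDisc, inner_smul_left, norm_smul, mul_pow]
  rw [h3]
  exact h2.congr_deriv (by simp)

theorem hasDerivAt_dirFrom_smul_zero (v : E) {ζ : E} (hζ : ‖ζ‖ = 1) :
    HasDerivAt (fun t : ℝ => dirFrom (-t • v) ζ) (v - ⟪v, ζ⟫ • ζ) 0 := by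
  have h0 : ζ ≠ 0 := norm_ne_zero_iff.1 (by rw [hζ]; exact one_ne_zero)
  have h1 : HasDerivAt (fun t : ℝ => ζ + t • v) v 0 := by
    simpa using ((hasDerivAt_id (0 : ℝ)).smul_const v).const_add ζ
  have h2 : HasDerivAt (fun t : ℝ => ‖ζ + t • v‖) ⟪v, ζ⟫ 0 := by
    have := (hasFDerivAt_norm' (w := ζ + (0 : ℝ) • v) (by simpa using h0)).comp_hasDerivAt 0 h1
    exact this.congr_deriv (by simp [hζ, real_inner_comm v ζ])
  have h3 := (h2.inv (by simp [hζ])).smul h1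
  have h4 : (fun t : ℝ => dirFrom (-t • v) ζ) = fun t : ℝ => ‖ζ + t • v‖⁻¹ • (ζ + t • v) := by
    ext t
    simp [dirFrom]
  rw [h4]
  exact h3.congr_deriv (by simp [hζ, sub_eq_add_neg])

variable [MeasurableSpace E] [BorelSpace E] [Nontrivial E]

theorem ae_mem_sphere : ∀ᵐ ζ ∂sphereMeasure E, ζ ∈ sphere (0 : E) 1 := by
  filter_upwards [ae_norm_eq_one (E := E)] with ζ hζ
  simpa using hζ

/-- Integration by parts on the sphere along the projection of a constant unit vector field, with
a possibly discontinuous weight that is invariant under the flow. -/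
theorem integral_fderiv_tangential {v : E} (hv : ‖v‖ = 1) {s : E → ℝ} (hs : Measurable s) {M : ℝ}
    (hM : ∀ ζ, |s ζ| ≤ M)
    (hsv : ∀ t : ℝ, |t| < 1 → ∀ ζ : E, ‖ζ‖ = 1 → s (dirFrom (-t • v) ζ) = s ζ)
    {G : E → ℝ} (hG : ContDiff ℝ 1 G) :
    ∫ ζ, s ζ * (fderiv ℝ G ζ (v - ⟪v, ζ⟫ • ζ) - (finrank ℝ E - 1) * (⟪v, ζ⟫ * G ζ))
      ∂sphereMeasure E = 0 := by
  have hK : IsCompact (sphere (0 : E) 1) := isCompact_sphere 0 1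
  have hnorm : ∀ t ∈ Ioo (-1 : ℝ) 1, ‖-t • v‖ < 1 := by
    intro t ht
    rw [norm_smul, hv, mul_one, Real.norm_eq_abs, abs_neg]
    exact abs_lt.2 ht
  have hcont1 : ∀ t ∈ Ioo (-1 : ℝ) 1, ∀ ζ : E, ‖ζ‖ = 1 →
      ContDiffAt ℝ 1 (fun p : ℝ × E => dirFrom (-p.1 • v) p.2) (t, ζ) := by
    intro t ht ζ hζ
    unfold dirFrom
    have h1 : ContDiffAt ℝ 1 (fun p : ℝ × E => p.2 - -p.1 • v) (t, ζ) := by fun_prop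
    have h2 := sub_ne_zero_of_norm (hnorm t ht) hζ
    exact ((h1.norm ℝ h2).inv (norm_ne_zero_iff.2 h2)).smul h1
  have hcont2 : ∀ t ∈ Ioo (-1 : ℝ) 1, ∀ ζ : E,
      ContDiffAt ℝ 1 (fun p : ℝ × E => rayLen (-p.1 • v) p.2) (t, ζ) := by
    intro t ht ζ
    unfold rayLen
    have h1 : ContDiffAt ℝ 1 (fun p : ℝ × E => (-p.1 • v, p.2)) (t, ζ) := by fun_prop
    have h2 : ContDiffAt ℝ 1 (fun p : ℝ × E => rayDisc (-p.1 • v) p.2) (t, ζ) :=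
      ContDiffAt.comp (g := fun p : E × E => rayDisc p.1 p.2) (t, ζ)
        (contDiffAt_rayDisc (hnorm t ht) ζ) h1
    refine h2.sub ?_
    exact ContDiffAt.inner ℝ (by fun_prop) (by fun_prop)
  have hcd : ∀ t ∈ Ioo (-1 : ℝ) 1, ∀ ζ : E, ‖ζ‖ = 1 →
      ContDiffAt ℝ 1 (fun p : ℝ × E => G (dirFrom (-p.1 • v) p.2) * (1 - ⟪-p.1 • v, p.2⟫) -
        G p.2 * rayLen (-p.1 • v) p.2 ^ finrank ℝ E) (t, ζ) := by
    intro t ht ζ hζ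
    refine ContDiffAt.sub (ContDiffAt.mul (hG.contDiffAt.comp _ (hcont1 t ht ζ hζ)) ?_)
      (ContDiffAt.mul (hG.contDiffAt.comp _ contDiffAt_snd) ((hcont2 t ht ζ).pow _))
    exact contDiffAt_const.sub (ContDiffAt.inner ℝ (by fun_prop) (by fun_prop))
  refine integral_deriv_eq_zero_of_contDiffAt hK ae_mem_sphere isOpen_Ioo (c := 0)
    (U := Ioo (-1 : ℝ) 1) (by norm_num)
    (k := fun t ζ => G (dirFrom (-t • v) ζ) * (1 - ⟪-t • v, ζ⟫) -
      G ζ * rayLen (-t • v) ζ ^ finrank ℝ E)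
    (fun t ht ζ hζ => hcd t ht ζ (by simpa using hζ)) ?_ hs hM ?_
  · intro ζ hζ
    have hζ' : ‖ζ‖ = 1 := by simpa using hζ
    have e0 : dirFrom (-(0 : ℝ) • v) ζ = ζ := by simp [dirFrom, hζ']
    have e1 : rayLen (-(0 : ℝ) • v) ζ = 1 := by simp [rayLen, rayDisc]
    have hGd : HasFDerivAt G (fderiv ℝ G ζ) (dirFrom (-(0 : ℝ) • v) ζ) := by
      rw [e0]
      exact (hG.differentiable one_ne_zero ζ).hasFDerivAt
    have d1 := hGd.comp_hasDerivAt (0 : ℝ) (hasDerivAt_dirFrom_smul_zero v hζ')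
    have d2 : HasDerivAt (fun t : ℝ => 1 - ⟪-t • v, ζ⟫) ⟪v, ζ⟫ 0 := by
      have := ((hasDerivAt_id (0 : ℝ)).mul_const ⟪v, ζ⟫).const_add 1
      simpa [inner_smul_left] using this
    have d3 := ((hasDerivAt_rayLen_smul_zero v ζ).pow (finrank ℝ E)).const_mul (G ζ)
    refine ((d1.mul d2).sub d3).congr_deriv ?_
    simp only [Function.comp_apply, e0, e1]
    simp
    ring
  · intro t ht
    have ht' : |t| < 1 := abs_lt.2 ht
    have h := integral_dirFrom (hnorm t ht) (g := fun ζ => s ζ * G ζ)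
      (hs.mul hG.continuous.measurable)
    have c1 : ContinuousOn (fun ζ : E => G (dirFrom (-t • v) ζ) * (1 - ⟪-t • v, ζ⟫))
        (sphere 0 1) := by
      intro ζ hζ
      have h1 : ContinuousAt (fun ζ : E => dirFrom (-t • v) ζ) ζ :=
        (hcont1 t ht ζ (by simpa using hζ)).continuousAt.comp (f := fun ζ => (t, ζ))
          (by fun_prop)
      exact ((hG.continuous.continuousAt.comp h1).mul (by fun_prop)).continuousWithinAt
    have c2 : Continuous (fun ζ : E => G ζ * rayLen (-t • v) ζ ^ finrank ℝ E) :=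
      hG.continuous.mul ((continuous_rayLen _).pow _)
    have hi : ∀ {k : E → ℝ}, ContinuousOn k (sphere 0 1) →
        Integrable (fun ζ => s ζ * k ζ) (sphereMeasure E) :=
      fun hk => integrable_mul_of_continuousOn_compact hK ae_mem_sphere hs hM hk
    simp only [mul_sub (s _)]
    rw [integral_sub (hi c1) (hi c2.continuousOn), sub_eq_zero]
    simp_rw [← mul_assoc]
    rw [← h]
    refine integral_congr_ae ?_
    filter_upwards [ae_norm_eq_one (E := E)] with ζ hζ
    rw [hsv t ht' ζ hζ]

end ByParts

section Rotation

variable {E : Type*} [NormedAddCommGroup E] [InnerProductSpace ℝ E]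

theorem norm_add_smul_add_smul_sq {u v : E} (hu : ‖u‖ = 1) (hv : ‖v‖ = 1) (huv : ⟪u, v⟫ = 0)
    (ζ : E) (a b : ℝ) :
    ‖ζ + (a • u + b • v)‖ ^ 2 = ‖ζ‖ ^ 2 + 2 * (a * ⟪u, ζ⟫ + b * ⟪v, ζ⟫) + a ^ 2 + b ^ 2 := by
  rw [norm_add_sq_real, norm_add_sq_real, inner_add_right, inner_smul_right, inner_smul_right,
    norm_smul, norm_smul, inner_smul_left, inner_smul_right, huv, hu, hv, real_inner_comm u ζ,
    real_inner_comm v ζ]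
  simp
  ring

/-- Rotation by the angle `t` in the plane spanned by two orthonormal vectors. -/
noncomputable def planeRotation {u v : E} (hu : ‖u‖ = 1) (hv : ‖v‖ = 1) (huv : ⟪u, v⟫ = 0)
    (t : ℝ) : E →ₗᵢ[ℝ] E where
  toFun ζ := ζ + (((Real.cos t - 1) * ⟪u, ζ⟫ - Real.sin t * ⟪v, ζ⟫) • u +
    ((Real.cos t - 1) * ⟪v, ζ⟫ + Real.sin t * ⟪u, ζ⟫) • v)
  map_add' ζ ξ := by
    simp only [inner_add_right]
    module
  map_smul' c ζ := by
    simp only [inner_smul_right, RingHom.id_apply]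
    module
  norm_map' ζ := by
    rw [← sq_eq_sq₀ (norm_nonneg _) (norm_nonneg _)]
    change ‖ζ + (_ • u + _ • v)‖ ^ 2 = _
    rw [norm_add_smul_add_smul_sq hu hv huv]
    linear_combination (⟪u, ζ⟫ ^ 2 + ⟪v, ζ⟫ ^ 2) * Real.sin_sq_add_cos_sq t

theorem planeRotation_apply {u v : E} (hu : ‖u‖ = 1) (hv : ‖v‖ = 1) (huv : ⟪u, v⟫ = 0)
    (t : ℝ) (ζ : E) : planeRotation hu hv huv t ζ =
      ζ + (((Real.cos t - 1) * ⟪u, ζ⟫ - Real.sin t * ⟪v, ζ⟫) • u +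
    ((Real.cos t - 1) * ⟪v, ζ⟫ + Real.sin t * ⟪u, ζ⟫) • v) := rfl

theorem inner_planeRotation_left {u v : E} (hu : ‖u‖ = 1) (hv : ‖v‖ = 1) (huv : ⟪u, v⟫ = 0)
    (t : ℝ) (ζ : E) : ⟪u, planeRotation hu hv huv t ζ⟫ =
      Real.cos t * ⟪u, ζ⟫ - Real.sin t * ⟪v, ζ⟫ := by
  rw [planeRotation_apply, inner_add_right, inner_add_right, inner_smul_right, inner_smul_right,
    huv, real_inner_self_eq_norm_sq, hu]
  ring

theorem inner_planeRotation_right {u v : E} (hu : ‖u‖ = 1) (hv : ‖v‖ = 1) (huv : ⟪u, v⟫ = 0)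
    (t : ℝ) (ζ : E) : ⟪v, planeRotation hu hv huv t ζ⟫ =
      Real.sin t * ⟪u, ζ⟫ + Real.cos t * ⟪v, ζ⟫ := by
  rw [planeRotation_apply, inner_add_right, inner_add_right, inner_smul_right, inner_smul_right,
    real_inner_comm u v, huv, real_inner_self_eq_norm_sq, hv]
  ring

theorem inner_planeRotation_of_orthogonal {u v : E} (hu : ‖u‖ = 1) (hv : ‖v‖ = 1)
    (huv : ⟪u, v⟫ = 0) {w : E} (hwu : ⟪w, u⟫ = 0) (hwv : ⟪w, v⟫ = 0) (t : ℝ) (ζ : E) :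
    ⟪w, planeRotation hu hv huv t ζ⟫ = ⟪w, ζ⟫ := by
  rw [planeRotation_apply, inner_add_right, inner_add_right, inner_smul_right, inner_smul_right,
    hwu, hwv]
  ring

variable [FiniteDimensional ℝ E] [MeasurableSpace E] [BorelSpace E] [Nontrivial E]

theorem integral_comp_planeRotation {u v : E} (hu : ‖u‖ = 1) (hv : ‖v‖ = 1) (huv : ⟪u, v⟫ = 0)
    (t : ℝ) (f : E → ℝ) :
    ∫ ζ, f (planeRotation hu hv huv t ζ) ∂sphereMeasure E = ∫ ζ, f ζ ∂sphereMeasure E :=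
  integral_comp_sphereMeasure ((planeRotation hu hv huv t).toLinearIsometryEquiv rfl) f

/-- The part of the unit sphere where the `ℓ`-coordinate lies in `[a, b]`. -/
def sphereSlab (ℓ : E) (a b : ℝ) : Set E := {ζ | ‖ζ‖ = 1 ∧ ⟪ℓ, ζ⟫ ∈ Icc a b}

theorem isCompact_sphereSlab (ℓ : E) (a b : ℝ) : IsCompact (sphereSlab ℓ a b) := by
  refine (isCompact_sphere (0 : E) 1).of_isClosed_subset ?_ fun ζ hζ => by simpa using hζ.1
  exact (isClosed_eq continuous_norm continuous_const).inter
    (isClosed_Icc.preimage (f := fun ζ : E => ⟪ℓ, ζ⟫) (by fun_prop))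

theorem sq_inner_add_sq_inner_le {ℓ m : E} (hℓ : ‖ℓ‖ = 1) (hm : ‖m‖ = 1) (hlm : ⟪ℓ, m⟫ = 0)
    (ζ : E) : ⟪ℓ, ζ⟫ ^ 2 + ⟪m, ζ⟫ ^ 2 ≤ ‖ζ‖ ^ 2 := by
  have h := norm_add_smul_add_smul_sq hℓ hm hlm ζ (-⟪ℓ, ζ⟫) (-⟪m, ζ⟫)
  nlinarith [sq_nonneg ‖ζ + ((-⟪ℓ, ζ⟫) • ℓ + (-⟪m, ζ⟫) • m)‖]

/-- Integration by parts along the rotation generator in the plane of `m` and `w`. -/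
theorem setIntegral_rotation_generator {ℓ m w : E} (hℓ : ‖ℓ‖ = 1) (hm : ‖m‖ = 1) (hw : ‖w‖ = 1)
    (hlm : ⟪ℓ, m⟫ = 0) (hlw : ⟪ℓ, w⟫ = 0) (hmw : ⟪m, w⟫ = 0) {a b : ℝ} {C : ℝ → ℝ}
    (hC : Measurable C) {M : ℝ} (hM : ∀ s, |C s| ≤ M) {G G' : ℝ → ℝ → ℝ}
    (hG : ContinuousOn (Function.uncurry G) {p | p.1 ∈ Icc a b ∧ p.1 ^ 2 + p.2 ^ 2 ≤ 1})
    (hG' : ContinuousOn (Function.uncurry G') {p | p.1 ∈ Icc a b ∧ p.1 ^ 2 + p.2 ^ 2 ≤ 1})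
    (hd : ∀ s ∈ Icc a b, ∀ y, s ^ 2 + y ^ 2 ≤ 1 → HasDerivAt (G s) (G' s y) y) :
    ∫ ζ in sphereSlab ℓ a b, C ⟪ℓ, ζ⟫ *
      (⟪m, ζ⟫ * G ⟪ℓ, ζ⟫ ⟪m, ζ⟫ - ⟪w, ζ⟫ ^ 2 * G' ⟪ℓ, ζ⟫ ⟪m, ζ⟫) ∂sphereMeasure E = 0 := by
  set R := planeRotation hm hw hmw with hR
  have hRl : ∀ t ζ, ⟪ℓ, R t ζ⟫ = ⟪ℓ, ζ⟫ := inner_planeRotation_of_orthogonal hm hw hmw hlm hlw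
  have hK := isCompact_sphereSlab ℓ a b
  have hKR : ∀ t ζ, R t ζ ∈ sphereSlab ℓ a b ↔ ζ ∈ sphereSlab ℓ a b := by
    intro t ζ
    simp only [sphereSlab, mem_ofPred_eq, hRl, LinearIsometry.norm_map]
  have hmaps : ∀ t, ∀ ζ ∈ sphereSlab ℓ a b, (⟪ℓ, ζ⟫, Real.cos t * ⟪m, ζ⟫ - Real.sin t * ⟪w, ζ⟫) ∈
      {p : ℝ × ℝ | p.1 ∈ Icc a b ∧ p.1 ^ 2 + p.2 ^ 2 ≤ 1} := by
    intro t ζ hζ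
    refine ⟨hζ.2, ?_⟩
    have h := sq_inner_add_sq_inner_le hℓ hm hlm (R t ζ)
    rwa [hRl, hR, inner_planeRotation_left, LinearIsometry.norm_map, hζ.1, one_pow] at h
  have hGc : ContinuousOn (fun p : ℝ × E =>
      G ⟪ℓ, p.2⟫ (Real.cos p.1 * ⟪m, p.2⟫ - Real.sin p.1 * ⟪w, p.2⟫))
      (univ ×ˢ sphereSlab ℓ a b) :=
    hG.comp (f := fun p : ℝ × E =>
      (⟪ℓ, p.2⟫, Real.cos p.1 * ⟪m, p.2⟫ - Real.sin p.1 * ⟪w, p.2⟫)) (by fun_prop)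
      fun p hp => hmaps p.1 p.2 hp.2
  have hGc' : ContinuousOn (fun p : ℝ × E =>
      G' ⟪ℓ, p.2⟫ (Real.cos p.1 * ⟪m, p.2⟫ - Real.sin p.1 * ⟪w, p.2⟫))
      (univ ×ˢ sphereSlab ℓ a b) :=
    hG'.comp (f := fun p : ℝ × E =>
      (⟪ℓ, p.2⟫, Real.cos p.1 * ⟪m, p.2⟫ - Real.sin p.1 * ⟪w, p.2⟫)) (by fun_prop)
      fun p hp => hmaps p.1 p.2 hp.2
  have hkc : ContinuousOn (Function.uncurry fun (t : ℝ) (ζ : E) =>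
      (Real.sin t * ⟪m, ζ⟫ + Real.cos t * ⟪w, ζ⟫) *
        G ⟪ℓ, ζ⟫ (Real.cos t * ⟪m, ζ⟫ - Real.sin t * ⟪w, ζ⟫)) (univ ×ˢ sphereSlab ℓ a b) :=
    ContinuousOn.mul (by fun_prop) hGc
  have := integral_deriv_eq_zero (μ := (sphereMeasure E).restrict (sphereSlab ℓ a b)) hK
    (ae_restrict_mem hK.isClosed.measurableSet) isOpen_univ (mem_univ 0)
    (k := fun t ζ => (Real.sin t * ⟪m, ζ⟫ + Real.cos t * ⟪w, ζ⟫) *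
      G ⟪ℓ, ζ⟫ (Real.cos t * ⟪m, ζ⟫ - Real.sin t * ⟪w, ζ⟫))
    (k' := fun t ζ => (Real.cos t * ⟪m, ζ⟫ - Real.sin t * ⟪w, ζ⟫) *
      G ⟪ℓ, ζ⟫ (Real.cos t * ⟪m, ζ⟫ - Real.sin t * ⟪w, ζ⟫) +
      (Real.sin t * ⟪m, ζ⟫ + Real.cos t * ⟪w, ζ⟫) *
      (G' ⟪ℓ, ζ⟫ (Real.cos t * ⟪m, ζ⟫ - Real.sin t * ⟪w, ζ⟫) *
        (-Real.sin t * ⟪m, ζ⟫ - Real.cos t * ⟪w, ζ⟫)))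
    (fun t _ => continuousOn_compact_of_prod hkc (mem_univ t)) ?_ ?_
    (s := fun ζ => C ⟪ℓ, ζ⟫) (hC.comp (by fun_prop)) (M := M) (fun ζ => hM _)
    (c := ∫ ζ in sphereSlab ℓ a b, C ⟪ℓ, ζ⟫ * (⟪w, ζ⟫ * G ⟪ℓ, ζ⟫ ⟪m, ζ⟫) ∂sphereMeasure E) ?_
  · rw [← this]
    refine integral_congr_ae (Eventually.of_forall fun ζ => ?_)
    simp only [Real.sin_zero, Real.cos_zero]
    ring_nf
  · exact (ContinuousOn.mul (by fun_prop) hGc).add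
      (ContinuousOn.mul (by fun_prop) (hGc'.mul (by fun_prop)))
  · intro t _ ζ hζ
    have d1 := ((Real.hasDerivAt_cos t).mul_const ⟪m, ζ⟫).sub
      ((Real.hasDerivAt_sin t).mul_const ⟪w, ζ⟫)
    have d2 := ((Real.hasDerivAt_sin t).mul_const ⟪m, ζ⟫).add
      ((Real.hasDerivAt_cos t).mul_const ⟪w, ζ⟫)
    have h := hmaps t ζ hζ
    have d3 := (hd _ h.1 _ h.2).comp t d1
    refine (d2.mul d3).congr_deriv ?_
    simp only [Function.comp_apply, Pi.add_apply, Pi.sub_apply]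
    ring
  · intro t _
    rw [← integral_indicator hK.isClosed.measurableSet,
      ← integral_indicator hK.isClosed.measurableSet, eq_comm,
      ← integral_comp_planeRotation hm hw hmw t]
    refine integral_congr_ae (Eventually.of_forall fun ζ => ?_)
    beta_reduce
    rw [← hR]
    by_cases hζ : ζ ∈ sphereSlab ℓ a b
    · rw [indicator_of_mem hζ, indicator_of_mem ((hKR t ζ).2 hζ), hRl]
      simp only [hR, inner_planeRotation_left, inner_planeRotation_right]
    · rw [indicator_of_notMem hζ, indicator_of_notMem fun h => hζ ((hKR t ζ).1 h)]

theorem setIntegral_slice_by_parts {ι : Type*} [Fintype ι] [DecidableEq ι]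
    (e : OrthonormalBasis ι ℝ E) {i j : ι} (hij : i ≠ j) {a b : ℝ} {C : ℝ → ℝ}
    (hC : Measurable C) {M : ℝ} (hM : ∀ s, |C s| ≤ M) {G G' : ℝ → ℝ → ℝ}
    (hG : ContinuousOn (Function.uncurry G) {p | p.1 ∈ Icc a b ∧ p.1 ^ 2 + p.2 ^ 2 ≤ 1})
    (hG' : ContinuousOn (Function.uncurry G') {p | p.1 ∈ Icc a b ∧ p.1 ^ 2 + p.2 ^ 2 ≤ 1})
    (hd : ∀ s ∈ Icc a b, ∀ y, s ^ 2 + y ^ 2 ≤ 1 → HasDerivAt (G s) (G' s y) y) :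
    ∫ ζ in sphereSlab (e i) a b, C ⟪e i, ζ⟫ *
      ((1 - ⟪e i, ζ⟫ ^ 2 - ⟪e j, ζ⟫ ^ 2) * G' ⟪e i, ζ⟫ ⟪e j, ζ⟫ -
        (finrank ℝ E - 2) * (⟪e j, ζ⟫ * G ⟪e i, ζ⟫ ⟪e j, ζ⟫)) ∂sphereMeasure E = 0 := by
  have hK := isCompact_sphereSlab (e i) a b
  have hn := fun k => e.orthonormal.1 k
  have ho : ∀ k l, k ≠ l → ⟪e k, e l⟫ = 0 := fun k l h => e.orthonormal.2 h
  have hmaps : ∀ ζ ∈ sphereSlab (e i) a b, (⟪e i, ζ⟫, ⟪e j, ζ⟫) ∈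
      {p : ℝ × ℝ | p.1 ∈ Icc a b ∧ p.1 ^ 2 + p.2 ^ 2 ≤ 1} := by
    intro ζ hζ
    have h := sq_inner_add_sq_inner_le (hn i) (hn j) (ho i j hij) ζ
    rw [hζ.1, one_pow] at h
    exact ⟨hζ.2, h⟩
  have hGc : ContinuousOn (fun ζ => G ⟪e i, ζ⟫ ⟪e j, ζ⟫) (sphereSlab (e i) a b) :=
    hG.comp (f := fun ζ => (⟪e i, ζ⟫, ⟪e j, ζ⟫)) (by fun_prop) hmaps
  have hGc' : ContinuousOn (fun ζ => G' ⟪e i, ζ⟫ ⟪e j, ζ⟫) (sphereSlab (e i) a b) :=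
    hG'.comp (f := fun ζ => (⟪e i, ζ⟫, ⟪e j, ζ⟫)) (by fun_prop) hmaps
  have hz : ∀ k ∈ (Finset.univ.erase i).erase j, ∫ ζ in sphereSlab (e i) a b, C ⟪e i, ζ⟫ *
      (⟪e j, ζ⟫ * G ⟪e i, ζ⟫ ⟪e j, ζ⟫ - ⟪e k, ζ⟫ ^ 2 * G' ⟪e i, ζ⟫ ⟪e j, ζ⟫)
        ∂sphereMeasure E = 0 := by
    intro k hk
    simp only [Finset.mem_erase, Finset.mem_univ, and_true] at hk
    exact setIntegral_rotation_generator (hn i) (hn j) (hn k) (ho i j hij) (ho i k hk.2.symm)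
      (ho j k hk.1.symm) hC hM hG hG' hd
  have hsum := Finset.sum_eq_zero hz
  rw [← integral_finsetSum] at hsum
  · rw [← neg_eq_zero, ← integral_neg, ← hsum]
    refine setIntegral_congr_fun hK.isClosed.measurableSet fun ζ hζ => ?_
    have h1 : ∑ k, ⟪e k, ζ⟫ ^ 2 = 1 := by
      rw [e.sum_sq_inner_right, hζ.1, one_pow]
    have hj : j ∈ Finset.univ.erase i := by simp [hij.symm]
    have h2 : ∑ k ∈ (Finset.univ.erase i).erase j, ⟪e k, ζ⟫ ^ 2 =
        1 - ⟪e i, ζ⟫ ^ 2 - ⟪e j, ζ⟫ ^ 2 := by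
      have e1 := Finset.add_sum_erase Finset.univ (fun k => ⟪e k, ζ⟫ ^ 2) (Finset.mem_univ i)
      have e2 := Finset.add_sum_erase (Finset.univ.erase i) (fun k => ⟪e k, ζ⟫ ^ 2) hj
      linarith
    have h3 : (((Finset.univ.erase i).erase j).card : ℝ) = finrank ℝ E - 2 := by
      have e1 := Finset.card_erase_add_one hj
      have e2 := Finset.card_erase_add_one (Finset.mem_univ i)
      have e3 : finrank ℝ E = Fintype.card ι := finrank_eq_card_basis e.toBasis
      rw [e3, ← Finset.card_univ, ← e2, ← e1]
      push_cast
      ring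
    rw [← Finset.mul_sum, Finset.sum_sub_distrib, ← Finset.sum_mul, ← Finset.sum_mul, h2,
      Finset.sum_const, nsmul_eq_mul, h3]
    ring
  · intro k _
    exact integrable_mul_of_continuousOn_compact hK (ae_restrict_mem hK.isClosed.measurableSet)
      (s := fun ζ => C ⟪e i, ζ⟫) (hC.comp (by fun_prop)) (fun ζ => hM _)
      (k := fun ζ => ⟪e j, ζ⟫ * G ⟪e i, ζ⟫ ⟪e j, ζ⟫ - ⟪e k, ζ⟫ ^ 2 * G' ⟪e i, ζ⟫ ⟪e j, ζ⟫)
      ((ContinuousOn.mul (by fun_prop) hGc).sub (ContinuousOn.mul (by fun_prop) hGc'))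

end Rotation

section SignWeight

theorem measurable_real_sign : Measurable Real.sign := by
  unfold Real.sign
  exact Measurable.ite measurableSet_Iio measurable_const
    (Measurable.ite measurableSet_Ioi measurable_const measurable_const)

theorem abs_real_sign_le (t : ℝ) : |Real.sign t| ≤ 1 := by
  rcases Real.sign_apply_eq t with h | h | h <;> rw [h] <;> simp

theorem real_sign_mul_of_pos {c : ℝ} (hc : 0 < c) (t : ℝ) : Real.sign (c * t) = Real.sign t := by
  rcases lt_trichotomy t 0 with h | h | h
  · rw [Real.sign_of_neg h, Real.sign_of_neg (mul_neg_of_pos_of_neg hc h)]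
  · simp [h]
  · rw [Real.sign_of_pos h, Real.sign_of_pos (mul_pos hc h)]

variable {E : Type*} [NormedAddCommGroup E] [InnerProductSpace ℝ E] [FiniteDimensional ℝ E]

theorem contDiff_rayDisc {x : E} (hx : ‖x‖ < 1) : ContDiff ℝ 1 (rayDisc x) := by
  rw [contDiff_iff_contDiffAt]
  intro θ
  exact ContDiffAt.comp (g := fun p : E × E => rayDisc p.1 p.2) (f := fun θ => (x, θ)) θ
    (contDiffAt_rayDisc hx θ) (by fun_prop)

theorem hasFDerivAt_rayDisc {x : E} (hx : ‖x‖ < 1) (θ : E) :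
    HasFDerivAt (rayDisc x) ((⟪x, θ⟫ / rayDisc x θ) • innerSL ℝ x) θ := by
  have h1 : HasFDerivAt (fun θ : E => ⟪x, θ⟫ ^ 2 + (1 - ‖x‖ ^ 2))
      ((2 * ⟪x, θ⟫) • innerSL ℝ x) θ := by
    have := (((innerSL ℝ x).hasFDerivAt (x := θ)).pow 2).add_const (1 - ‖x‖ ^ 2)
    simpa using this
  have h2 := h1.sqrt (Real.sqrt_pos.1 (rayDisc_pos hx θ)).ne'
  refine h2.congr_fderiv ?_
  ext v
  simp only [smul_smul]
  congr 2
  change 1 / (2 * rayDisc x θ) * _ = _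
  have := (rayDisc_pos hx θ).ne'
  field_simp

variable [MeasurableSpace E] [BorelSpace E] [Nontrivial E]

theorem integral_neg_sphereMeasure (f : E → ℝ) :
    ∫ θ, f (-θ) ∂sphereMeasure E = ∫ θ, f θ ∂sphereMeasure E :=
  integral_comp_sphereMeasure (LinearIsometryEquiv.neg ℝ) f

theorem integral_eq_zero_of_odd {f : E → ℝ} (hf : ∀ θ, f (-θ) = -f θ) :
    ∫ θ, f θ ∂sphereMeasure E = 0 := by
  have h := integral_neg_sphereMeasure f
  simp only [hf, integral_neg] at h
  linarith

theorem exists_isometry_flip (m : E) :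
    ∃ L : E ≃ₗᵢ[ℝ] E, (∀ θ, ⟪m, L θ⟫ = -⟪m, θ⟫) ∧ ∀ w, ⟪w, m⟫ = 0 → ∀ θ, ⟪w, L θ⟫ = ⟪w, θ⟫ := by
  refine ⟨(Submodule.span ℝ {m})ᗮ.reflection, fun θ => ?_, fun w hw θ => ?_⟩
  · rw [← LinearIsometryEquiv.inner_map_map (Submodule.span ℝ {m})ᗮ.reflection,
      Submodule.reflection_reflection, Submodule.reflection_orthogonalComplement_singleton_eq_neg,
      inner_neg_left]
  · have : (Submodule.span ℝ {m})ᗮ.reflection w = w :=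
      Submodule.reflection_mem_subspace_eq_self
        (Submodule.mem_orthogonal_singleton_iff_inner_left.2 hw)
    rw [← LinearIsometryEquiv.inner_map_map (Submodule.span ℝ {m})ᗮ.reflection,
      Submodule.reflection_reflection, this]

theorem integrable_sign_mul {ℓ : E} {k : E → ℝ} (hk : Continuous k) :
    Integrable (fun θ => Real.sign ⟪ℓ, θ⟫ * k θ) (sphereMeasure E) :=
  integrable_mul_of_continuousOn_compact (isCompact_sphere 0 1) ae_mem_sphere
    (s := fun θ => Real.sign ⟪ℓ, θ⟫) (measurable_real_sign.comp (by fun_prop))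
    (fun _ => abs_real_sign_le _) hk.continuousOn

theorem integral_sign_rayDisc {x ℓ m : E} (hx : ‖x‖ < 1) (hm : ‖m‖ = 1)
    (hlm : ⟪ℓ, m⟫ = 0) :
    ∫ θ, Real.sign ⟪ℓ, θ⟫ * (⟪x, m⟫ * ⟪x, θ⟫ / rayDisc x θ +
      (1 - ‖x‖ ^ 2) * ⟪m, θ⟫ / rayDisc x θ - finrank ℝ E * (rayDisc x θ * ⟪m, θ⟫))
      ∂sphereMeasure E = 0 := by
  rw [← integral_fderiv_tangential hm (s := fun θ => Real.sign ⟪ℓ, θ⟫)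
    (measurable_real_sign.comp (by fun_prop)) (fun _ => abs_real_sign_le _) ?_
    (contDiff_rayDisc hx)]
  · refine integral_congr_ae (Eventually.of_forall fun θ => ?_)
    have h1 := (rayDisc_pos hx θ).ne'
    have h2 := rayDisc_sq hx θ
    simp only [(hasFDerivAt_rayDisc hx θ).fderiv]
    simp only [smul_apply, innerSL_apply_apply, smul_eq_mul, inner_sub_right,
      inner_smul_right]
    congr 1
    field_simp
    linear_combination (-⟪m, θ⟫) * h2
  · intro t ht ζ hζ
    have h1 : ‖-t • m‖ < 1 := by rwa [norm_smul, hm, mul_one, Real.norm_eq_abs, abs_neg]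
    have h2 := sub_ne_zero_of_norm h1 hζ
    simp only [dirFrom, inner_smul_right, inner_sub_right, hlm, mul_zero, sub_zero]
    exact real_sign_mul_of_pos (inv_pos.2 (norm_pos_iff.2 h2)) _

theorem integral_sign_mul_div_rayDisc_nonpos {x ℓ m : E} (hx : ‖x‖ < 1)
    (hlm : ⟪ℓ, m⟫ = 0) {x₁ x₂ : ℝ} (h₁ : 0 ≤ x₁) (h₂ : 0 ≤ x₂) (hxe : x = x₁ • ℓ + x₂ • m) :
    ∫ θ, Real.sign ⟪ℓ, θ⟫ * (⟪m, θ⟫ / rayDisc x θ) ∂sphereMeasure E ≤ 0 := by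
  obtain ⟨L, hL1, hL2⟩ := exists_isometry_flip m
  have hD := continuous_rayDisc x
  have hi : Integrable (fun θ => Real.sign ⟪ℓ, θ⟫ * (⟪m, θ⟫ / rayDisc x θ)) (sphereMeasure E) :=
    integrable_sign_mul (Continuous.div (by fun_prop) hD fun θ => (rayDisc_pos hx θ).ne')
  have hi' : Integrable (fun θ => Real.sign ⟪ℓ, L θ⟫ * (⟪m, L θ⟫ / rayDisc x (L θ)))
      (sphereMeasure E) :=
    (measurePreserving_sphereMeasure L).integrable_comp_of_integrable hi
  have h := integral_comp_sphereMeasure L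
    (fun θ => Real.sign ⟪ℓ, θ⟫ * (⟪m, θ⟫ / rayDisc x θ))
  have h2 : ∫ θ, (Real.sign ⟪ℓ, θ⟫ * (⟪m, θ⟫ / rayDisc x θ) +
      Real.sign ⟪ℓ, L θ⟫ * (⟪m, L θ⟫ / rayDisc x (L θ))) ∂sphereMeasure E ≤ 0 := by
    refine integral_nonpos fun θ => ?_
    simp only [hL1, hL2 ℓ hlm, Pi.zero_apply]
    have hp : ∀ θ, ⟪x, θ⟫ = x₁ * ⟪ℓ, θ⟫ + x₂ * ⟪m, θ⟫ := fun θ => by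
      rw [hxe, inner_add_left, real_inner_smul_left, real_inner_smul_left]
    have e1 := rayDisc_sq hx θ
    have e2 := rayDisc_sq hx (L θ)
    rw [hp] at e1 e2
    rw [hL1, hL2 ℓ hlm] at e2
    have p1 := rayDisc_pos hx θ
    have p2 := rayDisc_pos hx (L θ)
    set A := rayDisc x θ
    set B := rayDisc x (L θ)
    have e3 : A ^ 2 - B ^ 2 = 4 * (x₁ * x₂) * (⟪ℓ, θ⟫ * ⟪m, θ⟫) := by
      linear_combination e1 - e2
    have hxx := mul_nonneg h₁ h₂
    have e4 : Real.sign ⟪ℓ, θ⟫ * (⟪m, θ⟫ / A) + Real.sign ⟪ℓ, θ⟫ * (-⟪m, θ⟫ / B) =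
        -(Real.sign ⟪ℓ, θ⟫ * ⟪m, θ⟫ * (A - B)) / (A * B) := by
      field_simp
      ring
    rw [e4]
    refine div_nonpos_of_nonpos_of_nonneg (neg_nonpos.2 ?_) (mul_pos p1 p2).le
    have e5 : A - B = (A ^ 2 - B ^ 2) / (A + B) := by field_simp; ring
    rw [e5, e3, mul_div_assoc']
    refine div_nonneg ?_ (add_pos p1 p2).le
    have e6 : 0 ≤ Real.sign ⟪ℓ, θ⟫ * ⟪ℓ, θ⟫ := by
      exact Real.sign_mul_nonneg _
    have := mul_nonneg (mul_nonneg e6 (sq_nonneg ⟪m, θ⟫)) hxx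
    linarith
  rw [integral_add hi hi', h] at h2
  linarith

/-- The contribution of the hemispheres `±⟪ℓ, θ⟫ > 0` is non-negative. -/
theorem integral_sign_chord_nonneg {x ℓ m : E} (hx : ‖x‖ < 1) (hm : ‖m‖ = 1)
    (hlm : ⟪ℓ, m⟫ = 0) {x₁ x₂ : ℝ} (h₁ : 0 ≤ x₁) (h₂ : 0 ≤ x₂) (hxe : x = x₁ • ℓ + x₂ • m)
    {n : ℝ} (hn : n = finrank ℝ E) (hn2 : 2 ≤ n) :
    0 ≤ ∫ θ, Real.sign ⟪ℓ, θ⟫ * ((x₂ + rayLen x θ * ⟪m, θ⟫ - (n - 2) / n * x₂) *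
      (rayLen x θ / rayDisc x θ)) ∂sphereMeasure E := by
  have hxm : ⟪x, m⟫ = x₂ := by
    rw [hxe, inner_add_left, real_inner_smul_left, real_inner_smul_left, hlm,
      real_inner_self_eq_norm_sq, hm]
    ring
  have hD := continuous_rayDisc x
  have hD0 := fun θ => (rayDisc_pos hx θ).ne'
  have hn0 : n ≠ 0 := by linarith
  have i1 : Integrable (fun θ => Real.sign ⟪ℓ, θ⟫ * ((2 / n) * x₂ - 2 * (⟪x, θ⟫ * ⟪m, θ⟫)))
      (sphereMeasure E) := integrable_sign_mul (by fun_prop)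
  have i2 : Integrable (fun θ => Real.sign ⟪ℓ, θ⟫ * (⟪x, m⟫ * ⟪x, θ⟫ / rayDisc x θ +
      (1 - ‖x‖ ^ 2) * ⟪m, θ⟫ / rayDisc x θ - finrank ℝ E * (rayDisc x θ * ⟪m, θ⟫)))
      (sphereMeasure E) :=
    integrable_sign_mul (by fun_prop (disch := exact hD0 _))
  have i3 : Integrable (fun θ => Real.sign ⟪ℓ, θ⟫ * (⟪m, θ⟫ / rayDisc x θ)) (sphereMeasure E) :=
    integrable_sign_mul (by fun_prop (disch := exact hD0 _))
  have z1 : ∫ θ, Real.sign ⟪ℓ, θ⟫ * ((2 / n) * x₂ - 2 * (⟪x, θ⟫ * ⟪m, θ⟫)) ∂sphereMeasure E = 0 :=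
    integral_eq_zero_of_odd fun θ => by
      simp only [inner_neg_right, Real.sign_neg]
      ring
  have z2 := integral_sign_rayDisc (ℓ := ℓ) hx hm hlm
  have z3 := integral_sign_mul_div_rayDisc_nonpos hx hlm h₁ h₂ hxe
  have key : ∀ θ, Real.sign ⟪ℓ, θ⟫ * ((x₂ + rayLen x θ * ⟪m, θ⟫ - (n - 2) / n * x₂) *
      (rayLen x θ / rayDisc x θ)) =
      (Real.sign ⟪ℓ, θ⟫ * ((2 / n) * x₂ - 2 * (⟪x, θ⟫ * ⟪m, θ⟫)) -
      (2 / n) * (Real.sign ⟪ℓ, θ⟫ * (⟪x, m⟫ * ⟪x, θ⟫ / rayDisc x θ +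
      (1 - ‖x‖ ^ 2) * ⟪m, θ⟫ / rayDisc x θ - finrank ℝ E * (rayDisc x θ * ⟪m, θ⟫)))) -
      ((n - 2) / n * (1 - ‖x‖ ^ 2)) * (Real.sign ⟪ℓ, θ⟫ * (⟪m, θ⟫ / rayDisc x θ)) := by
    intro θ
    have h2 := rayDisc_sq hx θ
    have h0 := hD0 θ
    rw [hxm, ← hn, rayLen]
    field_simp
    linear_combination (-(Real.sign ⟪ℓ, θ⟫ * n * ⟪m, θ⟫)) * h2
  have i4 : Integrable (fun θ => Real.sign ⟪ℓ, θ⟫ * ((2 / n) * x₂ - 2 * (⟪x, θ⟫ * ⟪m, θ⟫)) -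
      (2 / n) * (Real.sign ⟪ℓ, θ⟫ * (⟪x, m⟫ * ⟪x, θ⟫ / rayDisc x θ +
      (1 - ‖x‖ ^ 2) * ⟪m, θ⟫ / rayDisc x θ - finrank ℝ E * (rayDisc x θ * ⟪m, θ⟫))))
      (sphereMeasure E) := i1.sub (i2.const_mul _)
  simp only [key]
  rw [integral_sub i4 (i3.const_mul _), integral_sub i1 (i2.const_mul _),
    integral_const_mul, integral_const_mul, z1, z2]
  have h5 : 0 ≤ (n - 2) / n * (1 - ‖x‖ ^ 2) :=
    mul_nonneg (div_nonneg (by linarith) (by linarith)) (one_sub_norm_sq_pos hx).le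
  have := mul_nonneg h5 (neg_nonneg.2 z3)
  linarith

end SignWeight

section SlabKernel

/-- `|η - x| ^ 2` for a unit vector `η` with coordinates `s`, `y` in the plane of `x`. -/
def distSq (x₁ x₂ s y : ℝ) : ℝ := 1 + x₁ ^ 2 + x₂ ^ 2 - 2 * x₁ * s - 2 * x₂ * y

/-- The comparison quadratic for `distSq`. -/
def cmpSq (ξ s y : ℝ) : ℝ := 1 - s ^ 2 + ξ ^ 2 - 2 * ξ * y

/-- The potential whose slice divergence bounds the comparison kernel from below. -/
noncomputable def slabPot (lam ξ s y : ℝ) : ℝ :=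
  cmpSq ξ s y ^ (-lam) *
    (-1 / (2 * lam) + ξ / (2 * lam + 1) * ((y - ξ) / (1 - s ^ 2 - ξ * y)))

/-- The derivative of `slabPot` in its last variable. -/
noncomputable def slabPotDeriv (lam ξ s y : ℝ) : ℝ :=
  2 * lam * ξ * cmpSq ξ s y ^ (-lam - 1) *
    (-1 / (2 * lam) + ξ / (2 * lam + 1) * ((y - ξ) / (1 - s ^ 2 - ξ * y))) +
  cmpSq ξ s y ^ (-lam) * (ξ / (2 * lam + 1) * ((1 - s ^ 2 - ξ ^ 2) / (1 - s ^ 2 - ξ * y) ^ 2))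

theorem distSq_pos {x₁ x₂ s y : ℝ} (hx : x₁ ^ 2 + x₂ ^ 2 < 1) (hsy : s ^ 2 + y ^ 2 ≤ 1) :
    0 < distSq x₁ x₂ s y := by
  unfold distSq
  by_contra h
  have h1 : (s - x₁) ^ 2 + (y - x₂) ^ 2 ≤ 0 := by nlinarith
  have h2 : s - x₁ = 0 := by nlinarith [sq_nonneg (s - x₁), sq_nonneg (y - x₂)]
  have h3 : y - x₂ = 0 := by nlinarith [sq_nonneg (s - x₁), sq_nonneg (y - x₂)]
  have h4 : s = x₁ := by linarith
  have h5 : y = x₂ := by linarith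
  subst h4 h5
  nlinarith

theorem cmpSq_pos {ξ s y : ℝ} (h : s ^ 2 + ξ ^ 2 < 1) (hsy : s ^ 2 + y ^ 2 ≤ 1) :
    0 < cmpSq ξ s y := by
  unfold cmpSq
  by_contra h'
  have h3 : y - ξ = 0 := by nlinarith [sq_nonneg (y - ξ)]
  have h5 : y = ξ := by linarith
  subst h5
  nlinarith

theorem slab_denom_pos {ξ s y : ℝ} (h : s ^ 2 + ξ ^ 2 < 1) (hsy : s ^ 2 + y ^ 2 ≤ 1) :
    0 < 1 - s ^ 2 - ξ * y := by
  nlinarith [sq_nonneg (y - ξ)]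

theorem hasDerivAt_slabPot {lam ξ s y : ℝ} (h : s ^ 2 + ξ ^ 2 < 1) (hsy : s ^ 2 + y ^ 2 ≤ 1) :
    HasDerivAt (slabPot lam ξ s) (slabPotDeriv lam ξ s y) y := by
  have hQ := cmpSq_pos h hsy
  have hR := slab_denom_pos h hsy
  have d1 : HasDerivAt (cmpSq ξ s) (-(2 * ξ)) y := by
    unfold cmpSq
    simpa using ((hasDerivAt_id y).const_mul (2 * ξ)).const_sub (1 - s ^ 2 + ξ ^ 2)
  have d2 := d1.rpow_const (p := -lam) (Or.inl hQ.ne')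
  have d3 : HasDerivAt (fun y => (y - ξ) / (1 - s ^ 2 - ξ * y))
      ((1 - s ^ 2 - ξ ^ 2) / (1 - s ^ 2 - ξ * y) ^ 2) y := by
    refine (((hasDerivAt_id y).sub_const ξ).div
      (((hasDerivAt_id y).const_mul ξ).const_sub (1 - s ^ 2)) hR.ne').congr_deriv ?_
    simp only [id]
    ring
  refine (d2.mul ((d3.const_mul (ξ / (2 * lam + 1))).const_add (-1 / (2 * lam)))).congr_deriv ?_
  unfold slabPotDeriv
  ring

theorem continuousOn_slabPot {lam ξ : ℝ} {K : Set (ℝ × ℝ)}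
    (hK : ∀ p ∈ K, p.1 ^ 2 + ξ ^ 2 < 1 ∧ p.1 ^ 2 + p.2 ^ 2 ≤ 1) :
    ContinuousOn (Function.uncurry (slabPot lam ξ)) K ∧
      ContinuousOn (Function.uncurry (slabPotDeriv lam ξ)) K := by
  have hQ : ∀ p ∈ K, cmpSq ξ p.1 p.2 ≠ 0 := fun p hp => (cmpSq_pos (hK p hp).1 (hK p hp).2).ne'
  have hR : ∀ p ∈ K, 1 - p.1 ^ 2 - ξ * p.2 ≠ 0 :=
    fun p hp => (slab_denom_pos (hK p hp).1 (hK p hp).2).ne'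
  have hR2 : ∀ p ∈ K, (1 - p.1 ^ 2 - ξ * p.2) ^ 2 ≠ 0 := fun p hp => pow_ne_zero 2 (hR p hp)
  have cQ : ContinuousOn (fun p : ℝ × ℝ => cmpSq ξ p.1 p.2) K := by
    unfold cmpSq
    fun_prop
  have cP : ∀ c : ℝ, ContinuousOn (fun p : ℝ × ℝ => cmpSq ξ p.1 p.2 ^ c) K :=
    fun c => cQ.rpow_const fun p hp => Or.inl (hQ p hp)
  have cD : ContinuousOn (fun p : ℝ × ℝ => -1 / (2 * lam) +
      ξ / (2 * lam + 1) * ((p.2 - ξ) / (1 - p.1 ^ 2 - ξ * p.2))) K :=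
    continuousOn_const.add
      (continuousOn_const.mul (ContinuousOn.div (by fun_prop) (by fun_prop) hR))
  constructor
  · exact (cP _).mul cD
  · exact ((continuousOn_const.mul (cP _)).mul cD).add ((cP _).mul
      (continuousOn_const.mul (ContinuousOn.div (by fun_prop) (by fun_prop) hR2)))

theorem slabPot_certificate {lam ξ s y : ℝ} (hlam : 0 < lam) (hξ : 0 ≤ ξ)
    (h : s ^ 2 + ξ ^ 2 < 1) (hsy : s ^ 2 + y ^ 2 ≤ 1) :
    (1 - s ^ 2 - y ^ 2) * slabPotDeriv lam ξ s y - 2 * lam * (y * slabPot lam ξ s y) ≤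
      (y - 2 * lam / (2 * lam + 1) * ξ) * cmpSq ξ s y ^ (-lam) := by
  have hQ := cmpSq_pos h hsy
  have hR := slab_denom_pos h hsy
  have hW : cmpSq ξ s y ^ (-lam) = cmpSq ξ s y * cmpSq ξ s y ^ (-lam - 1) := by
    rw [Real.rpow_sub_one hQ.ne']
    field_simp
  have hW0 : 0 ≤ cmpSq ξ s y ^ (-lam - 1) := Real.rpow_nonneg hQ.le _
  unfold slabPotDeriv slabPot
  rw [hW]
  set W := cmpSq ξ s y ^ (-lam - 1)
  rw [← sub_nonneg]
  have hN : 0 < 2 * lam + 1 := by linarith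
  have key : (y - 2 * lam / (2 * lam + 1) * ξ) * (cmpSq ξ s y * W) -
      ((1 - s ^ 2 - y ^ 2) * (2 * lam * ξ * W *
        (-1 / (2 * lam) + ξ / (2 * lam + 1) * ((y - ξ) / (1 - s ^ 2 - ξ * y))) +
        cmpSq ξ s y * W * (ξ / (2 * lam + 1) * ((1 - s ^ 2 - ξ ^ 2) / (1 - s ^ 2 - ξ * y) ^ 2))) -
        2 * lam * (y * (cmpSq ξ s y * W *
        (-1 / (2 * lam) + ξ / (2 * lam + 1) * ((y - ξ) / (1 - s ^ 2 - ξ * y)))))) =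
      ξ / (2 * lam + 1) * (1 - s ^ 2 - y ^ 2) * (ξ * (y - ξ) / (1 - s ^ 2 - ξ * y)) ^ 2 * W := by
    unfold cmpSq
    obtain ⟨R, hR'⟩ : ∃ R, R = 1 - s ^ 2 - ξ * y := ⟨_, rfl⟩
    have hs2 : s ^ 2 = 1 - ξ * y - R := by linarith
    rw [← hR'] at hR ⊢
    rw [hs2]
    field_simp
    ring
  rw [key]
  have : 0 ≤ 1 - s ^ 2 - y ^ 2 := by linarith
  positivity

/-- The factor comparing `distSq` and `cmpSq` on a slice. -/
noncomputable def sliceFactor (lam x₁ x₂ ξ y₀ s : ℝ) : ℝ :=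
  (cmpSq ξ s y₀ / distSq x₁ x₂ s y₀) ^ lam

theorem sliceFactor_mul_le {n lam x₁ x₂ s y : ℝ} (hn : 2 < n) (hlam : 0 < lam) (h₁ : 0 ≤ x₁)
    (h₂ : 0 ≤ x₂) (hx : x₁ ^ 2 + x₂ ^ 2 < 1) (hs : s ∈ Icc ((n - 2) / n * x₁) x₁)
    (hsy : s ^ 2 + y ^ 2 ≤ 1) :
    sliceFactor lam x₁ x₂ ((n - 1) / n * x₂) ((n - 2) / n * x₂) s *
      ((y - (n - 2) / n * x₂) * cmpSq ((n - 1) / n * x₂) s y ^ (-lam)) ≤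
      (y - (n - 2) / n * x₂) * distSq x₁ x₂ s y ^ (-lam) := by
  have hn0 : 0 < n := by linarith
  have hk0 : 0 ≤ (n - 2) / n := div_nonneg (by linarith) hn0.le
  have hk1 : (n - 2) / n ≤ 1 := by rw [div_le_one hn0]; linarith
  have ht0 : 0 ≤ (n - 1) / n := div_nonneg (by linarith) hn0.le
  have ht1 : (n - 1) / n ≤ 1 := by rw [div_le_one hn0]; linarith
  have hs0 : 0 ≤ s := (mul_nonneg hk0 h₁).trans hs.1
  have hs1 : s ^ 2 ≤ x₁ ^ 2 := by nlinarith [hs.2]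
  have hξ1 : ((n - 1) / n * x₂) ^ 2 ≤ x₂ ^ 2 := by
    have : (n - 1) / n * x₂ ≤ x₂ := mul_le_of_le_one_left h₂ ht1
    have := mul_nonneg ht0 h₂
    nlinarith
  have hy1 : ((n - 2) / n * x₂) ^ 2 ≤ x₂ ^ 2 := by
    have : (n - 2) / n * x₂ ≤ x₂ := mul_le_of_le_one_left h₂ hk1
    have := mul_nonneg hk0 h₂
    nlinarith
  have hsξ : s ^ 2 + ((n - 1) / n * x₂) ^ 2 < 1 := by linarith
  have hsy0 : s ^ 2 + ((n - 2) / n * x₂) ^ 2 ≤ 1 := by linarith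
  have q0 := distSq_pos hx hsy0
  have q1 := distSq_pos hx hsy
  have Q0 := cmpSq_pos hsξ hsy0
  have Q1 := cmpSq_pos hsξ hsy
  have slab : 0 ≤ cmpSq ((n - 1) / n * x₂) s ((n - 2) / n * x₂) -
      (n - 1) / n * distSq x₁ x₂ s ((n - 2) / n * x₂) := by
    have e : cmpSq ((n - 1) / n * x₂) s ((n - 2) / n * x₂) -
        (n - 1) / n * distSq x₁ x₂ s ((n - 2) / n * x₂) =
        (1 - x₁ ^ 2 - (n - 1) / n * x₂ ^ 2) / n + (x₁ - s) * (s - (n - 2) / n * x₁) := by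
      unfold cmpSq distSq
      field_simp
      ring
    rw [e]
    have : (n - 1) / n * x₂ ^ 2 ≤ x₂ ^ 2 := mul_le_of_le_one_left (sq_nonneg _) ht1
    exact add_nonneg (div_nonneg (by linarith) hn0.le)
      (mul_nonneg (sub_nonneg.2 hs.2) (sub_nonneg.2 hs.1))
  have cross : cmpSq ((n - 1) / n * x₂) s y * distSq x₁ x₂ s ((n - 2) / n * x₂) -
      cmpSq ((n - 1) / n * x₂) s ((n - 2) / n * x₂) * distSq x₁ x₂ s y =
      2 * x₂ * (y - (n - 2) / n * x₂) * (cmpSq ((n - 1) / n * x₂) s ((n - 2) / n * x₂) -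
      (n - 1) / n * distSq x₁ x₂ s ((n - 2) / n * x₂)) := by
    unfold cmpSq distSq
    ring
  unfold sliceFactor
  set A := cmpSq ((n - 1) / n * x₂) s y
  set A0 := cmpSq ((n - 1) / n * x₂) s ((n - 2) / n * x₂)
  set B := distSq x₁ x₂ s y
  set B0 := distSq x₁ x₂ s ((n - 2) / n * x₂)
  set z := y - (n - 2) / n * x₂
  have e1 : B ^ (-lam) = (A / B) ^ lam * A ^ (-lam) := by
    rw [Real.div_rpow Q1.le q1.le, Real.rpow_neg Q1.le, Real.rpow_neg q1.le]
    have := (Real.rpow_pos_of_pos Q1 lam).ne'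
    field_simp
  rw [e1]
  have e2 : 0 ≤ z * ((A / B) ^ lam - (A0 / B0) ^ lam) := by
    rcases le_total 0 z with hz | hz
    · refine mul_nonneg hz (sub_nonneg.2 (Real.rpow_le_rpow (by positivity) ?_ hlam.le))
      rw [div_le_div_iff₀ q0 q1]
      have := mul_nonneg (mul_nonneg (mul_nonneg zero_le_two h₂) hz) slab
      linarith
    · refine mul_nonneg_of_nonpos_of_nonpos hz
        (sub_nonpos.2 (Real.rpow_le_rpow (by positivity) ?_ hlam.le))
      rw [div_le_div_iff₀ q1 q0]
      have := mul_nonneg (mul_nonneg (mul_nonneg zero_le_two h₂) (neg_nonneg.2 hz)) slab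
      linarith
  have e3 := mul_nonneg e2 (Real.rpow_nonneg Q1.le (-lam))
  linarith

theorem slabPot_mul_sliceFactor_le {n lam x₁ x₂ s y : ℝ} (hn : 2 < n) (hlam : 2 * lam = n - 2)
    (h₁ : 0 ≤ x₁) (h₂ : 0 ≤ x₂) (hx : x₁ ^ 2 + x₂ ^ 2 < 1)
    (hs : s ∈ Icc ((n - 2) / n * x₁) x₁) (hsy : s ^ 2 + y ^ 2 ≤ 1)
    (hsξ : s ^ 2 + ((n - 1) / n * x₂) ^ 2 < 1) (hk : 0 ≤ sliceFactor lam x₁ x₂ ((n - 1) / n * x₂)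
      ((n - 2) / n * x₂) s) :
    sliceFactor lam x₁ x₂ ((n - 1) / n * x₂) ((n - 2) / n * x₂) s *
      ((1 - s ^ 2 - y ^ 2) * slabPotDeriv lam ((n - 1) / n * x₂) s y -
        (n - 2) * (y * slabPot lam ((n - 1) / n * x₂) s y)) ≤
      (y - (n - 2) / n * x₂) * distSq x₁ x₂ s y ^ (-lam) := by
  refine le_trans ?_ (sliceFactor_mul_le hn (by linarith) h₁ h₂ hx hs hsy)
  refine mul_le_mul_of_nonneg_left ?_ hk
  have hn0 : 0 < n := by linarith
  have h := slabPot_certificate (lam := lam) (by linarith)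
    (mul_nonneg (div_nonneg (by linarith) hn0.le) h₂ : 0 ≤ (n - 1) / n * x₂) hsξ hsy
  rw [hlam] at h
  have e : (n - 2) / (n - 2 + 1) * ((n - 1) / n * x₂) = (n - 2) / n * x₂ := by
    have : n - 2 + 1 ≠ 0 := by linarith
    have : n - 1 ≠ 0 := by linarith
    field_simp
    ring
  rwa [e] at h

end SlabKernel

section Cap

variable {E : Type*} [NormedAddCommGroup E] [InnerProductSpace ℝ E] [FiniteDimensional ℝ E]
  [MeasurableSpace E] [BorelSpace E] [Nontrivial E]

theorem exists_orthonormalBasis_pair {ℓ m : E} (hℓ : ‖ℓ‖ = 1) (hm : ‖m‖ = 1) (hlm : ⟪ℓ, m⟫ = 0) :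
    ∃ (u : Finset E) (b : OrthonormalBasis u ℝ E) (i j : u), i ≠ j ∧ b i = ℓ ∧ b j = m := by
  have ho : Orthonormal ℝ ![ℓ, m] := by
    rw [orthonormal_iff_ite]
    intro i j
    fin_cases i <;> fin_cases j <;> simp [hℓ, hm, hlm, real_inner_comm ℓ m]
  obtain ⟨u, b, hu, hb⟩ := ho.toSubtypeRange.exists_orthonormalBasis_extension
  refine ⟨u, b, ⟨ℓ, hu ⟨0, rfl⟩⟩, ⟨m, hu ⟨1, rfl⟩⟩, ?_, by rw [hb], by rw [hb]⟩
  intro h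
  rw [Subtype.mk.injEq] at h
  rw [h, real_inner_self_eq_norm_sq, hm] at hlm
  norm_num at hlm

theorem setIntegral_slice_by_parts_pair {ℓ m : E} (hℓ : ‖ℓ‖ = 1) (hm : ‖m‖ = 1)
    (hlm : ⟪ℓ, m⟫ = 0) {a b : ℝ} {C : ℝ → ℝ}
    (hC : Measurable C) {M : ℝ} (hM : ∀ s, |C s| ≤ M) {G G' : ℝ → ℝ → ℝ}
    (hG : ContinuousOn (Function.uncurry G) {p | p.1 ∈ Icc a b ∧ p.1 ^ 2 + p.2 ^ 2 ≤ 1})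
    (hG' : ContinuousOn (Function.uncurry G') {p | p.1 ∈ Icc a b ∧ p.1 ^ 2 + p.2 ^ 2 ≤ 1})
    (hd : ∀ s ∈ Icc a b, ∀ y, s ^ 2 + y ^ 2 ≤ 1 → HasDerivAt (G s) (G' s y) y) :
    ∫ ζ in sphereSlab ℓ a b, C ⟪ℓ, ζ⟫ *
      ((1 - ⟪ℓ, ζ⟫ ^ 2 - ⟪m, ζ⟫ ^ 2) * G' ⟪ℓ, ζ⟫ ⟪m, ζ⟫ -
        (finrank ℝ E - 2) * (⟪m, ζ⟫ * G ⟪ℓ, ζ⟫ ⟪m, ζ⟫)) ∂sphereMeasure E = 0 := by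
  classical
  obtain ⟨u, e, i, j, hij, rfl, rfl⟩ := exists_orthonormalBasis_pair hℓ hm hlm
  exact setIntegral_slice_by_parts e hij hC hM hG hG' hd

/-- The contribution of the spherical cap between the two relevant parallel hyperplanes is
non-negative. -/
theorem setIntegral_cap_nonneg {ℓ m : E} (hℓ : ‖ℓ‖ = 1) (hm : ‖m‖ = 1) (hlm : ⟪ℓ, m⟫ = 0)
    {x₁ x₂ : ℝ} (h₁ : 0 ≤ x₁) (h₂ : 0 ≤ x₂) (hx : x₁ ^ 2 + x₂ ^ 2 < 1) {n lam : ℝ}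
    (hn : n = finrank ℝ E) (hn2 : 2 < n) (hlam : 2 * lam = n - 2) :
    0 ≤ ∫ ζ in sphereSlab ℓ ((n - 2) / n * x₁) x₁,
      (Ioc ((n - 2) / n * x₁) x₁).indicator 1 ⟪ℓ, ζ⟫ *
        ((⟪m, ζ⟫ - (n - 2) / n * x₂) * distSq x₁ x₂ ⟪ℓ, ζ⟫ ⟪m, ζ⟫ ^ (-lam)) ∂sphereMeasure E := by
  have hn0 : 0 < n := by linarith
  have hk0 : 0 ≤ (n - 2) / n := div_nonneg (by linarith) hn0.le
  have hk1 : (n - 2) / n ≤ 1 := by rw [div_le_one hn0]; linarith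
  have ht0 : 0 ≤ (n - 1) / n := div_nonneg (by linarith) hn0.le
  have ht1 : (n - 1) / n ≤ 1 := by rw [div_le_one hn0]; linarith
  set a := (n - 2) / n * x₁ with ha
  set y₀ := (n - 2) / n * x₂ with hy₀
  set ξ := (n - 1) / n * x₂ with hξ
  have hξ1 : ξ ^ 2 ≤ x₂ ^ 2 := by
    have : ξ ≤ x₂ := mul_le_of_le_one_left h₂ ht1
    have := mul_nonneg ht0 h₂
    nlinarith
  have hy1 : y₀ ^ 2 ≤ x₂ ^ 2 := by
    have : y₀ ≤ x₂ := mul_le_of_le_one_left h₂ hk1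
    have := mul_nonneg hk0 h₂
    nlinarith
  have ha0 : 0 ≤ a := mul_nonneg hk0 h₁
  have hs1 : ∀ s ∈ Icc a x₁, s ^ 2 ≤ x₁ ^ 2 := fun s hs => by nlinarith [hs.1, hs.2]
  have hsξ : ∀ s ∈ Icc a x₁, s ^ 2 + ξ ^ 2 < 1 := fun s hs => by linarith [hs1 s hs]
  have hsy : ∀ s ∈ Icc a x₁, s ^ 2 + y₀ ^ 2 ≤ 1 := fun s hs => by linarith [hs1 s hs]
  have hk : ∀ s ∈ Icc a x₁, 0 ≤ sliceFactor lam x₁ x₂ ξ y₀ s := fun s hs =>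
    Real.rpow_nonneg (div_nonneg (cmpSq_pos (hsξ s hs) (hsy s hs)).le
      (distSq_pos hx (hsy s hs)).le) _
  have hkm : Measurable (sliceFactor lam x₁ x₂ ξ y₀) := by
    unfold sliceFactor cmpSq distSq
    fun_prop
  have hkc : ContinuousOn (sliceFactor lam x₁ x₂ ξ y₀) (Icc a x₁) := by
    refine ContinuousOn.rpow_const (ContinuousOn.div ?_ ?_ fun s hs =>
      (distSq_pos hx (hsy s hs)).ne') fun s hs => Or.inl (div_pos
        (cmpSq_pos (hsξ s hs) (hsy s hs)) (distSq_pos hx (hsy s hs))).ne'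
    · unfold cmpSq
      fun_prop
    · unfold distSq
      fun_prop
  obtain ⟨M, hM⟩ := isCompact_Icc.exists_bound_of_continuousOn hkc
  set C : ℝ → ℝ := (Ioc a x₁).indicator (sliceFactor lam x₁ x₂ ξ y₀) with hCdef
  have hCm : Measurable C := hkm.indicator measurableSet_Ioc
  have hCM : ∀ s, |C s| ≤ |M| := fun s => by
    by_cases hs : s ∈ Ioc a x₁
    · rw [hCdef, indicator_of_mem hs]
      exact (hM s (Ioc_subset_Icc_self hs)).trans (le_abs_self M)
    · rw [hCdef, indicator_of_notMem hs]
      simp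
  obtain ⟨cG, cG'⟩ := continuousOn_slabPot (lam := lam) (ξ := ξ)
    (K := {p : ℝ × ℝ | p.1 ∈ Icc a x₁ ∧ p.1 ^ 2 + p.2 ^ 2 ≤ 1})
    fun p hp => ⟨hsξ p.1 hp.1, hp.2⟩
  have hK := isCompact_sphereSlab ℓ a x₁
  have hKae := ae_restrict_mem (μ := sphereMeasure E) hK.isClosed.measurableSet
  have hz := setIntegral_slice_by_parts_pair hℓ hm hlm hCm hCM cG cG'
    fun s hs y hsy => hasDerivAt_slabPot (hsξ s hs) hsy
  have hmaps : ∀ ζ ∈ sphereSlab ℓ a x₁, (⟪ℓ, ζ⟫, ⟪m, ζ⟫) ∈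
      {p : ℝ × ℝ | p.1 ∈ Icc a x₁ ∧ p.1 ^ 2 + p.2 ^ 2 ≤ 1} := by
    intro ζ hζ
    have h := sq_inner_add_sq_inner_le hℓ hm hlm ζ
    rw [hζ.1, one_pow] at h
    exact ⟨hζ.2, h⟩
  have hGc : ContinuousOn (fun ζ => slabPot lam ξ ⟪ℓ, ζ⟫ ⟪m, ζ⟫) (sphereSlab ℓ a x₁) :=
    cG.comp (f := fun ζ => (⟪ℓ, ζ⟫, ⟪m, ζ⟫)) (by fun_prop) hmaps
  have hGc' : ContinuousOn (fun ζ => slabPotDeriv lam ξ ⟪ℓ, ζ⟫ ⟪m, ζ⟫) (sphereSlab ℓ a x₁) :=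
    cG'.comp (f := fun ζ => (⟪ℓ, ζ⟫, ⟪m, ζ⟫)) (by fun_prop) hmaps
  rw [← hz]
  refine setIntegral_mono_on ?_ ?_ hK.isClosed.measurableSet fun ζ hζ => ?_
  · exact integrable_mul_of_continuousOn_compact hK hKae (s := fun ζ => C ⟪ℓ, ζ⟫)
      (hCm.comp (by fun_prop)) (fun ζ => hCM _)
      (k := fun ζ => (1 - ⟪ℓ, ζ⟫ ^ 2 - ⟪m, ζ⟫ ^ 2) * slabPotDeriv lam ξ ⟪ℓ, ζ⟫ ⟪m, ζ⟫ -
        (finrank ℝ E - 2) * (⟪m, ζ⟫ * slabPot lam ξ ⟪ℓ, ζ⟫ ⟪m, ζ⟫))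
      ((ContinuousOn.mul (by fun_prop) hGc').sub
        (continuousOn_const.mul (ContinuousOn.mul (by fun_prop) hGc)))
  · refine integrable_mul_of_continuousOn_compact hK hKae
      (s := fun ζ => (Ioc a x₁).indicator 1 ⟪ℓ, ζ⟫) (M := 1)
      ((measurable_one.indicator measurableSet_Ioc).comp (by fun_prop)) (fun ζ => ?_)
      (k := fun ζ => (⟪m, ζ⟫ - y₀) * distSq x₁ x₂ ⟪ℓ, ζ⟫ ⟪m, ζ⟫ ^ (-lam))
      (ContinuousOn.mul (by fun_prop) (ContinuousOn.rpow_const ?_ fun ζ hζ =>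
        Or.inl (distSq_pos hx (hmaps ζ hζ).2).ne'))
    · unfold indicator
      split_ifs <;> simp
    · unfold distSq
      fun_prop
  · by_cases hs : ⟪ℓ, ζ⟫ ∈ Ioc a x₁
    · rw [hCdef, indicator_of_mem hs, indicator_of_mem hs, ← hn, Pi.one_apply, one_mul]
      exact slabPot_mul_sliceFactor_le hn2 hlam h₁ h₂ hx hζ.2 (hmaps ζ hζ).2 (hsξ _ hζ.2)
        (hk _ hζ.2)
    · rw [hCdef, indicator_of_notMem hs, indicator_of_notMem hs, zero_mul, zero_mul]

end Cap

section Kernel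

variable {E : Type*} [NormedAddCommGroup E] [InnerProductSpace ℝ E]

/-- The derivative of the Poisson kernel with pole `ζ` at the point `x` in the direction `v`. -/
noncomputable def poissonDeriv (x v ζ : E) : ℝ :=
  -(2 * ⟪x, v⟫) / ‖ζ - x‖ ^ finrank ℝ E -
    finrank ℝ E * (1 - ‖x‖ ^ 2) * ⟪x - ζ, v⟫ / ‖ζ - x‖ ^ (finrank ℝ E + 2)

theorem poissonDeriv_add_smul (x v w ζ : E) (a b : ℝ) :
    poissonDeriv x (a • v + b • w) ζ = a * poissonDeriv x v ζ + b * poissonDeriv x w ζ := by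
  unfold poissonDeriv
  simp only [inner_add_right, inner_smul_right]
  ring

theorem continuousOn_poissonDeriv {x : E} (hx : ‖x‖ < 1) (v : E) :
    ContinuousOn (poissonDeriv x v) (sphere 0 1) := by
  have h : ∀ ζ ∈ sphere (0 : E) 1, ‖ζ - x‖ ≠ 0 := fun ζ hζ =>
    norm_ne_zero_iff.2 (sub_ne_zero_of_norm hx (by simpa using hζ))
  unfold poissonDeriv
  exact ((ContinuousOn.div (by fun_prop) (by fun_prop) fun ζ hζ => pow_ne_zero _ (h ζ hζ)).sub
    (ContinuousOn.div (by fun_prop) (by fun_prop) fun ζ hζ => pow_ne_zero _ (h ζ hζ)))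

/-- The linear form whose sign governs the sign of `poissonDeriv`. -/
noncomputable def chordForm (x v θ : E) : ℝ :=
  ⟪x, v⟫ + rayLen x θ * ⟪v, θ⟫ - (finrank ℝ E - 2) / finrank ℝ E * ⟪x, v⟫

theorem rayDisc_neg (x θ : E) : rayDisc x (-θ) = rayDisc x θ := by
  simp [rayDisc]

theorem rayLen_neg_mul {x : E} (hx : ‖x‖ < 1) (θ : E) :
    rayLen x (-θ) * rayLen x θ = 1 - ‖x‖ ^ 2 := by
  rw [rayLen, rayLen, rayDisc_neg, inner_neg_right]
  linear_combination rayDisc_sq hx θ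

theorem poissonDeriv_eq [FiniteDimensional ℝ E] [Nontrivial E] {x ζ : E} (hx : ‖x‖ < 1)
    (hζ : ‖ζ‖ = 1) (v : E) :
    poissonDeriv x v ζ = -(finrank ℝ E * (rayLen x (dirFrom x ζ) ^ finrank ℝ E)⁻¹ *
      chordForm x v (-dirFrom x ζ)) := by
  have hr := rayLen_pos hx (dirFrom x ζ)
  have h1 : x - ζ = -(rayLen x (dirFrom x ζ) • dirFrom x ζ) := by
    conv_lhs => rw [← add_rayLen_smul_dirFrom hx hζ]
    abel
  have hn : (finrank ℝ E : ℝ) ≠ 0 := Nat.cast_ne_zero.2 finrank_pos.ne'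
  have h2 : rayLen x (-dirFrom x ζ) = (1 - ‖x‖ ^ 2) / rayLen x (dirFrom x ζ) := by
    rw [eq_div_iff hr.ne', rayLen_neg_mul hx]
  rw [poissonDeriv, chordForm, h1, ← rayLen_dirFrom hx hζ, h2, inner_neg_right, inner_neg_left,
    real_inner_smul_left, real_inner_comm v (dirFrom x ζ), pow_add]
  set r := rayLen x (dirFrom x ζ)
  have hrn := (pow_pos hr (finrank ℝ E)).ne'
  field_simp
  ring

variable [FiniteDimensional ℝ E] [MeasurableSpace E] [BorelSpace E] [Nontrivial E]

theorem continuous_chordForm (x v : E) : Continuous (chordForm x v) := by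
  have := continuous_rayLen x
  unfold chordForm
  fun_prop

theorem measurableSet_chord_cap (x ℓ : E) :
    MeasurableSet {θ | 0 < chordForm x ℓ θ ∧ ⟪ℓ, θ⟫ ≤ 0} := by
  have h1 : MeasurableSet {θ | 0 < chordForm x ℓ θ} :=
    measurableSet_lt measurable_const (continuous_chordForm x ℓ).measurable
  have h2 : MeasurableSet {θ : E | ⟪ℓ, θ⟫ ≤ 0} := measurableSet_le (by fun_prop) measurable_const
  exact h1.inter h2

/-- The weight `±1` given by the sign of a real number. -/
noncomputable def signWeight (t : ℝ) : ℝ := if t < 0 then -1 else 1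

theorem signWeight_mul_self (t : ℝ) : signWeight t * t = |t| := by
  unfold signWeight
  split_ifs with h
  · rw [abs_of_neg h]; ring
  · rw [abs_of_nonneg (not_lt.1 h)]; ring

theorem abs_signWeight (t : ℝ) : |signWeight t| = 1 := by
  unfold signWeight
  split_ifs <;> simp

theorem measurable_signWeight : Measurable signWeight :=
  Measurable.ite measurableSet_Iio measurable_const measurable_const

theorem signWeight_mul_of_pos {c : ℝ} (hc : 0 < c) (t : ℝ) :
    signWeight (c * t) = signWeight t := by
  unfold signWeight
  simp only [mul_neg_iff, hc, hc.not_gt, true_and, false_and, or_false]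

theorem integral_signWeight_poissonDeriv {x : E} (hx : ‖x‖ < 1) (ℓ m : E) :
    ∫ ζ, signWeight (poissonDeriv x ℓ ζ) * poissonDeriv x m ζ ∂sphereMeasure E =
      finrank ℝ E / (1 - ‖x‖ ^ 2) * ∫ θ, -signWeight (-chordForm x ℓ θ) *
        (chordForm x m θ * (rayLen x θ / rayDisc x θ)) ∂sphereMeasure E := by
  have hn : (0 : ℝ) < finrank ℝ E := Nat.cast_pos.2 finrank_pos
  have hmr := (continuous_rayLen x).measurable
  have hmd := (continuous_rayDisc x).measurable
  have hc : ∀ v, Measurable fun φ => chordForm x v (-φ) :=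
    fun v => (continuous_chordForm x v).measurable.comp measurable_neg
  have h := integral_dirFrom hx (g := fun φ => -signWeight (-chordForm x ℓ (-φ)) *
    (finrank ℝ E * (rayLen x φ ^ finrank ℝ E)⁻¹ * chordForm x m (-φ)) *
    (rayLen x φ * rayDisc x φ)⁻¹) (by
      have h1 : Measurable fun φ => signWeight (-chordForm x ℓ (-φ)) :=
        measurable_signWeight.comp (hc ℓ).neg
      have h2 := hc m
      fun_prop)
  rw [← integral_const_mul, eq_comm, ← integral_neg_sphereMeasure, eq_comm]
  convert h using 1
  · refine integral_congr_ae ?_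
    filter_upwards [ae_norm_eq_one (E := E)] with ζ hζ
    have h1 := rayLen_pos hx (dirFrom x ζ)
    have h2 := rayDisc_pos hx (dirFrom x ζ)
    have h3 : (0 : ℝ) < finrank ℝ E * (rayLen x (dirFrom x ζ) ^ finrank ℝ E)⁻¹ := by positivity
    rw [poissonDeriv_eq hx hζ, poissonDeriv_eq hx hζ, ← rayLen_mul_rayDisc_dirFrom hx hζ, ← mul_neg,
      signWeight_mul_of_pos h3]
    field_simp
  · refine integral_congr_ae (Eventually.of_forall fun φ => ?_)
    have h1 := rayLen_pos hx φ
    have h2 := rayDisc_pos hx φ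
    have h3 := one_sub_norm_sq_pos hx
    have h4 : rayLen x (-φ) = (1 - ‖x‖ ^ 2) / rayLen x φ := by
      rw [eq_div_iff h1.ne', rayLen_neg_mul hx]
    simp only [rayDisc_neg, h4]
    field_simp

theorem chordForm_dirFrom {x ζ : E} (hx : ‖x‖ < 1) (hζ : ‖ζ‖ = 1) (v : E) :
    chordForm x v (dirFrom x ζ) = ⟪v, ζ⟫ - (finrank ℝ E - 2) / finrank ℝ E * ⟪x, v⟫ := by
  have h : ⟪v, ζ⟫ = ⟪x, v⟫ + rayLen x (dirFrom x ζ) * ⟪v, dirFrom x ζ⟫ := by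
    conv_lhs => rw [← add_rayLen_smul_dirFrom hx hζ]
    rw [inner_add_right, inner_smul_right, real_inner_comm]
  rw [h, chordForm]

theorem inner_dirFrom_nonpos_iff {x ζ : E} (hx : ‖x‖ < 1) (hζ : ‖ζ‖ = 1) (v : E) :
    ⟪v, dirFrom x ζ⟫ ≤ 0 ↔ ⟪v, ζ⟫ ≤ ⟪x, v⟫ := by
  have h := sub_ne_zero_of_norm hx hζ
  rw [dirFrom, inner_smul_right, inner_sub_right, real_inner_comm x v,
    ← smul_eq_mul, smul_nonpos_iff_nonpos_of_pos_left (inv_pos.2 (norm_pos_iff.2 h)), sub_nonpos]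

theorem integral_chord_cap_nonneg {x ℓ m : E} (hE : 3 ≤ finrank ℝ E) (hx : ‖x‖ < 1)
    (hℓ : ‖ℓ‖ = 1) (hm : ‖m‖ = 1) (hlm : ⟪ℓ, m⟫ = 0) {x₁ x₂ : ℝ} (h₁ : 0 ≤ x₁) (h₂ : 0 ≤ x₂)
    (hxe : x = x₁ • ℓ + x₂ • m) :
    0 ≤ ∫ θ, {θ | 0 < chordForm x ℓ θ ∧ ⟪ℓ, θ⟫ ≤ 0}.indicator 1 θ *
      (chordForm x m θ * (rayLen x θ / rayDisc x θ)) ∂sphereMeasure E := by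
  obtain ⟨n, hn⟩ : ∃ n : ℝ, n = finrank ℝ E := ⟨_, rfl⟩
  have hn3 : (3 : ℝ) ≤ n := by rw [hn]; exact_mod_cast hE
  have hxℓ : ⟪x, ℓ⟫ = x₁ := by
    rw [hxe, inner_add_left, real_inner_smul_left, real_inner_smul_left, real_inner_comm ℓ m, hlm,
      real_inner_self_eq_norm_sq, hℓ]
    ring
  have hxm : ⟪x, m⟫ = x₂ := by
    rw [hxe, inner_add_left, real_inner_smul_left, real_inner_smul_left, hlm,
      real_inner_self_eq_norm_sq, hm]
    ring
  have hnx : ‖x‖ ^ 2 = x₁ ^ 2 + x₂ ^ 2 := by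
    have h : ⟪x, x⟫ = x₁ * ⟪x, ℓ⟫ + x₂ * ⟪x, m⟫ := by
      conv_lhs => rw [hxe, inner_add_right, real_inner_smul_right, real_inner_smul_right, ← hxe]
    rw [← real_inner_self_eq_norm_sq, h, hxℓ, hxm]
    ring
  have hx1 : x₁ ^ 2 + x₂ ^ 2 < 1 := by rw [← hnx]; linarith [one_sub_norm_sq_pos hx]
  have hcap := setIntegral_cap_nonneg hℓ hm hlm h₁ h₂ hx1 hn (by linarith)
    (lam := (n - 2) / 2) (by ring)
  have hmr := (continuous_rayLen x).measurable
  have hmd := (continuous_rayDisc x).measurable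
  have hmc := fun v => (continuous_chordForm x v).measurable
  have hset : MeasurableSet {θ | 0 < chordForm x ℓ θ ∧ ⟪ℓ, θ⟫ ≤ 0} :=
    measurableSet_chord_cap x ℓ
  have h := integral_dirFrom hx (g := fun θ =>
    {θ | 0 < chordForm x ℓ θ ∧ ⟪ℓ, θ⟫ ≤ 0}.indicator 1 θ * (chordForm x m θ *
      (rayLen x θ / rayDisc x θ)) * (rayLen x θ ^ finrank ℝ E)⁻¹) (by
      have h1 := measurable_one.indicator (f := (1 : E → ℝ)) hset
      have h2 := hmc m
      fun_prop)
  have e1 : ∀ θ, {θ | 0 < chordForm x ℓ θ ∧ ⟪ℓ, θ⟫ ≤ 0}.indicator 1 θ * (chordForm x m θ *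
      (rayLen x θ / rayDisc x θ)) * (rayLen x θ ^ finrank ℝ E)⁻¹ * rayLen x θ ^ finrank ℝ E =
      {θ | 0 < chordForm x ℓ θ ∧ ⟪ℓ, θ⟫ ≤ 0}.indicator 1 θ * (chordForm x m θ *
      (rayLen x θ / rayDisc x θ)) := fun θ =>
    inv_mul_cancel_right₀ (pow_pos (rayLen_pos hx θ) _).ne' _
  simp only [e1] at h
  rw [← h]
  refine hcap.trans_eq ?_
  rw [← integral_indicator (isCompact_sphereSlab _ _ _).isClosed.measurableSet]
  refine integral_congr_ae ?_
  filter_upwards [ae_norm_eq_one (E := E)] with ζ hζ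
  by_cases hs : ⟪ℓ, ζ⟫ ∈ Ioc ((n - 2) / n * x₁) x₁
  · have hd : dirFrom x ζ ∈ {θ | 0 < chordForm x ℓ θ ∧ ⟪ℓ, θ⟫ ≤ 0} := by
      refine ⟨?_, ?_⟩
      · rw [chordForm_dirFrom hx hζ, hxℓ, ← hn]
        exact sub_pos.2 hs.1
      · rw [inner_dirFrom_nonpos_iff hx hζ, hxℓ]
        exact hs.2
    have hmem : ζ ∈ sphereSlab ℓ ((n - 2) / n * x₁) x₁ := ⟨hζ, Ioc_subset_Icc_self hs⟩
    rw [indicator_of_mem hmem, indicator_of_mem hs, indicator_of_mem hd,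
      chordForm_dirFrom hx hζ, hxm, ← hn, ← rayLen_mul_rayDisc_dirFrom hx hζ]
    have hq : distSq x₁ x₂ ⟪ℓ, ζ⟫ ⟪m, ζ⟫ = rayLen x (dirFrom x ζ) ^ 2 := by
      rw [rayLen_dirFrom hx hζ, norm_sub_sq_real, hζ, hnx, hxe, inner_add_right, inner_smul_right,
        inner_smul_right, distSq, real_inner_comm ℓ ζ, real_inner_comm m ζ]
      ring
    have hr := rayLen_pos hx (dirFrom x ζ)
    have hD := rayDisc_pos hx (dirFrom x ζ)
    have hp : distSq x₁ x₂ ⟪ℓ, ζ⟫ ⟪m, ζ⟫ ^ (-((n - 2) / 2)) =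
        rayLen x (dirFrom x ζ) ^ 2 * (rayLen x (dirFrom x ζ) ^ finrank ℝ E)⁻¹ := by
      rw [hq, ← Real.rpow_natCast _ 2, ← Real.rpow_mul hr.le, ← Real.rpow_natCast _ (finrank ℝ E),
        ← Real.rpow_neg hr.le, ← Real.rpow_add hr, ← hn]
      congr 1
      push_cast
      ring
    rw [hp]
    simp only [Pi.one_apply]
    field_simp
  · have hd : dirFrom x ζ ∉ {θ | 0 < chordForm x ℓ θ ∧ ⟪ℓ, θ⟫ ≤ 0} := by
      rintro ⟨hd1, hd2⟩
      rw [chordForm_dirFrom hx hζ, hxℓ, ← hn] at hd1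
      rw [inner_dirFrom_nonpos_iff hx hζ, hxℓ] at hd2
      exact hs ⟨sub_pos.1 hd1, hd2⟩
    rw [indicator_of_notMem hd]
    by_cases hmem : ζ ∈ sphereSlab ℓ ((n - 2) / n * x₁) x₁
    · rw [indicator_of_mem hmem, indicator_of_notMem hs]
      ring
    · rw [indicator_of_notMem hmem]
      ring

/-- The key inequality: moving `ℓ` towards `x` does not decrease the `L¹` norm of the kernel to
first order. -/
theorem integral_signWeight_mul_poissonDeriv_nonneg {x ℓ m : E} (hE : 3 ≤ finrank ℝ E)
    (hx : ‖x‖ < 1) (hℓ : ‖ℓ‖ = 1) (hm : ‖m‖ = 1) (hlm : ⟪ℓ, m⟫ = 0) {x₁ x₂ : ℝ} (h₁ : 0 ≤ x₁)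
    (h₂ : 0 ≤ x₂) (hxe : x = x₁ • ℓ + x₂ • m) :
    0 ≤ ∫ ζ, signWeight (poissonDeriv x ℓ ζ) * poissonDeriv x m ζ ∂sphereMeasure E := by
  rw [integral_signWeight_poissonDeriv hx]
  have hE' : (3 : ℝ) ≤ finrank ℝ E := by exact_mod_cast hE
  refine mul_nonneg (div_nonneg (Nat.cast_nonneg _) (one_sub_norm_sq_pos hx).le) ?_
  have hxℓ : ⟪x, ℓ⟫ = x₁ := by
    rw [hxe, inner_add_left, real_inner_smul_left, real_inner_smul_left, real_inner_comm ℓ m, hlm,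
      real_inner_self_eq_norm_sq, hℓ]
    ring
  have hxm : ⟪x, m⟫ = x₂ := by
    rw [hxe, inner_add_left, real_inner_smul_left, real_inner_smul_left, hlm,
      real_inner_self_eq_norm_sq, hm]
    ring
  have hk : Continuous fun θ => chordForm x m θ * (rayLen x θ / rayDisc x θ) :=
    (continuous_chordForm x m).mul ((continuous_rayLen x).div (continuous_rayDisc x)
      fun θ => (rayDisc_pos hx θ).ne')
  have hset : MeasurableSet {θ | 0 < chordForm x ℓ θ ∧ ⟪ℓ, θ⟫ ≤ 0} :=
    measurableSet_chord_cap x ℓ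
  have i1 := integrable_sign_mul (ℓ := ℓ) hk
  have i2 : Integrable (fun θ => {θ | 0 < chordForm x ℓ θ ∧ ⟪ℓ, θ⟫ ≤ 0}.indicator 1 θ *
      (chordForm x m θ * (rayLen x θ / rayDisc x θ))) (sphereMeasure E) := by
    refine integrable_mul_of_continuousOn_compact (isCompact_sphere 0 1) ae_mem_sphere (M := 1)
      (measurable_one.indicator hset) (fun θ => ?_) hk.continuousOn
    unfold indicator
    split_ifs <;> simp
  have z1 := integral_sign_chord_nonneg hx hm hlm h₁ h₂ hxe rfl (by linarith)
  have z2 := integral_chord_cap_nonneg hE hx hℓ hm hlm h₁ h₂ hxe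
  have e : ∫ θ, -signWeight (-chordForm x ℓ θ) *
      (chordForm x m θ * (rayLen x θ / rayDisc x θ)) ∂sphereMeasure E =
      ∫ θ, (Real.sign ⟪ℓ, θ⟫ * (chordForm x m θ * (rayLen x θ / rayDisc x θ)) +
        2 * ({θ | 0 < chordForm x ℓ θ ∧ ⟪ℓ, θ⟫ ≤ 0}.indicator 1 θ *
      (chordForm x m θ * (rayLen x θ / rayDisc x θ)))) ∂sphereMeasure E := by
    refine integral_congr_ae ?_
    have hℓ0 : ℓ ≠ 0 := norm_ne_zero_iff.1 (by rw [hℓ]; exact one_ne_zero)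
    filter_upwards [ae_inner_ne_zero hℓ0] with θ hθ
    rw [← mul_assoc 2, ← add_mul]
    congr 1
    rcases lt_or_gt_of_ne hθ with h | h
    · rw [Real.sign_of_neg h]
      by_cases hc : 0 < chordForm x ℓ θ
      · have : θ ∈ {θ | 0 < chordForm x ℓ θ ∧ ⟪ℓ, θ⟫ ≤ 0} := ⟨hc, h.le⟩
        rw [indicator_of_mem this, signWeight, if_pos (neg_neg_of_pos hc), Pi.one_apply]
        norm_num
      · have : θ ∉ {θ | 0 < chordForm x ℓ θ ∧ ⟪ℓ, θ⟫ ≤ 0} := fun h' => hc h'.1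
        rw [indicator_of_notMem this, signWeight, if_neg fun h' => hc (neg_neg_iff_pos.1 h')]
        norm_num
    · have hc : 0 < chordForm x ℓ θ := by
        rw [chordForm, hxℓ]
        have h5 := mul_pos (rayLen_pos hx θ) h
        have h6 : (finrank ℝ E - 2 : ℝ) / finrank ℝ E * x₁ ≤ x₁ :=
          mul_le_of_le_one_left h₁ ((div_le_one (by linarith)).2 (by linarith))
        linarith
      have : θ ∉ {θ | 0 < chordForm x ℓ θ ∧ ⟪ℓ, θ⟫ ≤ 0} := fun h' => h'.2.not_gt h
      rw [Real.sign_of_pos h, indicator_of_notMem this, signWeight, if_pos (neg_neg_of_pos hc)]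
      norm_num
  rw [e, integral_add i1 (i2.const_mul 2), integral_const_mul]
  refine add_nonneg ?_ (mul_nonneg zero_le_two z2)
  simpa only [chordForm, hxm] using z1

end Kernel

section Rotation

variable {E : Type*} [NormedAddCommGroup E] [InnerProductSpace ℝ E] [FiniteDimensional ℝ E]
  [MeasurableSpace E] [BorelSpace E] [Nontrivial E]

/-- The `L¹` norm over the sphere of the derivative of the Poisson kernel at `x` in the
direction `v`. -/
noncomputable def poissonDerivNorm (x v : E) : ℝ :=
  ∫ ζ, |poissonDeriv x v ζ| ∂sphereMeasure E

theorem poissonDeriv_neg (x v ζ : E) : poissonDeriv x (-v) ζ = -poissonDeriv x v ζ := by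
  have h := poissonDeriv_add_smul x v 0 ζ (-1) 0
  simpa using h

theorem poissonDerivNorm_neg (x v : E) : poissonDerivNorm x (-v) = poissonDerivNorm x v := by
  simp [poissonDerivNorm, poissonDeriv_neg]

theorem poissonDerivNorm_nonneg (x v : E) : 0 ≤ poissonDerivNorm x v :=
  integral_nonneg fun _ => abs_nonneg _

theorem measurable_poissonDeriv (x v : E) : Measurable (poissonDeriv x v) := by
  unfold poissonDeriv
  fun_prop

theorem integrable_signWeight_mul_poissonDeriv {x : E} (hx : ‖x‖ < 1) (v w : E) :
    Integrable (fun ζ => signWeight (poissonDeriv x v ζ) * poissonDeriv x w ζ)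
      (sphereMeasure E) :=
  integrable_mul_of_continuousOn_compact (isCompact_sphere 0 1) ae_mem_sphere (M := 1)
    (measurable_signWeight.comp (measurable_poissonDeriv x v)) (fun _ => (abs_signWeight _).le)
    (continuousOn_poissonDeriv hx w)

theorem integral_signWeight_mul_le_poissonDerivNorm {x : E} (hx : ‖x‖ < 1) (v w : E) :
    ∫ ζ, signWeight (poissonDeriv x v ζ) * poissonDeriv x w ζ ∂sphereMeasure E ≤
      poissonDerivNorm x w := by
  refine integral_mono (integrable_signWeight_mul_poissonDeriv hx v w)
    (integrable_of_continuousOn_compact (isCompact_sphere 0 1) ae_mem_sphere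
      (continuousOn_poissonDeriv hx w)).abs fun ζ => ?_
  refine (le_abs_self _).trans_eq ?_
  rw [abs_mul, abs_signWeight, one_mul]

/-- The unit vector at angle `α` from `e` in the oriented plane spanned by `e` and `f`. -/
noncomputable def planarDir (e f : E) (α : ℝ) : E := Real.cos α • e + Real.sin α • f

theorem cos_mul_poissonDerivNorm_le {x e f : E} (hE : 3 ≤ finrank ℝ E) (hx : ‖x‖ < 1)
    (he : ‖e‖ = 1) (hf : ‖f‖ = 1) (hef : ⟪e, f⟫ = 0) {r : ℝ} (hr : 0 ≤ r) (hxe : x = r • e)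
    {α β : ℝ} (hβ : 0 ≤ β) (hβα : β ≤ α) (hα : α ≤ Real.pi / 2) :
    Real.cos (α - β) * poissonDerivNorm x (planarDir e f α) ≤
      poissonDerivNorm x (planarDir e f β) := by
  have hcos : 0 ≤ Real.cos α := Real.cos_nonneg_of_mem_Icc ⟨by linarith [Real.pi_pos], hα⟩
  have hsin : 0 ≤ Real.sin α := Real.sin_nonneg_of_nonneg_of_le_pi (by linarith)
    (by linarith [Real.pi_pos])
  have hsin' : 0 ≤ Real.sin (α - β) := Real.sin_nonneg_of_nonneg_of_le_pi (by linarith)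
    (by linarith [Real.pi_pos])
  have hcs := Real.sin_sq_add_cos_sq α
  set m := Real.sin α • e - Real.cos α • f with hm
  have hfe : ⟪f, e⟫ = 0 := by rw [real_inner_comm, hef]
  have hee : ⟪e, e⟫ = 1 := by rw [real_inner_self_eq_norm_sq, he]; norm_num
  have hff : ⟪f, f⟫ = 1 := by rw [real_inner_self_eq_norm_sq, hf]; norm_num
  have hℓ1 : ‖planarDir e f α‖ = 1 := by
    rw [← sq_eq_sq₀ (norm_nonneg _) zero_le_one, ← real_inner_self_eq_norm_sq, planarDir]
    simp only [inner_add_left, inner_add_right, real_inner_smul_left, real_inner_smul_right, hef,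
      hfe, hee, hff]
    linear_combination hcs
  have hm1 : ‖m‖ = 1 := by
    rw [← sq_eq_sq₀ (norm_nonneg _) zero_le_one, ← real_inner_self_eq_norm_sq, hm]
    simp only [inner_sub_left, inner_sub_right, real_inner_smul_left, real_inner_smul_right, hef,
      hfe, hee, hff]
    linear_combination hcs
  have hlm : ⟪planarDir e f α, m⟫ = 0 := by
    rw [planarDir, hm]
    simp only [inner_add_left, inner_sub_right, real_inner_smul_left, real_inner_smul_right, hef,
      hfe, hee, hff]
    ring
  have hxe' : x = (r * Real.cos α) • planarDir e f α + (r * Real.sin α) • m := by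
    rw [planarDir, hm, hxe]
    match_scalars
    · linear_combination -r * hcs
    · ring
  have hβe : planarDir e f β =
      Real.cos (α - β) • planarDir e f α + Real.sin (α - β) • m := by
    have h1 := Real.cos_sub α (α - β)
    have h2 := Real.sin_sub α (α - β)
    rw [sub_sub_cancel] at h1 h2
    rw [planarDir, planarDir, hm, h1, h2]
    module
  have key := integral_signWeight_mul_poissonDeriv_nonneg hE hx hℓ1 hm1 hlm
    (mul_nonneg hr hcos) (mul_nonneg hr hsin) hxe'
  refine le_trans ?_ (integral_signWeight_mul_le_poissonDerivNorm hx (planarDir e f α) _)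
  have e1 : ∀ ζ, signWeight (poissonDeriv x (planarDir e f α) ζ) *
      poissonDeriv x (planarDir e f β) ζ =
      Real.cos (α - β) * |poissonDeriv x (planarDir e f α) ζ| + Real.sin (α - β) *
        (signWeight (poissonDeriv x (planarDir e f α) ζ) * poissonDeriv x m ζ) := by
    intro ζ
    rw [hβe, poissonDeriv_add_smul, ← signWeight_mul_self]
    ring
  have i1 := (integrable_of_continuousOn_compact (isCompact_sphere 0 1) ae_mem_sphere
      (continuousOn_poissonDeriv hx (planarDir e f α))).abs
  have i2 := integrable_signWeight_mul_poissonDeriv hx (planarDir e f α) m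
  simp only [e1]
  rw [integral_add (i1.const_mul _) (i2.const_mul _), integral_const_mul, integral_const_mul]
  exact le_add_of_nonneg_right (mul_nonneg hsin' key)

theorem cos_pow_mul_poissonDerivNorm_le {x e f : E} (hE : 3 ≤ finrank ℝ E) (hx : ‖x‖ < 1)
    (he : ‖e‖ = 1) (hf : ‖f‖ = 1) (hef : ⟪e, f⟫ = 0) {r : ℝ} (hr : 0 ≤ r) (hxe : x = r • e)
    {t : ℝ} (ht : 0 ≤ t) (k : ℕ) (hk : k * t ≤ Real.pi / 2) :
    Real.cos t ^ k * poissonDerivNorm x (planarDir e f (k * t)) ≤ poissonDerivNorm x e := by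
  induction k with
  | zero => simp [planarDir]
  | succ k ih =>
    push_cast at hk ⊢
    have hk0 : 0 ≤ k * t := by positivity
    have hc : 0 ≤ Real.cos t :=
      Real.cos_nonneg_of_mem_Icc ⟨by linarith [Real.pi_pos], by linarith⟩
    have h := cos_mul_poissonDerivNorm_le hE hx he hf hef hr hxe hk0
      (by linarith : k * t ≤ (k + 1) * t) hk
    rw [show (k + 1) * t - k * t = t by ring] at h
    refine le_trans ?_ (ih (by linarith))
    rw [pow_succ, mul_assoc]
    exact mul_le_mul_of_nonneg_left h (pow_nonneg hc k)

theorem poissonDerivNorm_planarDir_le {x e f : E} (hE : 3 ≤ finrank ℝ E) (hx : ‖x‖ < 1)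
    (he : ‖e‖ = 1) (hf : ‖f‖ = 1) (hef : ⟪e, f⟫ = 0) {r : ℝ} (hr : 0 ≤ r) (hxe : x = r • e)
    {α : ℝ} (hα0 : 0 ≤ α) (hα : α ≤ Real.pi / 2) :
    poissonDerivNorm x (planarDir e f α) ≤ poissonDerivNorm x e := by
  have hlim : Tendsto (fun N : ℕ => (1 - α ^ 2 / 2 * (N : ℝ)⁻¹) *
      poissonDerivNorm x (planarDir e f α)) atTop
      (𝓝 ((1 - α ^ 2 / 2 * 0) * poissonDerivNorm x (planarDir e f α))) :=
    ((tendsto_inv_atTop_nhds_zero_nat.const_mul _).const_sub _).mul_const _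
  rw [mul_zero, sub_zero, one_mul] at hlim
  refine le_of_tendsto hlim ?_
  filter_upwards [eventually_ge_atTop 2] with N hN
  have hN2 : (2 : ℝ) ≤ N := by exact_mod_cast hN
  have hN0 : (0 : ℝ) < N := by linarith
  have hNα : N * (α / N) = α := mul_div_cancel₀ α hN0.ne'
  have h := cos_pow_mul_poissonDerivNorm_le hE hx he hf hef hr hxe
    (div_nonneg hα0 hN0.le) N (by rwa [hNα])
  rw [hNα] at h
  refine (mul_le_mul_of_nonneg_right ?_ (poissonDerivNorm_nonneg _ _)).trans h
  have h3 : α / N ≤ 1 := by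
    rw [div_le_one hN0]
    linarith [Real.pi_le_four]
  have h4 : 0 ≤ α / N := div_nonneg hα0 hN0.le
  have h1 := one_add_mul_le_pow (a := -((α / N) ^ 2 / 2)) (by nlinarith) N
  have h2 : 1 + -((α / N) ^ 2 / 2) ≤ Real.cos (α / N) := by
    linarith [Real.one_sub_sq_div_two_le_cos (x := α / N)]
  refine le_trans (le_of_eq ?_) (h1.trans (pow_le_pow_left₀ (by nlinarith) h2 N))
  field_simp
  ring

theorem poissonDerivNorm_le_of_inner_nonneg {x e ℓ : E} (hE : 3 ≤ finrank ℝ E) (hx : ‖x‖ < 1)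
    (he : ‖e‖ = 1) {r : ℝ} (hr : 0 ≤ r) (hxe : x = r • e) (hℓ : ‖ℓ‖ = 1) (h : 0 ≤ ⟪e, ℓ⟫) :
    poissonDerivNorm x ℓ ≤ poissonDerivNorm x e := by
  by_cases hel : ℓ = e
  · rw [hel]
  have h1 : ⟪e, ℓ⟫ < 1 := (inner_lt_one_iff_real_of_norm_eq_one he hℓ).2 (Ne.symm hel)
  set c := ⟪e, ℓ⟫ with hc
  have hcc : Real.cos (Real.arccos c) = c := Real.cos_arccos (by linarith) h1.le
  have hss : Real.sin (Real.arccos c) = √(1 - c ^ 2) := Real.sin_arccos c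
  have hs0 : 0 < √(1 - c ^ 2) := Real.sqrt_pos.2 (by nlinarith)
  have hee : ⟪e, e⟫ = 1 := by rw [real_inner_self_eq_norm_sq, he]; norm_num
  have hn : ‖ℓ - c • e‖ = √(1 - c ^ 2) := by
    rw [eq_comm, Real.sqrt_eq_iff_mul_self_eq (by nlinarith) (norm_nonneg _), ← pow_two,
      norm_sub_sq_real, norm_smul, he, hℓ, real_inner_smul_right, real_inner_comm, ← hc,
      Real.norm_eq_abs, mul_one, sq_abs]
    ring
  have hℓe : ℓ = planarDir e ((√(1 - c ^ 2))⁻¹ • (ℓ - c • e)) (Real.arccos c) := by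
    rw [planarDir, hcc, hss, smul_inv_smul₀ hs0.ne']
    abel
  rw [hℓe]
  refine poissonDerivNorm_planarDir_le hE hx he ?_ ?_ hr hxe (Real.arccos_nonneg c)
    (Real.arccos_le_pi_div_two.2 h)
  · rw [norm_smul, hn, norm_inv, Real.norm_of_nonneg hs0.le, inv_mul_cancel₀ hs0.ne']
  · rw [real_inner_smul_right, inner_sub_right, real_inner_smul_right, hee, ← hc]
    ring

/-- Among all directions, the radial one maximises the `L¹` norm of the derivative of the Poisson
kernel. -/
theorem poissonDerivNorm_le_radial {x ℓ : E} (hE : 3 ≤ finrank ℝ E) (hx : ‖x‖ < 1) (hx0 : x ≠ 0)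
    (hℓ : ‖ℓ‖ = 1) : poissonDerivNorm x ℓ ≤ poissonDerivNorm x (‖x‖⁻¹ • x) := by
  have hn : ‖x‖ ≠ 0 := norm_ne_zero_iff.2 hx0
  have he : ‖‖x‖⁻¹ • x‖ = 1 := by rw [norm_smul, norm_inv, norm_norm, inv_mul_cancel₀ hn]
  have hxe : x = ‖x‖ • (‖x‖⁻¹ • x) := (smul_inv_smul₀ hn x).symm
  rcases le_total 0 ⟪‖x‖⁻¹ • x, ℓ⟫ with h | h
  · exact poissonDerivNorm_le_of_inner_nonneg hE hx he (norm_nonneg x) hxe hℓ h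
  · rw [← poissonDerivNorm_neg x ℓ]
    refine poissonDerivNorm_le_of_inner_nonneg hE hx he (norm_nonneg x) hxe ?_ ?_
    · rwa [norm_neg]
    · rw [inner_neg_right]
      linarith

end Rotation

section Poisson

variable {E : Type*} [NormedAddCommGroup E] [InnerProductSpace ℝ E]

/-- The Poisson kernel of the unit ball. -/
noncomputable def ballPoissonKernel (y ζ : E) : ℝ := (1 - ‖y‖ ^ 2) * (‖ζ - y‖ ^ finrank ℝ E)⁻¹

/-- The gradient of the Poisson kernel in its first variable. -/
noncomputable def poissonGrad (y ζ : E) : E :=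
  (-2 * (‖ζ - y‖ ^ finrank ℝ E)⁻¹) • y +
    ((1 - ‖y‖ ^ 2) * (finrank ℝ E * (‖ζ - y‖ ^ (finrank ℝ E + 2))⁻¹)) • (ζ - y)

/-- The Hessian of the Poisson kernel in its first variable. -/
noncomputable def poissonHess (y ζ : E) : E →L[ℝ] E :=
  (-2 * (‖ζ - y‖ ^ finrank ℝ E)⁻¹ -
      (1 - ‖y‖ ^ 2) * (finrank ℝ E * (‖ζ - y‖ ^ (finrank ℝ E + 2))⁻¹)) •
        ContinuousLinearMap.id ℝ E +
    (innerSL ℝ ((-2 * (finrank ℝ E * (‖ζ - y‖ ^ (finrank ℝ E + 2))⁻¹)) • (ζ - y))).smulRight y +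
    (innerSL ℝ ((-2 * (finrank ℝ E * (‖ζ - y‖ ^ (finrank ℝ E + 2))⁻¹)) • y +
      ((1 - ‖y‖ ^ 2) * finrank ℝ E * ((finrank ℝ E + 2) * (‖ζ - y‖ ^ (finrank ℝ E + 4))⁻¹)) •
        (ζ - y))).smulRight (ζ - y)

theorem inner_poissonGrad (y v ζ : E) : ⟪poissonGrad y ζ, v⟫ = poissonDeriv y v ζ := by
  rw [poissonGrad, poissonDeriv, inner_add_left, real_inner_smul_left, real_inner_smul_left,
    ← neg_sub y ζ, inner_neg_left, norm_neg, norm_sub_rev y ζ]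
  ring

theorem hasFDerivAt_inv_norm_sub_pow {y ζ : E} (h : ζ - y ≠ 0) (k : ℕ) :
    HasFDerivAt (fun y => (‖ζ - y‖ ^ k)⁻¹)
      (innerSL ℝ ((k * (‖ζ - y‖ ^ (k + 2))⁻¹) • (ζ - y))) y := by
  have hr : ‖ζ - y‖ ≠ 0 := norm_ne_zero_iff.2 h
  have h1 : HasFDerivAt (fun y => ζ - y) (-ContinuousLinearMap.id ℝ E) y :=
    (hasFDerivAt_id y).const_sub ζ
  have h2 := (hasFDerivAt_norm' h).comp y h1
  have h3 : HasDerivAt (fun r : ℝ => (r ^ k)⁻¹)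
      (-(k * ‖ζ - y‖ ^ (k - 1)) / (‖ζ - y‖ ^ k) ^ 2) ‖ζ - y‖ :=
    (hasDerivAt_pow k ‖ζ - y‖).fun_inv (pow_ne_zero k hr)
  refine (h3.comp_hasFDerivAt y h2).congr_fderiv ?_
  ext v
  simp only [smul_apply, ContinuousLinearMap.comp_apply, innerSL_apply_apply,
    neg_apply, ContinuousLinearMap.id_apply, real_inner_smul_left,
    inner_neg_right, smul_eq_mul]
  rcases k with _ | k
  · simp
  · simp only [Nat.add_sub_cancel]
    field_simp
    ring

theorem hasFDerivAt_one_sub_norm_sq (y : E) :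
    HasFDerivAt (fun y : E => 1 - ‖y‖ ^ 2) (innerSL ℝ ((-2 : ℝ) • y)) y := by
  refine ((hasStrictFDerivAt_norm_sq y).hasFDerivAt.const_sub 1).congr_fderiv ?_
  ext v
  simp

theorem hasFDerivAt_ballPoissonKernel {y ζ : E} (h : ζ - y ≠ 0) :
    HasFDerivAt (fun y => ballPoissonKernel y ζ) (innerSL ℝ (poissonGrad y ζ)) y := by
  refine ((hasFDerivAt_one_sub_norm_sq y).mul
    (hasFDerivAt_inv_norm_sub_pow h (finrank ℝ E))).congr_fderiv ?_
  ext v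
  simp only [add_apply, smul_apply, innerSL_apply_apply,
    real_inner_smul_left, smul_eq_mul, poissonGrad, inner_add_left]
  ring

theorem hasFDerivAt_poissonGrad {y ζ : E} (h : ζ - y ≠ 0) :
    HasFDerivAt (fun y => poissonGrad y ζ) (poissonHess y ζ) y := by
  have h1 : HasFDerivAt (fun y => ζ - y) (-ContinuousLinearMap.id ℝ E) y :=
    (hasFDerivAt_id y).const_sub ζ
  have h2 := (hasFDerivAt_inv_norm_sub_pow h (finrank ℝ E)).const_mul (-2)
  have h3 := (hasFDerivAt_one_sub_norm_sq y).fun_mul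
    ((hasFDerivAt_inv_norm_sub_pow h (finrank ℝ E + 2)).const_mul (finrank ℝ E : ℝ))
  refine ((h2.smul (hasFDerivAt_id y)).add (h3.smul h1)).congr_fderiv ?_
  ext v
  simp only [add_apply, smul_apply, innerSL_apply_apply,
    ContinuousLinearMap.smulRight_apply, neg_apply,
    ContinuousLinearMap.id_apply, real_inner_smul_left, smul_eq_mul, poissonHess, inner_add_left,
    id_eq]
  push_cast
  match_scalars <;> ring

theorem continuousOn_poissonGrad :
    ContinuousOn (Function.uncurry (poissonGrad (E := E))) (ball 0 1 ×ˢ sphere 0 1) := by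
  have h : ∀ p ∈ (ball (0 : E) 1 ×ˢ sphere (0 : E) 1), ∀ k, ‖p.2 - p.1‖ ^ k ≠ 0 := fun p hp k =>
    pow_ne_zero k (norm_ne_zero_iff.2 (sub_ne_zero_of_norm (mem_ball_zero_iff.1 hp.1)
      (mem_sphere_zero_iff_norm.1 hp.2)))
  have hi : ∀ k : ℕ, ContinuousOn (fun p : E × E => (‖p.2 - p.1‖ ^ k)⁻¹)
      (ball 0 1 ×ˢ sphere 0 1) := fun k =>
    ContinuousOn.inv₀ (by fun_prop) fun p hp => h p hp k
  have h1 := hi (finrank ℝ E)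
  have h2 := hi (finrank ℝ E + 2)
  unfold poissonGrad Function.uncurry
  fun_prop

theorem continuousOn_poissonHess :
    ContinuousOn (Function.uncurry (poissonHess (E := E))) (ball 0 1 ×ˢ sphere 0 1) := by
  have h : ∀ p ∈ (ball (0 : E) 1 ×ˢ sphere (0 : E) 1), ∀ k, ‖p.2 - p.1‖ ^ k ≠ 0 := fun p hp k =>
    pow_ne_zero k (norm_ne_zero_iff.2 (sub_ne_zero_of_norm (mem_ball_zero_iff.1 hp.1)
      (mem_sphere_zero_iff_norm.1 hp.2)))
  have hi : ∀ k : ℕ, ContinuousOn (fun p : E × E => (‖p.2 - p.1‖ ^ k)⁻¹)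
      (ball 0 1 ×ˢ sphere 0 1) := fun k =>
    ContinuousOn.inv₀ (by fun_prop) fun p hp => h p hp k
  have h1 := hi (finrank ℝ E)
  have h2 := hi (finrank ℝ E + 2)
  have h3 := hi (finrank ℝ E + 4)
  have hs : ∀ c : E × E → E →L[ℝ] ℝ, ∀ f : E × E → E, ContinuousOn c (ball 0 1 ×ˢ sphere 0 1) →
      ContinuousOn f (ball 0 1 ×ˢ sphere 0 1) →
      ContinuousOn (fun p => (c p).smulRight (f p)) (ball 0 1 ×ˢ sphere 0 1) := fun c f hc hf =>
    ((ContinuousLinearMap.smulRightL ℝ E E).continuous.comp_continuousOn hc).clm_apply hf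
  unfold poissonHess Function.uncurry
  refine ContinuousOn.add (ContinuousOn.add (by fun_prop) (hs _ _ (by fun_prop) (by fun_prop)))
    (hs _ _ (by fun_prop) (by fun_prop))

theorem continuousOn_ballPoissonKernel {y : E} (hy : ‖y‖ < 1) :
    ContinuousOn (ballPoissonKernel y) (sphere 0 1) := by
  unfold ballPoissonKernel
  refine ContinuousOn.mul (by fun_prop) (ContinuousOn.inv₀ (by fun_prop) fun ζ hζ => ?_)
  exact pow_ne_zero _ (norm_ne_zero_iff.2
    (sub_ne_zero_of_norm hy (mem_sphere_zero_iff_norm.1 hζ)))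

theorem sum_inner_poissonHess [FiniteDimensional ℝ E] {ι : Type*} [Fintype ι]
    (b : OrthonormalBasis ι ℝ E) {y ζ : E} (hy : ‖y‖ < 1) (hζ : ‖ζ‖ = 1) :
    ∑ i, ⟪poissonHess y ζ (b i), b i⟫ = 0 := by
  have hr : ‖ζ - y‖ ≠ 0 := norm_ne_zero_iff.2 (sub_ne_zero_of_norm hy hζ)
  have hsum : ∀ p q : E, ∑ i, ⟪p, b i⟫ * ⟪q, b i⟫ = ⟪p, q⟫ := fun p q => by
    rw [← b.sum_inner_mul_inner p q]
    exact Finset.sum_congr rfl fun i _ => by rw [real_inner_comm q]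
  have hb : ∀ i, ⟪b i, b i⟫ = 1 := fun i => by
    rw [real_inner_self_eq_norm_sq, b.norm_eq_one]; norm_num
  have hcard : (Fintype.card ι : ℝ) = finrank ℝ E := by
    rw [finrank_eq_card_basis b.toBasis]
  have hw : ‖ζ - y‖ ^ 2 = 1 - 2 * ⟪ζ, y⟫ + ‖y‖ ^ 2 := by
    rw [norm_sub_sq_real, hζ]; ring
  simp only [poissonHess, add_apply, smul_apply, innerSL_apply_apply,
    ContinuousLinearMap.smulRight_apply, ContinuousLinearMap.id_apply, inner_add_left,
    real_inner_smul_left (F := E), Finset.sum_add_distrib, hb, mul_one]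
  rw [Finset.sum_const, Finset.card_univ, nsmul_eq_mul, hcard]
  simp only [add_mul, mul_assoc, Finset.sum_add_distrib, ← Finset.mul_sum, hsum,
    real_inner_self_eq_norm_sq]
  rw [real_inner_comm (ζ - y) y, inner_sub_left, real_inner_self_eq_norm_sq]
  simp only [pow_add]
  field_simp
  rw [hw]
  ring

end Poisson

section Harmonic

open scoped Laplacian InnerProductSpace

variable {E : Type*} [NormedAddCommGroup E] [InnerProductSpace ℝ E] [FiniteDimensional ℝ E]

theorem contDiffOn_two_of_hasFDerivAt {f : E → ℝ} {g : E → E} {T : E → E →L[ℝ] E} {U : Set E}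
    (hU : IsOpen U) (hf : ∀ y ∈ U, HasFDerivAt f (innerSL ℝ (g y)) y)
    (hg : ∀ y ∈ U, HasFDerivAt g (T y) y) (hT : ContinuousOn T U) : ContDiffOn ℝ 2 f U := by
  have hg1 : ContDiffOn ℝ 1 g U := by
    rw [show (1 : WithTop ℕ∞) = 0 + 1 by norm_num, contDiffOn_succ_iff_fderiv_of_isOpen hU]
    refine ⟨fun y hy => (hg y hy).differentiableAt.differentiableWithinAt, by simp, ?_⟩
    exact contDiffOn_zero.2 (hT.congr fun y hy => (hg y hy).fderiv)
  rw [show (2 : WithTop ℕ∞) = 1 + 1 by norm_num, contDiffOn_succ_iff_fderiv_of_isOpen hU]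
  refine ⟨fun y hy => (hf y hy).differentiableAt.differentiableWithinAt, by simp, ?_⟩
  refine contDiffOn_clm_apply.2 fun v => ?_
  refine (hg1.inner ℝ (contDiffOn_const (c := v))).congr fun y hy => ?_
  rw [(hf y hy).fderiv, innerSL_apply_apply]

theorem laplacian_eq_of_hasFDerivAt {f : E → ℝ} {g : E → E} {T : E → E →L[ℝ] E} {U : Set E}
    (hU : IsOpen U) (hf : ∀ y ∈ U, HasFDerivAt f (innerSL ℝ (g y)) y)
    (hg : ∀ y ∈ U, HasFDerivAt g (T y) y) (hT : ContinuousOn T U) {ι : Type*} [Fintype ι]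
    (b : OrthonormalBasis ι ℝ E) {y : E} (hy : y ∈ U) :
    Δ f y = ∑ i, ⟪T y (b i), b i⟫ := by
  rw [InnerProductSpace.laplacian_eq_iteratedFDeriv_orthonormalBasis f b]
  refine Finset.sum_congr rfl fun i _ => ?_
  rw [iteratedFDeriv_two_apply]
  have h2 : ContDiffAt ℝ 2 f y :=
    (contDiffOn_two_of_hasFDerivAt hU hf hg hT).contDiffAt (hU.mem_nhds hy)
  have h3 : DifferentiableAt ℝ (fderiv ℝ f) y :=
    (h2.fderiv_right (m := 1) (by norm_num)).differentiableAt (by norm_num)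
  have h4 := h3.hasFDerivAt.clm_apply (hasFDerivAt_const (b i) y)
  have h5 : (fun z => fderiv ℝ f z (b i)) =ᶠ[𝓝 y] fun z => ⟪g z, b i⟫ := by
    filter_upwards [hU.mem_nhds hy] with z hz
    rw [(hf z hz).fderiv, innerSL_apply_apply]
  have h6 := ((hg y hy).inner ℝ (hasFDerivAt_const (b i) y)).congr_of_eventuallyEq h5
  have h7 := congrArg (fun L => L (b i)) (h4.unique h6)
  simpa using h7

theorem deriv_deriv_nonpos_of_isLocalMax {φ : ℝ → ℝ} {t : ℝ} (h : IsLocalMax φ t)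
    (hc : ContinuousAt φ t) : deriv (deriv φ) t ≤ 0 := by
  by_contra! hpos
  have hmin := isLocalMin_of_deriv_deriv_pos hpos h.deriv_eq_zero hc
  have heq : φ =ᶠ[𝓝 t] fun _ => φ t := by
    filter_upwards [h, hmin] with s h1 h2 using le_antisymm h1 h2
  have := heq.deriv.deriv_eq
  simp at this
  exact hpos.ne' this

theorem fderiv_fderiv_nonpos_of_isLocalMax {f : E → ℝ} {z : E} (hf : ContDiffAt ℝ 2 f z)
    (h : IsLocalMax f z) (e : E) : fderiv ℝ (fderiv ℝ f) z e e ≤ 0 := by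
  have hline : ∀ t : ℝ, HasDerivAt (fun t : ℝ => z + t • e) e t := fun t => by
    simpa using ((hasDerivAt_id t).smul_const e).const_add z
  have hcont : ContinuousAt (fun t : ℝ => z + t • e) 0 := (hline 0).continuousAt
  have h0 : z + (0 : ℝ) • e = z := by simp
  have hφ : IsLocalMax (fun t : ℝ => f (z + t • e)) 0 := by
    have := hcont.tendsto
    rw [h0] at this
    have h2 := this.eventually h
    simpa [IsLocalMax, IsMaxFilter] using h2
  have hd : deriv (fun t : ℝ => f (z + t • e)) =ᶠ[𝓝 0] fun t => fderiv ℝ f (z + t • e) e := by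
    have h1 : ∀ᶠ y in 𝓝 z, DifferentiableAt ℝ f y :=
      (hf.eventually (by simp)).mono fun y hy => hy.differentiableAt (by norm_num)
    rw [← h0] at h1
    filter_upwards [hcont.tendsto.eventually h1] with t ht
    exact (ht.hasFDerivAt.comp_hasDerivAt t (hline t)).deriv
  have h3 : DifferentiableAt ℝ (fderiv ℝ f) (z + (0 : ℝ) • e) := by
    rw [h0]
    exact (hf.fderiv_right (m := 1) (by norm_num)).differentiableAt (by norm_num)
  have h4 : HasDerivAt (fun t : ℝ => fderiv ℝ f (z + t • e) e)
      (fderiv ℝ (fderiv ℝ f) z e e) 0 := by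
    have h4 := h3.hasFDerivAt.comp_hasDerivAt (0 : ℝ) (hline 0)
    rw [h0] at h4
    have h5 := h4.clm_apply (hasDerivAt_const (0 : ℝ) e)
    rw [map_zero, add_zero] at h5
    exact h5
  have h5 : ContinuousAt (fun t : ℝ => f (z + t • e)) 0 :=
    ContinuousAt.comp_of_eq (f := fun t : ℝ => z + t • e) hf.continuousAt hcont h0
  have h6 := deriv_deriv_nonpos_of_isLocalMax hφ h5
  rwa [hd.deriv_eq, h4.deriv] at h6

theorem laplacian_nonpos_of_isLocalMax {f : E → ℝ} {z : E} (hf : ContDiffAt ℝ 2 f z)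
    (h : IsLocalMax f z) : Δ f z ≤ 0 := by
  rw [InnerProductSpace.laplacian_eq_iteratedFDeriv_stdOrthonormalBasis]
  refine Finset.sum_nonpos fun i _ => ?_
  rw [iteratedFDeriv_two_apply]
  exact fderiv_fderiv_nonpos_of_isLocalMax hf h _

theorem contDiff_norm_sq_two : ContDiff ℝ 2 fun y : E => ‖y‖ ^ 2 := contDiff_norm_sq ℝ

theorem laplacian_norm_sq (y : E) : Δ (fun y : E => ‖y‖ ^ 2) y = 2 * finrank ℝ E := by
  have hf : ∀ z ∈ (univ : Set E), HasFDerivAt (fun y : E => ‖y‖ ^ 2) (innerSL ℝ ((2 : ℝ) • z)) z :=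
    fun z _ => by
      refine (hasStrictFDerivAt_norm_sq z).hasFDerivAt.congr_fderiv ?_
      ext v
      simp
  have hg : ∀ z ∈ (univ : Set E), HasFDerivAt (fun z : E => (2 : ℝ) • z)
      ((2 : ℝ) • ContinuousLinearMap.id ℝ E) z := fun z _ => (hasFDerivAt_id z).const_smul (2 : ℝ)
  rw [laplacian_eq_of_hasFDerivAt isOpen_univ hf hg continuousOn_const (stdOrthonormalBasis ℝ E)
    (mem_univ y)]
  simp [real_inner_smul_left, mul_comm]

/-- Maximum principle: a harmonic function on the unit ball whose values near the boundary are
asymptotically nonpositive is nonpositive. -/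
theorem nonpos_of_laplacian_eq_zero [Nontrivial E] {h : E → ℝ} (hc : ContDiffOn ℝ 2 h (ball 0 1))
    (hΔ : ∀ y ∈ ball (0 : E) 1, Δ h y = 0)
    (hb : ∀ ε > 0, ∃ ρ < 1, ∀ y : E, ρ ≤ ‖y‖ → ‖y‖ < 1 → h y ≤ ε) {y : E} (hy : ‖y‖ < 1) :
    h y ≤ 0 := by
  by_contra! hpos
  obtain ⟨ρ₀, hρ₀, hbd⟩ := hb (h y / 4) (by linarith)
  set ρ := max ρ₀ ‖y‖ with hρ
  have hρ1 : ρ < 1 := max_lt hρ₀ hy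
  set g : E → ℝ := h + (h y / 4) • fun z : E => ‖z‖ ^ 2 with hg
  have hg' : ∀ z, g z = h z + h y / 4 * ‖z‖ ^ 2 := fun z => rfl
  have hsub : closedBall (0 : E) ρ ⊆ ball 0 1 := closedBall_subset_ball hρ1
  have hgc : ContDiffOn ℝ 2 g (ball 0 1) := by
    have h1 : ContDiffOn ℝ 2 ((h y / 4) • fun z : E => ‖z‖ ^ 2) (ball 0 1) :=
      contDiff_norm_sq_two.contDiffOn.const_smul (h y / 4)
    exact hc.add h1
  have hymem : y ∈ closedBall (0 : E) ρ := by simp [hρ]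
  obtain ⟨z, hz, hzmax⟩ := (isCompact_closedBall (0 : E) ρ).exists_isMaxOn ⟨y, hymem⟩
    (hgc.continuousOn.mono hsub)
  have hyz : h y ≤ g z := by
    refine le_trans ?_ (hzmax hymem)
    rw [hg']
    nlinarith [sq_nonneg ‖y‖]
  have hz1 : ‖z‖ < 1 := mem_ball_zero_iff.1 (hsub hz)
  rcases (mem_closedBall_zero_iff.1 hz).lt_or_eq with hlt | heq
  · have hmax : IsLocalMax g z :=
      hzmax.isLocalMax (closedBall_mem_nhds_of_mem (mem_ball_zero_iff.2 hlt))
    have hzn := isOpen_ball.mem_nhds (hsub hz)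
    have h1 := laplacian_nonpos_of_isLocalMax (hgc.contDiffAt hzn) hmax
    have h4 : ContDiffAt ℝ 2 ((h y / 4) • fun z : E => ‖z‖ ^ 2) z :=
      contDiff_norm_sq_two.contDiffAt.const_smul (h y / 4)
    rw [hg, (hc.contDiffAt hzn).laplacian_add h4,
      InnerProductSpace.laplacian_smul _ contDiff_norm_sq_two.contDiffAt, hΔ z (hsub hz),
      laplacian_norm_sq, smul_eq_mul] at h1
    have h2 : (0 : ℝ) < finrank ℝ E := Nat.cast_pos.2 finrank_pos
    have h3 : 0 < h y / 4 * (2 * finrank ℝ E) := by positivity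
    linarith
  · have h1 := hbd z (by rw [heq]; exact le_max_left _ _) hz1
    rw [hg'] at hyz
    have h2 : ‖z‖ ^ 2 ≤ 1 := by nlinarith [norm_nonneg z]
    nlinarith

end Harmonic

section PoissonIntegral

open scoped Laplacian InnerProductSpace

variable {E : Type*} [NormedAddCommGroup E] [InnerProductSpace ℝ E] [FiniteDimensional ℝ E]
  [MeasurableSpace E] [BorelSpace E] [Nontrivial E]

theorem ballPoissonKernel_nonneg {y : E} (hy : ‖y‖ < 1) (ζ : E) : 0 ≤ ballPoissonKernel y ζ :=
  mul_nonneg (one_sub_norm_sq_pos hy).le (inv_nonneg.2 (pow_nonneg (norm_nonneg _) _))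

theorem integrable_ballPoissonKernel {y : E} (hy : ‖y‖ < 1) :
    Integrable (ballPoissonKernel y) (sphereMeasure E) :=
  integrable_of_continuousOn_compact (isCompact_sphere 0 1) ae_mem_sphere
    (continuousOn_ballPoissonKernel hy)

theorem integral_ballPoissonKernel {y : E} (hy : ‖y‖ < 1) :
    ∫ ζ, ballPoissonKernel y ζ ∂sphereMeasure E = 1 := by
  have hmr := (continuous_rayLen y).measurable
  have hmd := (continuous_rayDisc y).measurable
  have h := integral_dirFrom hy (g := fun φ => (1 - ‖y‖ ^ 2) * (rayLen y φ ^ finrank ℝ E)⁻¹ *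
    (rayLen y φ * rayDisc y φ)⁻¹) (by fun_prop)
  have e1 : ∫ ζ, ballPoissonKernel y ζ ∂sphereMeasure E =
      ∫ φ, rayLen y (-φ) / rayDisc y φ ∂sphereMeasure E := by
    convert h using 1
    · refine integral_congr_ae ?_
      filter_upwards [ae_norm_eq_one (E := E)] with ζ hζ
      have h1 := rayLen_pos hy (dirFrom y ζ)
      have h2 := rayDisc_pos hy (dirFrom y ζ)
      rw [← rayLen_mul_rayDisc_dirFrom hy hζ, inv_mul_cancel_right₀ (mul_pos h1 h2).ne',
        ballPoissonKernel, rayLen_dirFrom hy hζ]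
    · refine integral_congr_ae (Eventually.of_forall fun φ => ?_)
      have h1 := rayLen_pos hy φ
      have h2 := rayDisc_pos hy φ
      have h3 : rayLen y (-φ) = (1 - ‖y‖ ^ 2) / rayLen y φ := by
        rw [eq_div_iff h1.ne', rayLen_neg_mul hy]
      simp only [h3]
      field_simp
  have e2 := integral_neg_sphereMeasure fun φ => rayLen y (-φ) / rayDisc y φ
  simp only [neg_neg, rayDisc_neg] at e2
  have hc : ∀ φ, rayDisc y φ ≠ 0 := fun φ => (rayDisc_pos hy φ).ne'
  have c1 : Continuous fun φ => rayLen y φ / rayDisc y φ :=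
    (continuous_rayLen y).div (continuous_rayDisc y) hc
  have c2 : Continuous fun φ => rayLen y (-φ) / rayDisc y φ :=
    ((continuous_rayLen y).comp continuous_neg).div (continuous_rayDisc y) hc
  have i1 := integrable_of_continuousOn_compact (isCompact_sphere 0 1) ae_mem_sphere
    (c1.continuousOn (s := sphere (0 : E) 1))
  have i2 := integrable_of_continuousOn_compact (isCompact_sphere 0 1) ae_mem_sphere
    (c2.continuousOn (s := sphere (0 : E) 1))
  have e3 : ∫ φ, (rayLen y φ / rayDisc y φ + rayLen y (-φ) / rayDisc y φ) ∂sphereMeasure E = 2 := by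
    have : ∀ φ, rayLen y φ / rayDisc y φ + rayLen y (-φ) / rayDisc y φ = 2 := fun φ => by
      rw [← add_div, div_eq_iff (hc φ), rayLen, rayLen, rayDisc_neg, inner_neg_right]
      ring
    simp [this]
  rw [integral_add i1 i2, e2] at e3
  rw [e1]
  linarith

/-- The Poisson integral of a function on the unit sphere. -/
noncomputable def poissonIntegral (s : E → ℝ) (y : E) : ℝ :=
  ∫ ζ, s ζ • ballPoissonKernel y ζ ∂sphereMeasure E

theorem hasFDerivAt_poissonIntegral {s : E → ℝ} (hs : Measurable s) {M : ℝ} (hM : ∀ ζ, |s ζ| ≤ M)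
    {y : E} (hy : y ∈ ball (0 : E) 1) :
    HasFDerivAt (poissonIntegral s)
      (innerSL ℝ (∫ ζ, s ζ • poissonGrad y ζ ∂sphereMeasure E)) y := by
  have hc : ContinuousOn (Function.uncurry fun y ζ : E => innerSL ℝ (poissonGrad y ζ))
      (ball 0 1 ×ˢ sphere 0 1) :=
    (innerSL ℝ (E := E)).continuous.comp_continuousOn continuousOn_poissonGrad
  have h := hasFDerivAt_integral_compact (isCompact_sphere 0 1) ae_mem_sphere isOpen_ball
    (fun y hy => continuousOn_ballPoissonKernel (mem_ball_zero_iff.1 hy)) hc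
    (fun y hy ζ hζ => hasFDerivAt_ballPoissonKernel (sub_ne_zero_of_norm
      (mem_ball_zero_iff.1 hy) (mem_sphere_zero_iff_norm.1 hζ))) hs hM hy
  refine h.congr_fderiv ?_
  have hi := integrable_mul_of_continuousOn_compact (isCompact_sphere 0 1) ae_mem_sphere hs hM
    (continuousOn_compact_of_prod continuousOn_poissonGrad hy)
  have hi2 := integrable_mul_of_continuousOn_compact (isCompact_sphere 0 1) ae_mem_sphere hs hM
    (continuousOn_compact_of_prod hc hy)
  ext v
  rw [ContinuousLinearMap.integral_apply hi2, innerSL_apply_apply, real_inner_comm,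
    ← integral_inner hi]
  refine integral_congr_ae (Eventually.of_forall fun ζ => ?_)
  simp only [smul_apply, innerSL_apply_apply, real_inner_smul_right, smul_eq_mul]
  rw [real_inner_comm v]

theorem inner_integral_poissonGrad {s : E → ℝ} (hs : Measurable s) {M : ℝ} (hM : ∀ ζ, |s ζ| ≤ M)
    {y : E} (hy : y ∈ ball (0 : E) 1) (v : E) :
    ⟪∫ ζ, s ζ • poissonGrad y ζ ∂sphereMeasure E, v⟫ =
      ∫ ζ, s ζ * poissonDeriv y v ζ ∂sphereMeasure E := by
  have hi := integrable_mul_of_continuousOn_compact (isCompact_sphere 0 1) ae_mem_sphere hs hM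
    (continuousOn_compact_of_prod continuousOn_poissonGrad hy)
  rw [real_inner_comm, ← integral_inner hi]
  refine integral_congr_ae (Eventually.of_forall fun ζ => ?_)
  simp only [real_inner_smul_right, ← inner_poissonGrad]
  rw [real_inner_comm v]

theorem fderiv_poissonIntegral {s : E → ℝ} (hs : Measurable s) {M : ℝ} (hM : ∀ ζ, |s ζ| ≤ M)
    {y : E} (hy : y ∈ ball (0 : E) 1) (v : E) :
    fderiv ℝ (poissonIntegral s) y v = ∫ ζ, s ζ * poissonDeriv y v ζ ∂sphereMeasure E := by
  rw [(hasFDerivAt_poissonIntegral hs hM hy).fderiv, innerSL_apply_apply,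
    inner_integral_poissonGrad hs hM hy]

theorem hasFDerivAt_integral_poissonGrad {s : E → ℝ} (hs : Measurable s) {M : ℝ}
    (hM : ∀ ζ, |s ζ| ≤ M)
    {y : E} (hy : y ∈ ball (0 : E) 1) :
    HasFDerivAt (fun y => ∫ ζ, s ζ • poissonGrad y ζ ∂sphereMeasure E)
      (∫ ζ, s ζ • poissonHess y ζ ∂sphereMeasure E) y :=
  hasFDerivAt_integral_compact (isCompact_sphere 0 1) ae_mem_sphere isOpen_ball
    (fun _ hy => continuousOn_compact_of_prod continuousOn_poissonGrad hy) continuousOn_poissonHess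
    (fun _ hy _ hζ => hasFDerivAt_poissonGrad (sub_ne_zero_of_norm
      (mem_ball_zero_iff.1 hy) (mem_sphere_zero_iff_norm.1 hζ))) hs hM hy

theorem continuousOn_integral_poissonHess {s : E → ℝ} (hs : Measurable s) {M : ℝ}
    (hM : ∀ ζ, |s ζ| ≤ M) :
    ContinuousOn (fun y => ∫ ζ, s ζ • poissonHess y ζ ∂sphereMeasure E) (ball 0 1) :=
  continuousOn_integral_compact (isCompact_sphere 0 1) ae_mem_sphere isOpen_ball
    continuousOn_poissonHess hs hM

theorem contDiffOn_poissonIntegral {s : E → ℝ} (hs : Measurable s) {M : ℝ} (hM : ∀ ζ, |s ζ| ≤ M) :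
    ContDiffOn ℝ 2 (poissonIntegral s) (ball 0 1) :=
  contDiffOn_two_of_hasFDerivAt isOpen_ball (fun _ hy => hasFDerivAt_poissonIntegral hs hM hy)
    (fun _ hy => hasFDerivAt_integral_poissonGrad hs hM hy)
    (continuousOn_integral_poissonHess hs hM)

theorem laplacian_poissonIntegral {s : E → ℝ} (hs : Measurable s) {M : ℝ} (hM : ∀ ζ, |s ζ| ≤ M)
    {y : E} (hy : y ∈ ball (0 : E) 1) :
    Δ (poissonIntegral s) y = 0 := by
  rw [laplacian_eq_of_hasFDerivAt isOpen_ball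
    (fun _ hy => hasFDerivAt_poissonIntegral hs hM hy)
    (fun _ hy => hasFDerivAt_integral_poissonGrad hs hM hy)
    (continuousOn_integral_poissonHess hs hM) (stdOrthonormalBasis ℝ E) hy]
  have hi := integrable_mul_of_continuousOn_compact (isCompact_sphere 0 1) ae_mem_sphere hs hM
    (continuousOn_compact_of_prod continuousOn_poissonHess hy)
  set b := stdOrthonormalBasis ℝ E
  set L : (E →L[ℝ] E) →L[ℝ] ℝ :=
    ∑ i, (innerSL ℝ (b i)).comp (ContinuousLinearMap.apply ℝ E (b i)) with hL
  have hLT : ∀ T : E →L[ℝ] E, L T = ∑ i, ⟪T (b i), b i⟫ := fun T => by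
    rw [hL, sum_apply]
    refine Finset.sum_congr rfl fun i _ => ?_
    rw [real_inner_comm]
    rfl
  rw [← hLT, ← L.integral_comp_comm hi]
  refine integral_eq_zero_of_ae ?_
  filter_upwards [ae_norm_eq_one (E := E)] with ζ hζ
  rw [map_smul, hLT, sum_inner_poissonHess b (mem_ball_zero_iff.1 hy) hζ]
  simp

theorem abs_poissonIntegral_le {s : E → ℝ} {M : ℝ} (hM : ∀ ζ, |s ζ| ≤ M)
    {y : E} (hy : y ∈ ball (0 : E) 1) : |poissonIntegral s y| ≤ M := by
  have hy' := mem_ball_zero_iff.1 hy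
  have h : ‖poissonIntegral s y‖ ≤ ∫ ζ, M * ballPoissonKernel y ζ ∂sphereMeasure E := by
    refine norm_integral_le_of_norm_le ((integrable_ballPoissonKernel hy').const_mul M)
      (Eventually.of_forall fun ζ => ?_)
    rw [norm_smul, Real.norm_of_nonneg (ballPoissonKernel_nonneg hy' ζ)]
    exact mul_le_mul_of_nonneg_right (hM ζ) (ballPoissonKernel_nonneg hy' ζ)
  rwa [integral_const_mul, integral_ballPoissonKernel hy', mul_one] at h

/-- Quantitative boundary behaviour of the Poisson integral. -/
theorem abs_poissonIntegral_sub_le {s : E → ℝ} (hs : Measurable s) {M : ℝ} (hM : ∀ ζ, |s ζ| ≤ M)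
    {c ε δ : ℝ} (hδ : 0 < δ) {y : E}
    (hy : y ∈ ball (0 : E) 1) (hc : |c| ≤ M)
    (hnear : ∀ ζ ∈ sphere (0 : E) 1, ‖ζ - y‖ < δ → |s ζ - c| ≤ ε) (hε : 0 ≤ ε) :
    |poissonIntegral s y - c| ≤ ε + 2 * M * ((1 - ‖y‖ ^ 2) * (δ ^ finrank ℝ E)⁻¹) := by
  have hy' := mem_ball_zero_iff.1 hy
  have hM0 : 0 ≤ M := (abs_nonneg _).trans hc
  have h1y := one_sub_norm_sq_pos hy'
  have hP := integrable_ballPoissonKernel hy'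
  have hi : Integrable (fun ζ => s ζ • ballPoissonKernel y ζ) (sphereMeasure E) :=
    integrable_mul_of_continuousOn_compact (isCompact_sphere 0 1) ae_mem_sphere hs hM
      (continuousOn_ballPoissonKernel hy')
  have e : poissonIntegral s y - c =
      ∫ ζ, (s ζ • ballPoissonKernel y ζ - c * ballPoissonKernel y ζ) ∂sphereMeasure E := by
    rw [integral_sub hi (hP.const_mul c), integral_const_mul, integral_ballPoissonKernel hy',
      mul_one, poissonIntegral]
  rw [e]
  have hb : ‖∫ ζ, (s ζ • ballPoissonKernel y ζ - c * ballPoissonKernel y ζ) ∂sphereMeasure E‖ ≤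
      ∫ ζ, (ε * ballPoissonKernel y ζ + 2 * M * ((1 - ‖y‖ ^ 2) * (δ ^ finrank ℝ E)⁻¹))
        ∂sphereMeasure E := by
    refine norm_integral_le_of_norm_le ((hP.const_mul ε).add (integrable_const _)) ?_
    filter_upwards [ae_mem_sphere (E := E)] with ζ hζ
    have hPn := ballPoissonKernel_nonneg hy' ζ
    rw [smul_eq_mul, ← sub_mul, norm_mul, Real.norm_eq_abs, Real.norm_of_nonneg hPn]
    rcases lt_or_ge ‖ζ - y‖ δ with h | h
    · have h1 := mul_le_mul_of_nonneg_right (hnear ζ hζ h) hPn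
      have h2 : 0 ≤ 2 * M * ((1 - ‖y‖ ^ 2) * (δ ^ finrank ℝ E)⁻¹) := by positivity
      linarith
    · have h1 : ballPoissonKernel y ζ ≤ (1 - ‖y‖ ^ 2) * (δ ^ finrank ℝ E)⁻¹ := by
        refine mul_le_mul_of_nonneg_left ?_ h1y.le
        exact inv_anti₀ (pow_pos hδ _) (pow_le_pow_left₀ hδ.le h _)
      have h2 : |s ζ - c| ≤ 2 * M := (abs_sub _ _).trans (by linarith [hM ζ])
      have h3 := mul_le_mul h2 h1 hPn (by positivity)
      have h4 := mul_nonneg hε hPn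
      linarith
  rwa [integral_add (hP.const_mul ε) (integrable_const _), integral_const_mul,
    integral_ballPoissonKernel hy', mul_one, integral_const, probReal_univ, one_smul] at hb

end PoissonIntegral

section Estimate

open scoped Laplacian InnerProductSpace

theorem laplacian_comp_smul {E : Type*} [NormedAddCommGroup E] [InnerProductSpace ℝ E]
    [FiniteDimensional ℝ E] (u : E → ℝ) (R : ℝ) (y : E) :
    Δ (fun z => u (R • z)) y = R ^ 2 * Δ u (R • y) := by
  have h1 : fderiv ℝ (fun z => u (R • z)) = fun z => R • fderiv ℝ u (R • z) :=
    funext fun z => fderiv_comp_smul R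
  have h2 : fderiv ℝ (fun z => R • fderiv ℝ u (R • z)) y =
      R • R • fderiv ℝ (fderiv ℝ u) (R • y) := by
    have h := congrFun (fderiv_const_smul_field (𝕜 := ℝ) (f := fun z => fderiv ℝ u (R • z)) R) y
    rw [Pi.smul_apply, fderiv_comp_smul R] at h
    exact h
  simp only [InnerProductSpace.laplacian_eq_iteratedFDeriv_stdOrthonormalBasis,
    iteratedFDeriv_two_apply, h1, h2, Finset.mul_sum]
  refine Finset.sum_congr rfl fun i _ => ?_
  simp only [smul_apply, smul_eq_mul]
  ring

variable {E : Type*} [NormedAddCommGroup E] [InnerProductSpace ℝ E] [FiniteDimensional ℝ E]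
  [MeasurableSpace E] [BorelSpace E] [Nontrivial E]

/-- Poisson representation of a harmonic function continuous up to the boundary. -/
theorem eq_poissonIntegral_of_laplacian_eq_zero {v : E → ℝ} {M : ℝ}
    (hv : ContinuousOn v (closedBall 0 1)) (hv2 : ContDiffOn ℝ 2 v (ball 0 1))
    (hΔ : ∀ y ∈ ball (0 : E) 1, Δ v y = 0) (hb : ∀ y ∈ closedBall (0 : E) 1, |v y| ≤ M)
    {s : E → ℝ} (hs : Measurable s) (hsM : ∀ ζ, |s ζ| ≤ M)
    (hsv : ∀ ζ ∈ sphere (0 : E) 1, s ζ = v ζ) {y : E} (hy : y ∈ ball (0 : E) 1) :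
    v y = poissonIntegral s y := by
  have hM : 0 ≤ M := (abs_nonneg _).trans (hsM 0)
  have key : ∀ ε > 0, ∃ ρ < 1, ∀ y : E, ρ ≤ ‖y‖ → ‖y‖ < 1 → |poissonIntegral s y - v y| ≤ ε := by
    intro ε hε
    obtain ⟨δ, hδ, hδv⟩ := Metric.uniformContinuousOn_iff.1
      ((isCompact_closedBall (0 : E) 1).uniformContinuousOn_of_continuous hv)
      (ε / 2) (by positivity)
    set A := 2 * M * (δ ^ finrank ℝ E)⁻¹ with hA
    have hA0 : 0 ≤ A := by positivity
    have hlim : Tendsto (fun r : ℝ => A * (1 - r ^ 2)) (𝓝[<] 1) (𝓝 0) := by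
      have : Continuous fun r : ℝ => A * (1 - r ^ 2) := by fun_prop
      simpa using (this.tendsto 1).mono_left nhdsWithin_le_nhds
    have hev := (hlim.eventually (gt_mem_nhds (show (0 : ℝ) < ε / 2 by positivity))).and
      (Ioo_mem_nhdsLT (show (0 : ℝ) < 1 by norm_num))
    obtain ⟨ρ, hρA, hρ0, hρ1⟩ := hev.exists
    refine ⟨ρ, hρ1, fun y hρy hy1 => ?_⟩
    have hyc : y ∈ closedBall (0 : E) 1 := mem_closedBall_zero_iff.2 hy1.le
    have h := abs_poissonIntegral_sub_le hs hsM hδ (mem_ball_zero_iff.2 hy1) (hb y hyc)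
      (ε := ε / 2) (fun ζ hζ hζy => by
        rw [hsv ζ hζ]
        exact (hδv ζ (sphere_subset_closedBall hζ) y hyc (by rwa [dist_eq_norm])).le)
      (by positivity)
    have h2 : A * (1 - ‖y‖ ^ 2) ≤ A * (1 - ρ ^ 2) := by gcongr
    have h3 : 2 * M * ((1 - ‖y‖ ^ 2) * (δ ^ finrank ℝ E)⁻¹) = A * (1 - ‖y‖ ^ 2) := by
      rw [hA]; ring
    linarith
  have hP2 := contDiffOn_poissonIntegral hs hsM
  have hy' := mem_ball_zero_iff.1 hy
  have hcd : ∀ {f : E → ℝ}, ContDiffOn ℝ 2 f (ball 0 1) → ∀ z ∈ ball (0 : E) 1,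
      ContDiffAt ℝ 2 f z := fun hf z hz => hf.contDiffAt (isOpen_ball.mem_nhds hz)
  have h1 := nonpos_of_laplacian_eq_zero (hP2.sub hv2)
    (fun z hz => by
      rw [show (fun i => poissonIntegral s i - v i) = poissonIntegral s - v from rfl,
        (hcd hP2 z hz).laplacian_sub (hcd hv2 z hz), laplacian_poissonIntegral hs hsM hz,
        hΔ z hz, sub_zero])
    (fun ε hε => by
      obtain ⟨ρ, hρ, h⟩ := key ε hε
      exact ⟨ρ, hρ, fun z h1 h2 => (le_abs_self _).trans (h z h1 h2)⟩) hy'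
  have h2 := nonpos_of_laplacian_eq_zero (hv2.sub hP2)
    (fun z hz => by
      rw [show (fun i => v i - poissonIntegral s i) = v - poissonIntegral s from rfl,
        (hcd hv2 z hz).laplacian_sub (hcd hP2 z hz), laplacian_poissonIntegral hs hsM hz,
        hΔ z hz, sub_zero])
    (fun ε hε => by
      obtain ⟨ρ, hρ, h⟩ := key ε hε
      exact ⟨ρ, hρ, fun z h1 h2 => (le_abs_self _).trans (by
        rw [abs_sub_comm]; exact h z h1 h2)⟩) hy'
  linarith

theorem abs_fderiv_le_of_continuousOn_closedBall {v : E → ℝ} {M : ℝ}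
    (hv : ContinuousOn v (closedBall 0 1)) (hv2 : ContDiffOn ℝ 2 v (ball 0 1))
    (hΔ : ∀ y ∈ ball (0 : E) 1, Δ v y = 0) (hb : ∀ y ∈ closedBall (0 : E) 1, |v y| ≤ M)
    {x : E} (hx : x ∈ ball (0 : E) 1) (w : E) :
    |fderiv ℝ v x w| ≤ M * poissonDerivNorm x w := by
  classical
  have hM : 0 ≤ M := (abs_nonneg _).trans (hb 0 (mem_closedBall_self zero_le_one))
  set s : E → ℝ := (sphere (0 : E) 1).indicator v with hsdef
  have hs : Measurable s := by
    have h := (hv.mono (sphere_subset_closedBall (x := (0 : E)) (ε := 1))).measurable_piecewise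
      (continuousOn_const (c := (0 : ℝ))) (isClosed_sphere.measurableSet)
    rwa [show (fun _ : E => (0 : ℝ)) = 0 from rfl, piecewise_eq_indicator] at h
  have hsM : ∀ ζ, |s ζ| ≤ M := fun ζ => by
    by_cases h : ζ ∈ sphere (0 : E) 1
    · rw [hsdef, indicator_of_mem h]
      exact hb ζ (sphere_subset_closedBall h)
    · rw [hsdef, indicator_of_notMem h, abs_zero]
      exact hM
  have heq : v =ᶠ[𝓝 x] poissonIntegral s := by
    filter_upwards [isOpen_ball.mem_nhds hx] with y hy
    exact eq_poissonIntegral_of_laplacian_eq_zero hv hv2 hΔ hb hs hsM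
      (fun ζ hζ => indicator_of_mem hζ v) hy
  rw [heq.fderiv_eq, fderiv_poissonIntegral hs hsM hx w, poissonDerivNorm, ← integral_const_mul]
  have hi : Integrable (poissonDeriv x w) (sphereMeasure E) :=
    integrable_of_continuousOn_compact (isCompact_sphere 0 1) ae_mem_sphere
      (continuousOn_poissonDeriv (mem_ball_zero_iff.1 hx) w)
  rw [← Real.norm_eq_abs]
  refine norm_integral_le_of_norm_le (hi.abs.const_mul M) (Eventually.of_forall fun ζ => ?_)
  rw [norm_mul]
  exact mul_le_mul_of_nonneg_right (hsM ζ) (abs_nonneg _)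

/-- The sharp directional derivative estimate for bounded harmonic functions on the unit ball. -/
theorem abs_fderiv_le_of_laplacian_eq_zero {u : E → ℝ} {M : ℝ}
    (hu : ContDiffOn ℝ 2 u (ball 0 1)) (hΔ : ∀ y ∈ ball (0 : E) 1, Δ u y = 0)
    (hb : ∀ y ∈ ball (0 : E) 1, |u y| ≤ M) {x : E} (hx : x ∈ ball (0 : E) 1) (w : E) :
    |fderiv ℝ u x w| ≤ M * poissonDerivNorm x w := by
  have hR : ∀ R ∈ Ioo (0 : ℝ) 1, |R * fderiv ℝ u (R • x) w| ≤ M * poissonDerivNorm x w := by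
    intro R hR
    have hmaps : MapsTo (fun z : E => R • z) (closedBall 0 1) (ball 0 1) := fun z hz => by
      rw [mem_ball_zero_iff, norm_smul, Real.norm_of_nonneg hR.1.le]
      have := mem_closedBall_zero_iff.1 hz
      nlinarith [hR.1, hR.2, norm_nonneg z]
    have h := abs_fderiv_le_of_continuousOn_closedBall (v := fun z => u (R • z)) (M := M)
      (hu.continuousOn.comp (by fun_prop) hmaps)
      (hu.comp (contDiff_const_smul R).contDiffOn (hmaps.mono_left ball_subset_closedBall))
      (fun y hy => by
        rw [laplacian_comp_smul, hΔ _ (hmaps (ball_subset_closedBall hy)), mul_zero])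
      (fun y hy => hb _ (hmaps hy)) hx w
    rwa [fderiv_comp_smul R, smul_apply, smul_eq_mul] at h
  have hc : ContinuousAt (fderiv ℝ u) x :=
    (hu.continuousOn_fderiv_of_isOpen isOpen_ball (by norm_num)).continuousAt
      (isOpen_ball.mem_nhds hx)
  have hsm : Tendsto (fun R : ℝ => R • x) (𝓝[<] 1) (𝓝 x) := by
    have : Continuous fun R : ℝ => R • x := by fun_prop
    simpa using (this.tendsto 1).mono_left nhdsWithin_le_nhds
  have hlim : Tendsto (fun R : ℝ => |R * fderiv ℝ u (R • x) w|) (𝓝[<] 1)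
      (𝓝 |1 * fderiv ℝ u x w|) :=
    ((tendsto_id.mono_left nhdsWithin_le_nhds).mul
      (((ContinuousLinearMap.apply ℝ ℝ w).continuous.tendsto _).comp (hc.tendsto.comp hsm))).abs
  rw [one_mul] at hlim
  exact le_of_tendsto hlim (mem_of_superset (Ioo_mem_nhdsLT zero_lt_one) hR)

theorem exists_laplacian_eq_zero_fderiv_eq {x : E} (hx : x ∈ ball (0 : E) 1) (w : E) :
    ∃ u : E → ℝ, ContDiffOn ℝ 2 u (ball 0 1) ∧ (∀ y ∈ ball (0 : E) 1, Δ u y = 0) ∧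
      (∀ y ∈ ball (0 : E) 1, |u y| ≤ 1) ∧ fderiv ℝ u x w = poissonDerivNorm x w := by
  have hs : Measurable fun ζ => signWeight (poissonDeriv x w ζ) :=
    measurable_signWeight.comp (measurable_poissonDeriv x w)
  have hM : ∀ ζ, |signWeight (poissonDeriv x w ζ)| ≤ 1 := fun ζ => (abs_signWeight _).le
  refine ⟨_, contDiffOn_poissonIntegral hs hM, fun y hy => laplacian_poissonIntegral hs hM hy,
    fun y hy => abs_poissonIntegral_le hM hy, ?_⟩
  rw [fderiv_poissonIntegral hs hM hx w, poissonDerivNorm]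
  simp only [signWeight_mul_self]

end Estimate

section Constants

open scoped Laplacian

variable {n : ℕ}

theorem isHarmonicOnBall_iff {u : EuclideanSpace ℝ (Fin n) → ℝ} :
    IsHarmonicOnBall n u ↔ ContDiffOn ℝ 2 u (ball 0 1) ∧
      ∀ y ∈ ball (0 : EuclideanSpace ℝ (Fin n)) 1, Δ u y = 0 := by
  simp only [IsHarmonicOnBall, InnerProductSpace.laplacian_eq_iteratedFDeriv_orthonormalBasis u
    (EuclideanSpace.basisFun (Fin n) ℝ), EuclideanSpace.basisFun_apply]

theorem abs_le_supAbs {u : EuclideanSpace ℝ (Fin n) → ℝ}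
    (hu : ∃ M : ℝ, ∀ y ∈ ball (0 : EuclideanSpace ℝ (Fin n)) 1, |u y| ≤ M)
    {y : EuclideanSpace ℝ (Fin n)} (hy : y ∈ ball (0 : EuclideanSpace ℝ (Fin n)) 1) :
    |u y| ≤ supAbs n u := by
  obtain ⟨M, hM⟩ := hu
  refine le_ciSup (f := fun y : ball (0 : EuclideanSpace ℝ (Fin n)) 1 => |u y.1|) ⟨M, ?_⟩ ⟨y, hy⟩
  rintro _ ⟨z, rfl⟩
  exact hM z z.2

theorem supAbs_le {u : EuclideanSpace ℝ (Fin n) → ℝ} {M : ℝ}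
    (hM : ∀ y ∈ ball (0 : EuclideanSpace ℝ (Fin n)) 1, |u y| ≤ M) : supAbs n u ≤ M := by
  have : Nonempty (ball (0 : EuclideanSpace ℝ (Fin n)) 1) := ⟨⟨0, mem_ball_self zero_lt_one⟩⟩
  exact ciSup_le fun y => hM y y.2

theorem inner_gradient_eq_fderiv {E : Type*} [NormedAddCommGroup E] [InnerProductSpace ℝ E]
    [CompleteSpace E] (u : E → ℝ) (x v : E) : ⟪gradient u x, v⟫ = fderiv ℝ u x v :=
  InnerProductSpace.toDual_symm_apply

/-- The integral of `|∂_ℓ P(x, ·)|` is a lower bound for every admissible constant in the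
directional derivative estimate. -/
theorem poissonDerivNorm_le_of_forall [Nontrivial (EuclideanSpace ℝ (Fin n))]
    {x ℓ : EuclideanSpace ℝ (Fin n)} (hx : x ∈ ball (0 : EuclideanSpace ℝ (Fin n)) 1) {c : ℝ}
    (hc : ∀ u : EuclideanSpace ℝ (Fin n) → ℝ, IsHarmonicOnBall n u →
      (∃ M : ℝ, ∀ y ∈ ball (0 : EuclideanSpace ℝ (Fin n)) 1, |u y| ≤ M) →
      |⟪gradient u x, ℓ⟫| ≤ c * supAbs n u) :
    poissonDerivNorm x ℓ ≤ c := by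
  have hone : ∀ y ∈ ball (0 : EuclideanSpace ℝ (Fin n)) 1, |(fun _ => (1 : ℝ)) y| ≤ 1 := by simp
  have h1 := hc (fun _ => 1) (isHarmonicOnBall_iff.2 ⟨contDiffOn_const, fun y _ => by
    simp [InnerProductSpace.laplacian_eq_iteratedFDeriv_stdOrthonormalBasis,
      iteratedFDeriv_two_apply]⟩) ⟨1, hone⟩
  have h2 : supAbs n (fun _ => 1) = 1 :=
    le_antisymm (supAbs_le hone) (by
      simpa using abs_le_supAbs ⟨1, hone⟩ (mem_ball_self zero_lt_one))
  have hc0 : 0 ≤ c := by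
    rw [h2, mul_one] at h1
    exact (abs_nonneg _).trans h1
  obtain ⟨u, hu, hΔ, hb, hd⟩ := exists_laplacian_eq_zero_fderiv_eq hx ℓ
  have h3 := hc u (isHarmonicOnBall_iff.2 ⟨hu, hΔ⟩) ⟨1, hb⟩
  rw [inner_gradient_eq_fderiv, hd, abs_of_nonneg (poissonDerivNorm_nonneg x ℓ)] at h3
  exact h3.trans (mul_le_of_le_one_right hc0 (supAbs_le hb))

theorem norm_gradient_le_poissonDerivNorm_mul_supAbs (hn : 3 ≤ n)
    [Nontrivial (EuclideanSpace ℝ (Fin n))] {x : EuclideanSpace ℝ (Fin n)}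
    (hx : x ∈ ball (0 : EuclideanSpace ℝ (Fin n)) 1) (hx0 : x ≠ 0)
    {u : EuclideanSpace ℝ (Fin n) → ℝ} (hu : IsHarmonicOnBall n u)
    (hub : ∃ M : ℝ, ∀ y ∈ ball (0 : EuclideanSpace ℝ (Fin n)) 1, |u y| ≤ M) :
    ‖gradient u x‖ ≤ poissonDerivNorm x (‖x‖⁻¹ • x) * supAbs n u := by
  have hS : 0 ≤ supAbs n u := (abs_nonneg _).trans (abs_le_supAbs hub hx)
  rcases eq_or_ne (gradient u x) 0 with h0 | h0
  · rw [h0, norm_zero]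
    exact mul_nonneg (poissonDerivNorm_nonneg _ _) hS
  set ℓ := ‖gradient u x‖⁻¹ • gradient u x with hℓ
  have hℓ1 : ‖ℓ‖ = 1 := norm_smul_inv_norm (𝕜 := ℝ) h0
  have hg : ‖gradient u x‖ = fderiv ℝ u x ℓ := by
    rw [← inner_gradient_eq_fderiv, hℓ, inner_smul_right, real_inner_self_eq_norm_sq]
    field_simp
  obtain ⟨hu2, hΔ⟩ := isHarmonicOnBall_iff.1 hu
  calc ‖gradient u x‖ = fderiv ℝ u x ℓ := hg
    _ ≤ supAbs n u * poissonDerivNorm x ℓ := (le_abs_self _).trans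
        (abs_fderiv_le_of_laplacian_eq_zero hu2 hΔ (fun y hy => abs_le_supAbs hub hy) hx ℓ)
    _ ≤ supAbs n u * poissonDerivNorm x (‖x‖⁻¹ • x) := mul_le_mul_of_nonneg_left
        (poissonDerivNorm_le_radial (by rwa [finrank_euclideanSpace_fin])
          (mem_ball_zero_iff.1 hx) hx0 hℓ1) hS
    _ = poissonDerivNorm x (‖x‖⁻¹ • x) * supAbs n u := mul_comm _ _

end Constants

theorem generalized_khavinson_conjecture (n : ℕ) (hn : 3 ≤ n)
    (x : EuclideanSpace ℝ (Fin n)) (hx : x ∈ Metric.ball (0 : EuclideanSpace ℝ (Fin n)) 1)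
    (hx0 : x ≠ 0) :
    gradConst n x = dirConst n x (‖x‖⁻¹ • x) := by
  have : Nontrivial (EuclideanSpace ℝ (Fin n)) := nontrivial_of_ne x 0 hx0
  rw [gradConst, dirConst]
  congr 1
  ext c
  refine ⟨fun hc u hu hub => ?_, fun hc u hu hub => ?_⟩
  · have he : ‖‖x‖⁻¹ • x‖ = 1 := norm_smul_inv_norm (𝕜 := ℝ) hx0
    refine le_trans ?_ (hc u hu hub)
    simpa [he] using abs_real_inner_le_norm (gradient u x) (‖x‖⁻¹ • x)
  · refine (norm_gradient_le_poissonDerivNorm_mul_supAbs hn hx hx0 hu hub).trans ?_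
    exact mul_le_mul_of_nonneg_right (poissonDerivNorm_le_of_forall hx hc)
      ((abs_nonneg _).trans (abs_le_supAbs hub hx))
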